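/- arXiv:2601.14193 — 3 statements merged into one kernel-verified Lean document; each statement's English description precedes it below -/
import Mathlib

section
/- Let n ≥ 2. Any n+2 translation invariant curvature measures on ℝⁿ, each of which is SO(n) invariant (i.e., satisfies Φ(ρK, ρβ) = Φ(K, β) for every rotation ρ ∈ SO(n), every convex body K, and every Borel set β), are linearly dependent over ℂ. In other words, the complex vector space of SO(n) invariant translation invariant curvature measures on ℝⁿ has dimension at most n+1. -/
open MeasureTheory Metric Filter Topology
open scoped Pointwise

/-- ℝⁿ as Euclidean space. -/
abbrev Rn (n : ℕ) := EuclideanSpace ℝ (Fin n)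

/-- A convex body: a nonempty compact convex subset of ℝⁿ. -/
def IsConvexBody {n : ℕ} (K : Set (Rn n)) : Prop :=
  K.Nonempty ∧ IsCompact K ∧ Convex ℝ K

/-- Integral of a complex-valued function against a finite complex Borel measure,
defined via the Jordan decompositions of the real and imaginary parts. -/
noncomputable def cmIntegral {n : ℕ} (μ : ComplexMeasure (Rn n)) (f : Rn n → ℂ) : ℂ :=
  ((∫ x, f x ∂(ComplexMeasure.re μ).toJordanDecomposition.posPart)
    - (∫ x, f x ∂(ComplexMeasure.re μ).toJordanDecomposition.negPart))
  + Complex.I * ((∫ x, f x ∂(ComplexMeasure.im μ).toJordanDecomposition.posPart)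
    - (∫ x, f x ∂(ComplexMeasure.im μ).toJordanDecomposition.negPart))

/-- The total variation measure of a finite complex Borel measure (a set is null for this
measure iff it is null for the classical total variation measure). -/
noncomputable def cmVariation {n : ℕ} (μ : ComplexMeasure (Rn n)) : Measure (Rn n) :=
  (ComplexMeasure.re μ).totalVariation + (ComplexMeasure.im μ).totalVariation

/-- A translation invariant curvature measure on ℝⁿ: a map assigning to each convex body
a finite complex Borel measure, which is local, translation invariant, and weakly continuous
with respect to Hausdorff convergence of convex bodies. -/
structure CurvatureMeasure (n : ℕ) where
  /-- the finite complex Borel measure associated to a convex body -/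
  meas : Set (Rn n) → ComplexMeasure (Rn n)
  locality : ∀ K L U : Set (Rn n), IsConvexBody K → IsConvexBody L → IsOpen U →
    K ∩ U = L ∩ U → ∀ β : Set (Rn n), MeasurableSet β → β ⊆ U → meas K β = meas L β
  translation_invariant : ∀ K : Set (Rn n), IsConvexBody K → ∀ x : Rn n,
    ∀ β : Set (Rn n), MeasurableSet β →
      meas ((fun y => y + x) '' K) ((fun y => y + x) '' β) = meas K β
  continuity : ∀ (Ki : ℕ → Set (Rn n)) (K : Set (Rn n)), (∀ i, IsConvexBody (Ki i)) →
    IsConvexBody K → Tendsto (fun i => hausdorffDist (Ki i) K) atTop (𝓝 0) →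
    ∀ f : BoundedContinuousFunction (Rn n) ℂ,
      Tendsto (fun i => cmIntegral (meas (Ki i)) f) atTop (𝓝 (cmIntegral (meas K) f))

/-- A curvature measure is homogeneous of degree `k`. -/
def CurvatureMeasure.Homogeneous {n : ℕ} (Φ : CurvatureMeasure n) (k : ℕ) : Prop :=
  ∀ t : ℝ, 0 < t → ∀ K : Set (Rn n), IsConvexBody K → ∀ β : Set (Rn n), MeasurableSet β →
    Φ.meas (t • K) (t • β) = (t : ℂ) ^ k * Φ.meas K β

/-- A curvature measure is SO(n) invariant: invariant under every orientation preserving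
linear isometry (rotation) of ℝⁿ. -/
def CurvatureMeasure.SOInvariant {n : ℕ} (Φ : CurvatureMeasure n) : Prop :=
  ∀ ρ : Rn n ≃ₗᵢ[ℝ] Rn n, 0 < LinearMap.det (ρ.toLinearEquiv : Rn n →ₗ[ℝ] Rn n) →
    ∀ K : Set (Rn n), IsConvexBody K → ∀ β : Set (Rn n), MeasurableSet β →
      Φ.meas (ρ '' K) (ρ '' β) = Φ.meas K β



/-- signed measures -/
noncomputable def sgn4 {n : ℕ} (c : ComplexMeasure (Rn n)) (t : Fin 4) : SignedMeasure (Rn n) :=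
  ![ComplexMeasure.re c, -ComplexMeasure.re c, ComplexMeasure.im c, -ComplexMeasure.im c] t

/-- positive parts -/
noncomputable def part {n : ℕ} (c : ComplexMeasure (Rn n)) (t : Fin 4) : Measure (Rn n) :=
  (sgn4 c t).toJordanDecomposition.posPart

/-- weights -/
noncomputable def w4 (t : Fin 4) : ℂ := ![1, -1, Complex.I, -Complex.I] t

instance {n : ℕ} (c : ComplexMeasure (Rn n)) (t : Fin 4) : IsFiniteMeasure (part c t) := by
  unfold part; infer_instance

theorem posPart_exists {α : Type*} [MeasurableSpace α] (s : SignedMeasure α) (E : Set α)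
    (hE : MeasurableSet E) : ∃ A, MeasurableSet A ∧ A ⊆ E ∧
      s.toJordanDecomposition.posPart E = ENNReal.ofReal (s A) := by
  obtain ⟨i, hi, h0, h1, h2, h3⟩ := s.toJordanDecomposition_spec
  refine ⟨i ∩ E, hi.inter hE, Set.inter_subset_right, ?_⟩
  rw [h2, SignedMeasure.toMeasureOfZeroLE_apply _ _ hi hE]
  rw [ENNReal.ofReal, ← ENNReal.coe_inj.2]
  apply NNReal.eq
  have : 0 ≤ s (i ∩ E) := VectorMeasure.nonneg_of_zero_le_restrict _ (VectorMeasure.zero_le_restrict_subset _ hi Set.inter_subset_left h0)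
  simp [this]

theorem ofReal_le_posPart {α : Type*} [MeasurableSpace α] (s : SignedMeasure α) (A E : Set α)
    (hA : MeasurableSet A) (h : A ⊆ E) :
      ENNReal.ofReal (s A) ≤ s.toJordanDecomposition.posPart E := by
  refine le_trans ?_ (measure_mono h)
  rw [s.apply_eq_posPart_real_sub_negPart_real hA]
  refine ENNReal.ofReal_le_of_le_toReal ?_
  have : 0 ≤ s.toJordanDecomposition.negPart.real A := measureReal_nonneg
  change _ ≤ s.toJordanDecomposition.posPart.real A
  linarith

theorem cm_re_apply {n : ℕ} (c : ComplexMeasure (Rn n)) (A : Set (Rn n)) :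
    (ComplexMeasure.re c) A = (c A).re := rfl

theorem cm_im_apply {n : ℕ} (c : ComplexMeasure (Rn n)) (A : Set (Rn n)) :
    (ComplexMeasure.im c) A = (c A).im := rfl

theorem sgn4_apply {n : ℕ} (c : ComplexMeasure (Rn n)) (t : Fin 4) (A : Set (Rn n)) :
    sgn4 c t A = ![(c A).re, -(c A).re, (c A).im, -(c A).im] t := by
  fin_cases t <;> rfl

theorem sgn4_congr {n : ℕ} (c c' : ComplexMeasure (Rn n)) (t : Fin 4) (A A' : Set (Rn n))
    (h : c' A' = c A) : sgn4 c' t A' = sgn4 c t A := by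
  rw [sgn4_apply, sgn4_apply, h]

theorem sgn4_le {n : ℕ} (c : ComplexMeasure (Rn n)) (t : Fin 4) (A : Set (Rn n)) :
    sgn4 c t A ≤ ‖c A‖ := by
  have h1 := Complex.abs_re_le_norm (c A)
  have h2 := Complex.abs_im_le_norm (c A)
  rw [abs_le] at h1 h2
  rw [sgn4_apply]
  fin_cases t <;> simp <;> linarith

theorem part_le {n : ℕ} (c : ComplexMeasure (Rn n)) (t : Fin 4) (E : Set (Rn n))
    (hE : MeasurableSet E) (C : ℝ) (h : ∀ A, MeasurableSet A → A ⊆ E → ‖c A‖ ≤ C) :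
    part c t E ≤ ENNReal.ofReal C := by
  obtain ⟨A, hA, hAE, h1⟩ := posPart_exists (sgn4 c t) E hE
  rw [part, h1]
  exact ENNReal.ofReal_le_ofReal ((sgn4_le c t A).trans (h A hA hAE))

theorem part_image {n : ℕ} (c c' : ComplexMeasure (Rn n)) (t : Fin 4) (e : Rn n ≃ₜ Rn n)
    (E : Set (Rn n)) (hE : MeasurableSet E)
    (h : ∀ A, MeasurableSet A → A ⊆ E → c' (e '' A) = c A) :
    part c' t (e '' E) = part c t E := by
  have him : ∀ A, MeasurableSet A → MeasurableSet (e '' A) := fun A hA =>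
    e.toMeasurableEquiv.measurableSet_image.2 hA
  apply le_antisymm
  · obtain ⟨B, hB, hBE, h1⟩ := posPart_exists (sgn4 c' t) (e '' E) (him E hE)
    have hBe : e '' (e ⁻¹' B) = B := e.image_preimage B
    have hBE' : e ⁻¹' B ⊆ E := by
      intro x hx
      obtain ⟨y, hy, hyx⟩ := hBE hx
      rwa [← e.injective hyx]
    rw [part, h1, ← hBe, sgn4_congr c c' t _ _ (h _ (e.continuous.measurable hB) hBE')]
    exact ofReal_le_posPart _ _ _ (e.continuous.measurable hB) hBE'
  · obtain ⟨B, hB, hBE, h1⟩ := posPart_exists (sgn4 c t) E hE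
    rw [part, h1, ← sgn4_congr c c' t _ _ (h _ hB hBE)]
    exact ofReal_le_posPart _ _ _ (him _ hB) (Set.image_mono hBE)

theorem apply_eq_parts {n : ℕ} (c : ComplexMeasure (Rn n)) (E : Set (Rn n)) (hE : MeasurableSet E) :
    c E = ∑ t, w4 t * ((part c t).real E : ℂ) := by
  have h1 := (ComplexMeasure.re c).apply_eq_posPart_real_sub_negPart_real hE
  have h2 := (ComplexMeasure.im c).apply_eq_posPart_real_sub_negPart_real hE
  have h1' : (ComplexMeasure.re c) E = (c E).re := by
    exact cm_re_apply c E
  have h2' : (ComplexMeasure.im c) E = (c E).im := by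
    exact cm_im_apply c E
  rw [h1'] at h1
  rw [h2'] at h2
  rw [← Complex.re_add_im (c E), h1, h2]
  simp [Fin.sum_univ_four, w4, part, sgn4, SignedMeasure.toJordanDecomposition_neg]
  ring

theorem cmIntegral_eq_parts {n : ℕ} (c : ComplexMeasure (Rn n)) (f : Rn n → ℂ) :
    cmIntegral c f = ∑ t, w4 t * ∫ x, f x ∂(part c t) := by
  simp [cmIntegral, Fin.sum_univ_four, w4, part, sgn4, SignedMeasure.toJordanDecomposition_neg]
  ring

theorem norm_w4 (t : Fin 4) : ‖w4 t‖ = 1 := by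
  fin_cases t <;> simp [w4]


theorem approx_cm {n : ℕ} {ι : Type*} [Fintype ι] (c : ι → ComplexMeasure (Rn n))
    (β : Set (Rn n)) (hβ : MeasurableSet β) (η : ℝ) (hη : 0 < η) :
    ∃ f : BoundedContinuousFunction (Rn n) ℂ, ‖f‖ ≤ 1 ∧
      ∀ j, ‖cmIntegral (c j) f - c j β‖ ≤ η := by
  classical
  set μ : Measure (Rn n) := ∑ p : ι × Fin 4, part (c p.1) p.2 with hμ
  have hle : ∀ j t, part (c j) t ≤ μ := by
    intro j t
    have := Finset.single_le_sum (f := fun p : ι × Fin 4 => part (c p.1) p.2)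
      (fun i _ => bot_le) (Finset.mem_univ (j, t))
    exact this
  have hη' : ENNReal.ofReal (η / 8) ≠ 0 := by simpa using by linarith
  obtain ⟨F, hFβ, hF, hμF⟩ := hβ.exists_isClosed_sdiff_lt (measure_ne_top μ β) hη'
  obtain ⟨U, hβU, hU, _, hμU⟩ := hβ.exists_isOpen_sdiff_lt (measure_ne_top μ β) hη'
  obtain ⟨g, hg0, hg1, hg⟩ := exists_bounded_zero_one_of_closed hU.isClosed_compl hF
    (by rw [Set.disjoint_compl_left_iff_subset]; exact hFβ.trans hβU)
  let f : BoundedContinuousFunction (Rn n) ℂ :=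
    BoundedContinuousFunction.ofNormedAddCommGroup (fun x => (g x : ℂ)) (by fun_prop) 1
      (by intro x; simp only [Complex.norm_real, Real.norm_eq_abs]; rw [abs_of_nonneg (hg x).1]; exact (hg x).2)
  refine ⟨f, BoundedContinuousFunction.norm_ofNormedAddCommGroup_le _ zero_le_one _, ?_⟩
  intro j
  have key : ∀ t, ‖(∫ x, f x ∂(part (c j) t)) - ((part (c j) t).real β : ℂ)‖ ≤ η / 4 := by
    intro t
    have e1 : ((part (c j) t).real β : ℂ) = ∫ x, β.indicator (fun _ => (1:ℂ)) x ∂(part (c j) t) := by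
      rw [integral_indicator hβ]; simp
    have hfi : Integrable f (part (c j) t) := f.integrable _
    have hbi : Integrable (β.indicator (fun _ => (1:ℂ))) (part (c j) t) :=
      (integrable_const _).indicator hβ
    rw [e1, ← integral_sub hfi hbi]
    have hUF : MeasurableSet (U \ F) := hU.measurableSet.diff hF.measurableSet
    calc ‖∫ x, (f x - β.indicator (fun _ => (1:ℂ)) x) ∂(part (c j) t)‖
        ≤ ∫ x, (U \ F).indicator (fun _ => (1:ℝ)) x ∂(part (c j) t) := by
          apply norm_integral_le_of_norm_le ((integrable_const _).indicator hUF)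
          refine Filter.Eventually.of_forall fun x => ?_
          change ‖(g x : ℂ) - _‖ ≤ _
          by_cases hxF : x ∈ F
          · have := hg1 hxF
            simp only [Pi.one_apply] at this
            rw [this]; simp [hFβ hxF, hxF]
          · by_cases hxU : x ∈ U
            · have h1 := hg x
              by_cases hxβ : x ∈ β
              · simp only [hxβ, Set.indicator_of_mem, Set.mem_diff, hxU, hxF, not_false_eq_true, and_self]
                rw [← Complex.ofReal_one, ← Complex.ofReal_sub, Complex.norm_real, Real.norm_eq_abs, abs_le]
                constructor <;> linarith [h1.1, h1.2]
              · simp only [hxβ, Set.indicator_of_mem, Set.mem_diff, hxU, hxF, not_false_eq_true, and_self, Set.indicator_of_notMem, sub_zero]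
                rw [Complex.norm_real, Real.norm_eq_abs, abs_le]
                constructor <;> linarith [h1.1, h1.2]
            · have := hg0 (show x ∈ Uᶜ from hxU)
              simp only [Pi.zero_apply] at this
              have hxβ : x ∉ β := fun h => hxU (hβU h)
              rw [this]; simp [hxβ, hxU]
      _ = (part (c j) t).real (U \ F) := by rw [integral_indicator hUF]; simp
      _ ≤ η / 4 := by
          have h1 : (part (c j) t) (U \ F) ≤ ENNReal.ofReal (η / 4) := by
            calc (part (c j) t) (U \ F) ≤ μ (U \ F) := hle j t _
              _ ≤ μ ((U \ β) ∪ (β \ F)) := measure_mono (by intro x hx; by_cases h : x ∈ β; exacts [Or.inr ⟨h, hx.2⟩, Or.inl ⟨hx.1, h⟩])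
              _ ≤ μ (U \ β) + μ (β \ F) := measure_union_le _ _
              _ ≤ ENNReal.ofReal (η / 8) + ENNReal.ofReal (η / 8) := add_le_add hμU.le hμF.le
              _ = ENNReal.ofReal (η / 4) := by rw [← ENNReal.ofReal_add] <;> [congr 1; skip; skip] <;> linarith
          exact ENNReal.toReal_le_of_le_ofReal (by linarith) h1
  rw [cmIntegral_eq_parts, apply_eq_parts _ _ hβ, ← Finset.sum_sub_distrib]
  refine (norm_sum_le _ _).trans ?_
  calc ∑ t, ‖w4 t * (∫ x, f x ∂(part (c j) t)) - w4 t * ((part (c j) t).real β : ℂ)‖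
      ≤ ∑ t : Fin 4, η / 4 := by
        refine Finset.sum_le_sum fun t _ => ?_
        rw [← mul_sub, norm_mul, norm_w4, one_mul]; exact key t
    _ = η := by simp; ring

/-- integral as a continuous linear functional -/
noncomputable def cmL {n : ℕ} (c : ComplexMeasure (Rn n)) :
    BoundedContinuousFunction (Rn n) ℂ →L[ℂ] ℂ :=
  LinearMap.mkContinuous
    { toFun := fun f => cmIntegral c f
      map_add' := by
        intro f g
        simp only [cmIntegral_eq_parts, BoundedContinuousFunction.coe_add, Pi.add_apply]
        rw [← Finset.sum_add_distrib]
        refine Finset.sum_congr rfl fun t _ => ?_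
        rw [integral_add (f.integrable _) (g.integrable _), mul_add]
      map_smul' := by
        intro a f
        simp only [cmIntegral_eq_parts, BoundedContinuousFunction.coe_smul, RingHom.id_apply, smul_eq_mul]
        rw [Finset.mul_sum]
        refine Finset.sum_congr rfl fun t _ => ?_
        rw [integral_const_mul]; ring }
    (∑ t, (part c t).real Set.univ)
    (by
      intro f
      simp only [LinearMap.coe_mk, AddHom.coe_mk, cmIntegral_eq_parts]
      refine (norm_sum_le _ _).trans ?_
      rw [Finset.sum_mul]
      refine Finset.sum_le_sum fun t _ => ?_
      rw [norm_mul, norm_w4, one_mul, mul_comm]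
      exact norm_integral_le_of_norm_le_const (Filter.Eventually.of_forall fun x => f.norm_coe_le_norm x))

theorem blaschke {n : ℕ} (R : ℝ) (K : ℕ → Set (Rn n)) (hK : ∀ i, IsConvexBody (K i))
    (hR : ∀ i, K i ⊆ closedBall 0 R) :
    ∃ (L : Set (Rn n)) (φ : ℕ → ℕ), IsConvexBody L ∧ StrictMono φ ∧
      Tendsto (fun i => hausdorffDist (K (φ i)) L) atTop (𝓝 0) := by
  let N : ℕ → TopologicalSpace.NonemptyCompacts (Rn n) := fun i => ⟨⟨K i, (hK i).2.1⟩, (hK i).1⟩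
  have hc := TopologicalSpace.NonemptyCompacts.isCompact_subsets_of_isCompact
    (isCompact_closedBall (0 : Rn n) R)
  obtain ⟨L, _, φ, hφ, hlim⟩ := hc.tendsto_subseq (x := N) (fun i => hR i)
  have hd : Tendsto (fun i => hausdorffDist (K (φ i)) (L : Set (Rn n))) atTop (𝓝 0) := by
    have := tendsto_iff_dist_tendsto_zero.1 hlim
    simpa [Metric.NonemptyCompacts.dist_eq, Function.comp_def, N] using this
  refine ⟨L, φ, ⟨L.nonempty, L.isCompact, ?_⟩, hφ, hd⟩
  have hfin : ∀ i, hausdorffEDist (K (φ i)) (L : Set (Rn n)) ≠ ⊤ := fun i =>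
    hausdorffEDist_ne_top_of_nonempty_of_bounded (hK _).1 L.nonempty (hK _).2.1.isBounded L.isCompact.isBounded
  intro x hx y hy a b ha hb hab
  rw [← L.isCompact.isClosed.closure_eq, Metric.mem_closure_iff]
  intro ε hε
  have := (hd.eventually (gt_mem_nhds (show (0:ℝ) < ε / 2 by linarith))).exists
  obtain ⟨i, hi⟩ := this
  obtain ⟨x', hx', hxx⟩ := exists_dist_lt_of_hausdorffDist_lt' hx hi (hfin i)
  obtain ⟨y', hy', hyy⟩ := exists_dist_lt_of_hausdorffDist_lt' hy hi (hfin i)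
  obtain ⟨z, hz, hzz⟩ := exists_dist_lt_of_hausdorffDist_lt ((hK (φ i)).2.2 hx' hy' ha hb hab) hi (hfin i)
  refine ⟨z, hz, ?_⟩
  have h1 : dist (a • x + b • y) (a • x' + b • y') ≤ ε / 2 := by
    rw [dist_eq_norm, show a • x + b • y - (a • x' + b • y') = a • (x - x') + b • (y - y') by module]
    refine (norm_add_le _ _).trans ?_
    rw [norm_smul, norm_smul, Real.norm_of_nonneg ha, Real.norm_of_nonneg hb, ← dist_eq_norm, ← dist_eq_norm,
      dist_comm x, dist_comm y]
    nlinarith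
  linarith [dist_triangle (a • x + b • y) (a • x' + b • y') z]

theorem unif_bound {n : ℕ} (Φ : CurvatureMeasure n) (R : ℝ) : ∃ C : ℝ, ∀ K : Set (Rn n),
    IsConvexBody K → K ⊆ closedBall 0 R → ∀ β, MeasurableSet β → ‖Φ.meas K β‖ ≤ C := by
  by_contra! h
  choose K hK hR β hβ hb using fun i : ℕ => h (i : ℝ)
  obtain ⟨L, φ, hL, hφ, hlim⟩ := blaschke R K hK hR
  have hcv := Φ.continuity (fun i => K (φ i)) L (fun i => hK _) hL hlim
  obtain ⟨C, hC⟩ := banach_steinhaus (g := fun i => cmL (Φ.meas (K (φ i)))) (by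
    intro f
    obtain ⟨C, hC⟩ := (hcv f).norm.bddAbove_range
    exact ⟨C, fun i => hC ⟨i, rfl⟩⟩)
  obtain ⟨i, hi⟩ := exists_nat_gt (C + 1)
  obtain ⟨f, hf, hfj⟩ := approx_cm (fun _ : Unit => Φ.meas (K (φ i))) (β (φ i)) (hβ _) 1 one_pos
  have h1 := hfj ()
  have h2 : ‖cmIntegral (Φ.meas (K (φ i))) f‖ ≤ C := by
    have := (cmL (Φ.meas (K (φ i)))).le_of_opNorm_le (hC i) f
    have hC0 : 0 ≤ C := (norm_nonneg _).trans (hC i)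
    calc _ ≤ C * ‖f‖ := this
      _ ≤ C := by nlinarith
  have h3 := hb (φ i)
  have h4 : (i : ℝ) ≤ φ i := by exact_mod_cast hφ.id_le i
  have h5 := norm_sub_norm_le (Φ.meas (K (φ i)) (β (φ i))) (cmIntegral (Φ.meas (K (φ i))) f)
  rw [norm_sub_rev] at h5
  linarith


/-- positively oriented -/
def PosDet {n : ℕ} (ρ : Rn n ≃ₗᵢ[ℝ] Rn n) : Prop :=
  0 < LinearMap.det (ρ.toLinearEquiv : Rn n →ₗ[ℝ] Rn n)

/-- rigid motion -/
noncomputable def rig {n : ℕ} (ρ : Rn n ≃ₗᵢ[ℝ] Rn n) (v : Rn n) : Rn n ≃ᵢ Rn n :=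
  ρ.toIsometryEquiv.trans (IsometryEquiv.addRight v)

theorem rig_apply {n : ℕ} (ρ : Rn n ≃ₗᵢ[ℝ] Rn n) (v y : Rn n) : rig ρ v y = ρ y + v := rfl

theorem rig_image {n : ℕ} (ρ : Rn n ≃ₗᵢ[ℝ] Rn n) (v : Rn n) (A : Set (Rn n)) :
    rig ρ v '' A = (fun y => y + v) '' (ρ '' A) := by
  rw [Set.image_image]; rfl

theorem IsConvexBody.image_lin {n : ℕ} {K : Set (Rn n)} (hK : IsConvexBody K)
    (ρ : Rn n ≃ₗᵢ[ℝ] Rn n) : IsConvexBody (ρ '' K) :=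
  ⟨hK.1.image _, hK.2.1.image ρ.continuous, hK.2.2.linear_image (ρ.toLinearEquiv : Rn n →ₗ[ℝ] Rn n)⟩

theorem IsConvexBody.image_add {n : ℕ} {K : Set (Rn n)} (hK : IsConvexBody K)
    (v : Rn n) : IsConvexBody ((fun y => y + v) '' K) :=
  ⟨hK.1.image _, hK.2.1.image (by fun_prop), by
    have h : (fun y => y + v) = (fun y => v + y) := by funext y; exact add_comm _ _
    rw [h]; exact hK.2.2.translate v⟩

theorem IsConvexBody.image_rig {n : ℕ} {K : Set (Rn n)} (hK : IsConvexBody K)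
    (ρ : Rn n ≃ₗᵢ[ℝ] Rn n) (v : Rn n) : IsConvexBody (rig ρ v '' K) := by
  rw [rig_image]; exact (hK.image_lin ρ).image_add v

theorem meas_rig {n : ℕ} {Φ : CurvatureMeasure n} (hΦ : Φ.SOInvariant) {K K' : Set (Rn n)}
    (hK : IsConvexBody K) (hK' : IsConvexBody K') (ρ : Rn n ≃ₗᵢ[ℝ] Rn n) (hρ : PosDet ρ) (v : Rn n)
    (U : Set (Rn n)) (hU : IsOpen U) (h : rig ρ v '' K ∩ U = K' ∩ U) (A : Set (Rn n))
    (hA : MeasurableSet A) (hAU : rig ρ v '' A ⊆ U) :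
    Φ.meas K' (rig ρ v '' A) = Φ.meas K A := by
  have hm : MeasurableSet (rig ρ v '' A) :=
    (rig ρ v).toHomeomorph.toMeasurableEquiv.measurableSet_image.2 hA
  have hm' : MeasurableSet (ρ '' A) :=
    ρ.toHomeomorph.toMeasurableEquiv.measurableSet_image.2 hA
  rw [← Φ.locality _ _ U (hK.image_rig ρ v) hK' hU h _ hm hAU, rig_image, rig_image,
    Φ.translation_invariant _ (hK.image_lin ρ) v _ hm', hΦ ρ hρ K hK A hA]

theorem part_rig {n : ℕ} {Φ : CurvatureMeasure n} (hΦ : Φ.SOInvariant) {K K' : Set (Rn n)}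
    (hK : IsConvexBody K) (hK' : IsConvexBody K') (ρ : Rn n ≃ₗᵢ[ℝ] Rn n) (hρ : PosDet ρ) (v : Rn n)
    (U : Set (Rn n)) (hU : IsOpen U) (h : rig ρ v '' K ∩ U = K' ∩ U) (E : Set (Rn n))
    (hE : MeasurableSet E) (hEU : rig ρ v '' E ⊆ U) (t : Fin 4) :
    part (Φ.meas K') t (rig ρ v '' E) = part (Φ.meas K) t E :=
  part_image (Φ.meas K) (Φ.meas K') t (rig ρ v).toHomeomorph E hE
    (fun A hA hAE => meas_rig hΦ hK hK' ρ hρ v U hU h A hA ((Set.image_mono hAE).trans hEU))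

theorem posDet_refl {n : ℕ} : PosDet (LinearIsometryEquiv.refl ℝ (Rn n)) := by
  unfold PosDet
  have : ((LinearIsometryEquiv.refl ℝ (Rn n)).toLinearEquiv : Rn n →ₗ[ℝ] Rn n) = LinearMap.id := rfl
  rw [this]; simp

theorem part_compl {n : ℕ} (hn : 2 ≤ n) {Φ : CurvatureMeasure n} (hΦ : Φ.SOInvariant) {K : Set (Rn n)}
    (hK : IsConvexBody K) (t : Fin 4) : part (Φ.meas K) t Kᶜ = 0 := by
  have hU : Kᶜ = ⋃ N : ℕ, Kᶜ ∩ ball 0 N := by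
    rw [← Set.inter_iUnion, iUnion_ball_nat, Set.inter_univ]
  rw [hU, measure_iUnion_null_iff]
  intro N
  set U := Kᶜ ∩ ball (0 : Rn n) N with hUdef
  have hUo : IsOpen U := hK.2.1.isClosed.isOpen_compl.inter isOpen_ball
  obtain ⟨R, hR⟩ := hK.2.1.isBounded.subset_ball (0 : Rn n)
  let e : Rn n := EuclideanSpace.single ⟨0, by omega⟩ (1 : ℝ)
  have he : ‖e‖ = 1 := by simp [e]
  set D : ℝ := |R| + 2 * N + 1 with hD
  have hDpos : 0 < D := by positivity
  let v : ℕ → Rn n := fun i => (-((i + 1 : ℝ) * D)) • e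
  have hR' : R ≤ |R| := le_abs_self R
  have key : ∀ i, part (Φ.meas K) t ((fun y => y + v i) '' U) = part (Φ.meas K) t U := by
    intro i
    have h1 := part_rig hΦ (hK.image_add (-v i)) hK (LinearIsometryEquiv.refl ℝ _) posDet_refl (v i) Set.univ
      isOpen_univ (by
        rw [rig_image, Set.inter_univ, Set.inter_univ]
        simp only [LinearIsometryEquiv.coe_refl, Set.image_id, Set.image_image, id,
          neg_add_cancel_right, Set.image_id']) U hUo.measurableSet (Set.subset_univ _) t
    rw [rig_image] at h1
    simp only [LinearIsometryEquiv.coe_refl, Set.image_id] at h1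
    rw [h1]
    have h2 := part_rig hΦ (hK.image_add (-v i)) hK (LinearIsometryEquiv.refl ℝ _) posDet_refl 0 U
      hUo (by
        have hx : K ∩ U = ∅ := by ext x; simp +contextual [U]
        rw [hx, rig_image]
        simp only [LinearIsometryEquiv.coe_refl, Set.image_id, add_zero, Set.image_id']
        ext x
        simp only [Set.mem_inter_iff, Set.mem_image, Set.mem_empty_iff_false, iff_false]
        rintro ⟨⟨y, hy, rfl⟩, hyU⟩
        have hy1 := mem_ball_zero_iff.1 (hR hy)
        have hy2 := mem_ball_zero_iff.1 hyU.2
        have hv : ‖v i‖ = (i + 1) * D := by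
          simp only [v, norm_smul, he, mul_one, norm_neg, Real.norm_eq_abs]
          rw [abs_of_nonneg (by positivity)]
        have h3 : ‖v i‖ ≤ ‖y‖ + ‖y + -v i‖ := by
          have := norm_sub_le y (y + -v i)
          simpa using this
        have : D ≤ (i + 1) * D := by nlinarith [(Nat.cast_nonneg i : (0:ℝ) ≤ i)]
        have hN : (0:ℝ) ≤ N := Nat.cast_nonneg N
        linarith) U hUo.measurableSet (by rw [rig_image]; simp) t
    rw [rig_image] at h2
    simpa using h2.symm
  have hdisj : Pairwise (Function.onFun Disjoint fun i => (fun y => y + v i) '' U) := by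
    intro i j hij
    rw [Function.onFun, Set.disjoint_left]
    rintro _ ⟨y, hy, rfl⟩ ⟨z, hz, hzy⟩
    have hy2 := mem_ball_zero_iff.1 hy.2
    have hz2 := mem_ball_zero_iff.1 hz.2
    have h1 : z - y = v i - v j := by
      simp only at hzy
      rw [sub_eq_sub_iff_add_eq_add, hzy, add_comm]
    have h2 : v i - v j = (((j : ℝ) - i) * D) • e := by simp only [v]; module
    have h3 := norm_sub_le z y
    rw [h1, h2, norm_smul, he, mul_one, norm_mul, Real.norm_eq_abs, Real.norm_of_nonneg hDpos.le] at h3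
    have h4 : (1:ℝ) ≤ |(j:ℝ) - i| := by
      have : (1:ℤ) ≤ |(j:ℤ) - i| := Int.one_le_abs (by omega)
      exact_mod_cast this
    have : D ≤ |(j:ℝ) - i| * D := by nlinarith
    linarith [abs_nonneg R]
  by_contra hne
  have hsum := measure_iUnion (μ := part (Φ.meas K) t) hdisj (fun i =>
    (Homeomorph.addRight (v i)).toMeasurableEquiv.measurableSet_image.2 hUo.measurableSet)
  simp only [key] at hsum
  rw [ENNReal.tsum_const_eq_top_of_ne_zero hne] at hsum
  exact measure_ne_top _ _ hsum

/-- germ equivalence -/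
def GermEq {n : ℕ} (K : Set (Rn n)) (y : Rn n) (K' : Set (Rn n)) (y' : Rn n) : Prop :=
  ∃ (ρ : Rn n ≃ₗᵢ[ℝ] Rn n) (v : Rn n), PosDet ρ ∧ rig ρ v y = y' ∧ ∃ δ > 0,
    rig ρ v '' K ∩ ball y' δ = K' ∩ ball y' δ

theorem GermEq.eventually {n : ℕ} {K K' : Set (Rn n)} {y y' : Rn n} (h : GermEq K y K' y')
    (hK : IsConvexBody K) (hK' : IsConvexBody K') :
    ∀ᶠ r in 𝓝[>] (0:ℝ), ∀ Φ : CurvatureMeasure n, Φ.SOInvariant → ∀ t,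
      part (Φ.meas K') t (closedBall y' r) = part (Φ.meas K) t (closedBall y r) := by
  obtain ⟨ρ, v, hρ, hy, δ, hδ, hg⟩ := h
  filter_upwards [nhdsWithin_le_nhds (gt_mem_nhds hδ)] with r hr Φ hΦ t
  have him : rig ρ v '' closedBall y r = closedBall y' r := by
    rw [← hy]; exact (rig ρ v).image_closedBall y r
  rw [← part_rig hΦ hK hK' ρ hρ v (ball y' δ) isOpen_ball hg _ measurableSet_closedBall
    (by rw [him]; exact closedBall_subset_ball hr) t, him]


theorem exists_onb {n : ℕ} (V : Submodule ℝ (Rn n)) (u : Rn n) (hu : u ∈ Vᗮ) (hu1 : ‖u‖ = 1)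
    (k : ℕ) (hk : Module.finrank ℝ V = k) (hkn : k < n) :
    ∃ b : OrthonormalBasis (Fin n) ℝ (Rn n), Submodule.span ℝ (b '' {i | i.1 < k}) = V ∧
      b ⟨k, hkn⟩ = u := by
  subst hk
  let s0 := stdOrthonormalBasis ℝ V
  let f : Fin n → Rn n := fun i => if h : i.1 < Module.finrank ℝ V then (s0 ⟨i.1, h⟩ : Rn n) else u
  let s : Set (Fin n) := {i | i.1 ≤ Module.finrank ℝ V}
  have ho : Orthonormal ℝ (s.domRestrict f) := by
    constructor
    · rintro ⟨i, hi⟩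
      simp only [Set.domRestrict, f]
      split_ifs with h
      · exact s0.orthonormal.1 _
      · exact hu1
    · rintro ⟨i, hi⟩ ⟨j, hj⟩ hij
      have hij' : i.1 ≠ j.1 := fun h => hij (by ext; exact h)
      simp only [s, Set.mem_setOf_eq] at hi hj
      simp only [Set.domRestrict, f]
      split_ifs with h h' h'
      · have := s0.orthonormal.2 (i := ⟨i.1, h⟩) (j := ⟨j.1, h'⟩) (by simpa using hij')
        simpa using this
      · exact (Submodule.mem_orthogonal V u).1 hu _ (s0 ⟨i.1, h⟩).2
      · rw [real_inner_comm]
        exact (Submodule.mem_orthogonal V u).1 hu _ (s0 ⟨j.1, h'⟩).2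
      · omega
  obtain ⟨b, hb⟩ := Orthonormal.exists_orthonormalBasis_extension_of_card_eq (𝕜 := ℝ) (E := Rn n) (ι := Fin n)
    (by simp) ho
  refine ⟨b, ?_, ?_⟩
  · have hle : Submodule.span ℝ (b '' {i | i.1 < Module.finrank ℝ V}) ≤ V := by
      rw [Submodule.span_le]
      rintro _ ⟨i, hi, rfl⟩
      simp only [Set.mem_setOf_eq] at hi
      rw [hb i (le_of_lt hi)]
      simp only [f, dif_pos hi]
      exact (s0 ⟨i.1, hi⟩).2
    apply Submodule.eq_of_le_of_finrank_eq hle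
    have := b.toBasis.linearIndependent
    have h2 := (this.comp (fun i : {i : Fin n | i.1 < Module.finrank ℝ V} => i.1) Subtype.val_injective)
    have h3 := finrank_span_eq_card h2
    have h4 : Set.range (b.toBasis ∘ fun i : {i : Fin n | i.1 < Module.finrank ℝ V} => i.1) = b '' {i | i.1 < Module.finrank ℝ V} := by
      rw [Set.range_comp, Subtype.range_coe]; simp
    rw [h4] at h3
    rw [h3, Fintype.card_subtype]
    simp only [Set.mem_setOf_eq]
    rw [Fin.card_filter_val_lt]
    omega
  · rw [hb _ (by simp [s])]
    simp [f]

theorem exists_rotation {n : ℕ} (hn : 2 ≤ n) (V V' : Submodule ℝ (Rn n)) (u u' : Rn n)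
    (hu : u ∈ Vᗮ) (hu1 : ‖u‖ = 1) (hu' : u' ∈ V'ᗮ) (hu1' : ‖u'‖ = 1)
    (hd : Module.finrank ℝ V = Module.finrank ℝ V') :
    ∃ ρ : Rn n ≃ₗᵢ[ℝ] Rn n, PosDet ρ ∧ ρ '' (V : Set (Rn n)) = V' ∧ ρ u = u' := by
  have hkn : Module.finrank ℝ V < n := by
    have h1 : V ≠ ⊤ := by
      rintro rfl
      simp at hu
      simp [hu] at hu1
    have := Submodule.finrank_lt h1
    simpa using this
  obtain ⟨b, hbV, hbu⟩ := exists_onb V u hu hu1 _ rfl hkn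
  obtain ⟨b', hbV', hbu'⟩ := exists_onb V' u' hu' hu1' (Module.finrank ℝ V) hd.symm hkn
  have fin : ∀ ρ : Rn n ≃ₗᵢ[ℝ] Rn n, (∀ i, ρ (b i) = b' i ∨ ρ (b i) = - b' i) →
      ρ '' (V : Set (Rn n)) = V' := by
    intro ρ h
    have hle : V.map (ρ.toLinearEquiv : Rn n →ₗ[ℝ] Rn n) ≤ V' := by
      rw [← hbV, Submodule.map_span, Submodule.span_le]
      rintro _ ⟨_, ⟨i, hi, rfl⟩, rfl⟩
      have hm : b' i ∈ V' := by
        rw [← hbV']; exact Submodule.subset_span ⟨i, hi, rfl⟩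
      rcases h i with h | h
      · change ρ (b i) ∈ V'
        rw [h]; exact hm
      · change ρ (b i) ∈ V'
        rw [h]; exact V'.neg_mem hm
    have := Submodule.eq_of_le_of_finrank_eq hle (by
      rw [LinearEquiv.finrank_map_eq, hd])
    rw [← this]; rfl
  let ρ := b.equiv b' (Equiv.refl _)
  have hρ : ∀ i, ρ (b i) = b' i := fun i => by simp [ρ]
  have hne : LinearMap.det (ρ.toLinearEquiv : Rn n →ₗ[ℝ] Rn n) ≠ 0 := by
    exact (LinearEquiv.isUnit_det' ρ.toLinearEquiv).ne_zero
  rcases lt_or_gt_of_ne hne with h | h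
  · obtain ⟨j, hj⟩ : ∃ j : Fin n, j ≠ ⟨Module.finrank ℝ V, hkn⟩ := by
      have : Nontrivial (Fin n) := Fin.nontrivial_iff_two_le.2 hn
      exact exists_ne _
    let W : Submodule ℝ (Rn n) := (Submodule.span ℝ {b' j})ᗮ
    let σ := W.reflection
    have hσ1 : ∀ i, i ≠ j → σ (b' i) = b' i := by
      intro i hi
      apply Submodule.reflection_mem_subspace_eq_self
      rw [Submodule.mem_orthogonal_singleton_iff_inner_right]
      exact b'.orthonormal.2 hi.symm
    have hσ2 : σ (b' j) = - b' j := by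
      apply Submodule.reflection_mem_subspace_orthogonalComplement_eq_neg
      exact Submodule.le_orthogonal_orthogonal _ (Submodule.mem_span_singleton_self _)
    refine ⟨ρ.trans σ, ?_, fin _ ?_, ?_⟩
    · have h1 : LinearMap.det (σ.toLinearEquiv : Rn n →ₗ[ℝ] Rn n) = -1 := by
        have := W.det_reflection
        have h2 : Wᗮ = Submodule.span ℝ {b' j} := Submodule.orthogonal_orthogonal _
        rw [h2, finrank_span_singleton (b'.orthonormal.ne_zero j)] at this
        rw [pow_one] at this
        exact this
      unfold PosDet
      have h3 : ((ρ.trans σ).toLinearEquiv : Rn n →ₗ[ℝ] Rn n) =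
        (σ.toLinearEquiv : Rn n →ₗ[ℝ] Rn n) ∘ₗ (ρ.toLinearEquiv : Rn n →ₗ[ℝ] Rn n) := rfl
      rw [h3, LinearMap.det_comp, h1]
      linarith
    · intro i
      simp only [LinearIsometryEquiv.trans_apply, hρ]
      by_cases hi : i = j
      · right; rw [hi, hσ2]
      · left; exact hσ1 i hi
    · rw [← hbu, LinearIsometryEquiv.trans_apply, hρ, hσ1 _ hj.symm, hbu']
  · exact ⟨ρ, h, fin ρ (fun i => Or.inl (hρ i)), by rw [← hbu, hρ, hbu']⟩

theorem exists_rotation_sphere {n : ℕ} (hn : 2 ≤ n) (u u' : Rn n) (h : ‖u‖ = ‖u'‖) :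
    ∃ ρ : Rn n ≃ₗᵢ[ℝ] Rn n, PosDet ρ ∧ ρ u = u' := by
  by_cases h0 : ‖u‖ = 0
  · refine ⟨LinearIsometryEquiv.refl ℝ _, posDet_refl, ?_⟩
    rw [h0] at h
    rw [norm_eq_zero.1 h0, norm_eq_zero.1 h.symm]; rfl
  · obtain ⟨ρ, hρ, -, h2⟩ := exists_rotation hn ⊥ ⊥ (‖u‖⁻¹ • u) (‖u‖⁻¹ • u') (by simp)
      (by rw [norm_smul, norm_inv, norm_norm, inv_mul_cancel₀ h0]) (by simp)
      (by rw [norm_smul, norm_inv, norm_norm, h, inv_mul_cancel₀ (h ▸ h0)]) rfl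
    refine ⟨ρ, hρ, ?_⟩
    rw [map_smul] at h2
    exact smul_right_injective _ (inv_ne_zero h0) h2


theorem packing (m : ℕ) (hm : 1 ≤ m) (e : ℝ) (he : 0 < e) :
    ∃ c > 0, ∃ r0 > 0, ∀ r, 0 < r → r ≤ r0 → ∃ (M : ℕ) (z : Fin M → Rn (m + 1)),
      (∀ i, ‖z i‖ = e) ∧ (∀ i j, i ≠ j → 3 * r ≤ dist (z i) (z j)) ∧ c ≤ M * r ^ m := by
  have hm0 : (0 : ℝ) < m := by exact_mod_cast hm
  refine ⟨(e / (6 * m)) ^ m, by positivity, e / (6 * m), by positivity, ?_⟩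
  intro r hr hr0
  set N := ⌊e / (3 * r * m)⌋₊ with hN
  let ι := Fin m → Fin N
  let t : ι → Fin m → ℝ := fun a i => 3 * r * (a i : ℕ)
  have ht : ∀ a, ∑ i, t a i ^ 2 ≤ e ^ 2 := by
    intro a
    have h1 : ∀ i, t a i ≤ e / m := by
      intro i
      have h2 : ((a i : ℕ) : ℝ) ≤ N := by exact_mod_cast (a i).2.le
      have h3 : (N : ℝ) ≤ e / (3 * r * m) := Nat.floor_le (by positivity)
      calc t a i ≤ 3 * r * (e / (3 * r * m)) := by
            simp only [t]; gcongr; exact h2.trans h3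
        _ = e / m := by field_simp
    have h0 : ∀ i, 0 ≤ t a i := fun i => by simp only [t]; positivity
    calc ∑ i, t a i ^ 2 ≤ ∑ i : Fin m, (e / m) ^ 2 :=
          Finset.sum_le_sum fun i _ => pow_le_pow_left₀ (h0 i) (h1 i) 2
      _ = e ^ 2 / m := by simp; field_simp
      _ ≤ e ^ 2 := div_le_self (by positivity) (by exact_mod_cast hm)
  let z : ι → Rn (m + 1) := fun a => WithLp.toLp 2 (Fin.cons (Real.sqrt (e ^ 2 - ∑ i, t a i ^ 2)) (t a))
  have hz1 : ∀ a, ‖z a‖ = e := by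
    intro a
    have : ‖z a‖ ^ 2 = e ^ 2 := by
      rw [EuclideanSpace.real_norm_sq_eq, Fin.sum_univ_succ]
      simp only [z, Fin.cons_zero, Fin.cons_succ]
      rw [Real.sq_sqrt (by linarith [ht a])]
      ring
    exact (pow_left_inj₀ (norm_nonneg _) he.le (by norm_num)).1 this
  have hz2 : ∀ a b, a ≠ b → 3 * r ≤ dist (z a) (z b) := by
    intro a b hab
    obtain ⟨i, hi⟩ := Function.ne_iff.1 hab
    have h1 : |z a i.succ - z b i.succ| ≤ dist (z a) (z b) := by
      rw [dist_eq_norm]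
      exact PiLp.norm_apply_le (z a - z b) i.succ
    refine le_trans ?_ h1
    simp only [z, Fin.cons_succ, t]
    rw [← mul_sub, abs_mul, abs_of_pos (by positivity : 0 < 3 * r)]
    have h2 : (1 : ℤ) ≤ |((a i : ℕ) : ℤ) - (b i : ℕ)| := Int.one_le_abs (by
      intro h
      apply hi
      ext; omega)
    have h3 : (1 : ℝ) ≤ |((a i : ℕ) : ℝ) - (b i : ℕ)| := by exact_mod_cast h2
    nlinarith
  refine ⟨Fintype.card ι, fun i => z ((Fintype.equivFin ι).symm i), fun i => hz1 _, fun i j hij => hz2 _ _ (by simpa using hij), ?_⟩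
  have hc : (Fintype.card ι : ℝ) = (N : ℝ) ^ m := by simp [ι]
  rw [hc, ← mul_pow]
  apply pow_le_pow_left₀ (by positivity)
  have h4 : e / (3 * r * m) - 1 ≤ N := (Nat.sub_one_lt_floor _).le
  have h5 : e / (6 * m) = (e / (6 * m) / r) * r := by field_simp
  have h6 : 1 ≤ e / (6 * m) / r := by rw [le_div_iff₀ hr]; linarith
  have h7 : e / (3 * r * m) = 2 * (e / (6 * m) / r) := by field_simp; norm_num
  rw [h5]
  gcongr
  linarith


/-- supported boundary point with inner ball -/
def Supp {n : ℕ} (K : Set (Rn n)) (ε : ℝ) (x : Rn n) : Prop :=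
  ∃ q u : Rn n, ‖u‖ = 1 ∧ x = q + ε • u ∧ closedBall q ε ⊆ K ∧ ∀ y ∈ K, inner ℝ (y - x) u ≤ 0

theorem inner_est {n : ℕ} (q u w y : Rn n) (ε r : ℝ) (hε : 0 < ε) (hr : 0 < r) (hu : ‖u‖ = 1)
    (hy : inner ℝ (y - (q + ε • u)) u ≤ 0) (hyr : ‖y - (q + ε • u)‖ ≤ r)
    (hw : ‖w - (q + (ε / 2) • u)‖ = ‖y - (q + (ε / 2) • u)‖) (hwx : 2 * r ≤ ‖w - (q + ε • u)‖) :
    ‖w - q‖ < ε := by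
  set d := y - (q + ε • u) with hd
  set p := q + (ε / 2) • u with hp
  have h1 : y - p = d + (ε / 2) • u := by rw [hd, hp]; module
  have h2 : ‖y - p‖ ^ 2 ≤ r ^ 2 + (ε / 2) ^ 2 := by
    rw [h1, norm_add_sq_real, inner_smul_right, norm_smul, hu, Real.norm_of_nonneg (by positivity)]
    have : ‖d‖ ^ 2 ≤ r ^ 2 := pow_le_pow_left₀ (norm_nonneg _) hyr 2
    have := mul_nonneg hε.le (neg_nonneg.2 hy)
    nlinarith
  have h3 : ‖w - q‖ ^ 2 + ‖w - (q + ε • u)‖ ^ 2 = 2 * ‖w - p‖ ^ 2 + 2 * (ε / 2) ^ 2 := by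
    have e1 : w - q = (w - p) + (ε / 2) • u := by rw [hp]; module
    have e2 : w - (q + ε • u) = (w - p) - (ε / 2) • u := by rw [hp]; module
    rw [e1, e2, norm_add_sq_real, norm_sub_sq_real (w - p) ((ε / 2) • u), norm_smul, hu, Real.norm_of_nonneg (by positivity)]
    ring
  rw [hw] at h3
  have h4 : (2 * r) ^ 2 ≤ ‖w - (q + ε • u)‖ ^ 2 := pow_le_pow_left₀ (by positivity) hwx 2
  apply lt_of_pow_lt_pow_left₀ 2 hε.le
  nlinarith

theorem density_bound {m : ℕ} (hm : 1 ≤ m) {Φ : CurvatureMeasure (m + 1)} (hΦ : Φ.SOInvariant)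
    {K : Set (Rn (m + 1))} (hK : IsConvexBody K) (ε : ℝ) (hε : 0 < ε) :
    ∃ C > 0, ∃ r0 > 0, ∀ x, Supp K ε x → ∀ r, 0 < r → r ≤ r0 → ∀ A, MeasurableSet A →
      A ⊆ K ∩ closedBall x r → ‖Φ.meas K A‖ ≤ C * r ^ m := by
  obtain ⟨c, hc, r0, hr0, hpack⟩ := packing m hm (ε / 2) (by positivity)
  obtain ⟨R, hR⟩ := hK.2.1.isBounded.subset_closedBall (0 : Rn (m + 1))
  obtain ⟨C0, hC0⟩ := unif_bound Φ (3 * R)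
  refine ⟨(|C0| + 1) / c, by positivity, r0, hr0, ?_⟩
  rintro x ⟨q, u, hu, rfl, hq, hsup⟩ r hr hrr A hA hAK
  obtain ⟨M, z, hz1, hz2, hM⟩ := hpack r hr hrr
  set p := q + (ε / 2) • u with hp
  have hrot : ∀ i, ∃ ρ : Rn (m + 1) ≃ₗᵢ[ℝ] Rn (m + 1), PosDet ρ ∧ ρ ((ε / 2) • u) = z i := by
    intro i
    apply exists_rotation_sphere (by omega)
    rw [hz1, norm_smul, hu, mul_one, Real.norm_of_nonneg (by positivity)]
  choose ρ hρ hρz using hrot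
  let g : Fin M → Rn (m + 1) ≃ᵢ Rn (m + 1) := fun i => rig (ρ i) (p - ρ i p)
  have gp : ∀ i, g i p = p := fun i => by simp [g, rig_apply]
  have gx : ∀ i, g i (q + ε • u) = p + z i := fun i => by
    have e : q + ε • u = p + (ε / 2) • u := by rw [hp]; module
    simp only [g, rig_apply]
    rw [e, map_add, hρz]; abel
  have hpK : p ∈ K := hq (by
    rw [mem_closedBall, dist_eq_norm, hp, add_sub_cancel_left, norm_smul, hu, mul_one,
      Real.norm_of_nonneg (by positivity)]
    linarith)
  have hMpos : 0 < M := by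
    rcases Nat.eq_zero_or_pos M with h | h
    · subst h; simp at hM; linarith
    · exact h
  have hRp : ‖p‖ ≤ R := mem_closedBall_zero_iff.1 (hR hpK)
  set L := ⋂ i, g i '' K with hL
  have hLsub : L ⊆ closedBall 0 (3 * R) := by
    intro y hy
    obtain ⟨k, hk, rfl⟩ := Set.mem_iInter.1 hy ⟨0, hMpos⟩
    have h1 : dist (g ⟨0, hMpos⟩ k) p = dist k p := by
      conv_lhs => rw [← gp ⟨0, hMpos⟩]
      exact (g _).dist_eq _ _
    have hk' : ‖k‖ ≤ R := mem_closedBall_zero_iff.1 (hR hk)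
    rw [mem_closedBall_zero_iff]
    rw [dist_eq_norm, dist_eq_norm] at h1
    have h2 := norm_sub_le k p
    have h3 := norm_le_norm_add_norm_sub' (g ⟨0, hMpos⟩ k) p
    linarith
  have hbody : ∀ i, IsConvexBody (g i '' K) := fun i => hK.image_rig _ _
  have hLb : IsConvexBody L := by
    refine ⟨⟨p, Set.mem_iInter.2 fun i => ⟨p, hpK, gp i⟩⟩, ?_, convex_iInter fun i => (hbody i).2.2⟩
    exact (hbody ⟨0, hMpos⟩).2.1.of_isClosed_subset (isClosed_iInter fun i => (hbody i).2.1.isClosed)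
      (Set.iInter_subset _ _)
  have hnear : ∀ i y, y ∈ A → dist (g i y) (g i (q + ε • u)) ≤ r := fun i y hy => by
    rw [(g i).dist_eq]; exact (hAK hy).2
  have hsep : ∀ i j, i ≠ j → 3 * r ≤ dist (g i (q + ε • u)) (g j (q + ε • u)) := by
    intro i j hij
    rw [gx, gx, dist_add_left]; exact hz2 i j hij
  let U : Fin M → Set (Rn (m + 1)) := fun i => ⋂ j ∈ {j | j ≠ i}, interior (g j '' K)
  have hUo : ∀ i, IsOpen (U i) := fun i =>
    (Set.toFinite {j | j ≠ i}).isOpen_biInter fun j _ => isOpen_interior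
  have hAU : ∀ i, g i '' A ⊆ U i := by
    rintro i _ ⟨y, hy, rfl⟩
    simp only [U, Set.mem_iInter]
    intro j hj
    have hj' : j ≠ i := hj
    obtain ⟨w, hw⟩ := (g j).surjective (g i y)
    have hwq : ‖w - q‖ < ε := by
      apply inner_est q u w y ε r hε hr hu (hsup y (hAK hy).1)
      · rw [← dist_eq_norm]; exact (hAK hy).2
      · rw [← dist_eq_norm, ← dist_eq_norm, ← hp, ← (g j).dist_eq, hw, gp]
        conv_lhs => rw [← gp i]
        exact (g i).dist_eq _ _
      · rw [← dist_eq_norm, ← (g j).dist_eq, hw]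
        have h1 := hsep i j hj'.symm
        have h2 := hnear i y hy
        have h3 := dist_triangle (g i (q + ε • u)) (g i y) (g j (q + ε • u))
        rw [dist_comm] at h2
        linarith
    rw [← hw]
    have : interior (g j '' K) = g j '' interior K := ((g j).toHomeomorph.image_interior K).symm
    rw [this]
    refine ⟨w, interior_mono hq ?_, rfl⟩
    exact ball_subset_interior_closedBall (by rwa [mem_ball, dist_eq_norm])
  have hloc : ∀ i, Φ.meas L (g i '' A) = Φ.meas K A := by
    intro i
    refine meas_rig hΦ hK hLb (ρ i) (hρ i) _ (U i) (hUo i) ?_ A hA (hAU i)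
    ext y
    simp only [Set.mem_inter_iff, and_congr_left_iff]
    intro hyU
    simp only [U, Set.mem_iInter] at hyU
    constructor
    · intro hy
      refine Set.mem_iInter.2 fun j => ?_
      by_cases hj : j = i
      · rw [hj]; exact hy
      · exact interior_subset (hyU j hj)
    · intro hy; exact Set.mem_iInter.1 hy i
  have hmeas : ∀ i, MeasurableSet (g i '' A) := fun i =>
    (g i).toHomeomorph.toMeasurableEquiv.measurableSet_image.2 hA
  have hdisj : Pairwise (Function.onFun Disjoint fun i => g i '' A) := by
    intro i j hij
    rw [Function.onFun, Set.disjoint_left]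
    rintro _ ⟨y, hy, rfl⟩ ⟨y', hy', hyy⟩
    have h1 := hsep i j hij
    have h2 := hnear i y hy
    have h4 := hnear j y' hy'
    rw [hyy] at h4
    have h3 := dist_triangle (g i (q + ε • u)) (g i y) (g j (q + ε • u))
    rw [dist_comm] at h2
    linarith
  have hsum := VectorMeasure.of_disjoint_iUnion (v := Φ.meas L) hmeas hdisj
  rw [tsum_fintype] at hsum
  simp only [hloc, Finset.sum_const, Finset.card_univ, Fintype.card_fin] at hsum
  have hb := hC0 L hLb hLsub (⋃ i, g i '' A) (MeasurableSet.iUnion hmeas)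
  rw [hsum, nsmul_eq_mul, norm_mul, Complex.norm_natCast] at hb
  have hM' : (0 : ℝ) < M := by exact_mod_cast hMpos
  have h1 : ‖Φ.meas K A‖ ≤ (|C0| + 1) / M := by
    rw [le_div_iff₀ hM']
    linarith [le_abs_self C0]
  refine h1.trans ?_
  rw [div_mul_eq_mul_div, div_le_div_iff₀ hM' hc]
  have := abs_nonneg C0
  nlinarith


theorem Supp.mem {n : ℕ} {K : Set (Rn n)} {ε : ℝ} (hε : 0 < ε) {x : Rn n} (h : Supp K ε x) : x ∈ K := by
  obtain ⟨q, u, hu, rfl, hq, -⟩ := h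
  apply hq
  rw [mem_closedBall, dist_eq_norm, add_sub_cancel_left, norm_smul, hu, mul_one,
      Real.norm_of_nonneg hε.le]

theorem null_of_hausdorff {m : ℕ} (hm : 1 ≤ m) {Φ : CurvatureMeasure (m + 1)} (hΦ : Φ.SOInvariant)
    {K : Set (Rn (m + 1))} (hK : IsConvexBody K) (ε : ℝ) (hε : 0 < ε) (t : Fin 4)
    (B : Set (Rn (m + 1))) (hB : ∀ x ∈ B, Supp K ε x) (hB0 : μH[(m : ℝ)] B = 0) :
    part (Φ.meas K) t B = 0 := by
  obtain ⟨C, hC, r0, hr0, hd⟩ := density_bound hm hΦ hK ε hε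
  set S := {x | Supp K ε x} with hS
  set μ := part (Φ.meas K) t with hμ
  have hC0 : ENNReal.ofReal C ≠ 0 := by simpa using hC
  have key : (ENNReal.ofReal C)⁻¹ • μ.restrict S ≤ μH[(m : ℝ)] := by
    apply Measure.le_hausdorffMeasure (m : ℝ) _ (ENNReal.ofReal (r0 / 2)) (by simpa using hr0)
    intro s hs
    have h1 : μ.restrict S s ≤ ENNReal.ofReal C * ediam s ^ (m : ℝ) := by
      calc μ.restrict S s ≤ μ.restrict S (closure s) := measure_mono subset_closure
        _ = μ (closure s ∩ S) := Measure.restrict_apply isClosed_closure.measurableSet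
        _ ≤ _ := ?_
      rcases (closure s ∩ S).eq_empty_or_nonempty with h | ⟨x, hxs, hxS⟩
      · rw [h]; simp
      have hfin : ediam s ≠ ⊤ := ne_top_of_le_ne_top ENNReal.ofReal_ne_top hs
      set D := (ediam s).toReal with hD
      have hDe : ediam s = ENNReal.ofReal D := (ENNReal.ofReal_toReal hfin).symm
      have hD0 : 0 ≤ D := ENNReal.toReal_nonneg
      have hDr : D < r0 := by
        have : D ≤ r0 / 2 := ENNReal.toReal_le_of_le_ofReal (by positivity) hs
        linarith
      have hev : ∀ᶠ r in 𝓝[>] D, μ (closure s ∩ S) ≤ ENNReal.ofReal (C * r ^ m) := by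
        filter_upwards [Ioo_mem_nhdsGT hDr] with r hr
        have hsub : closure s ∩ S ⊆ K ∩ closedBall x r := by
          rintro y ⟨hys, hyS⟩
          refine ⟨Supp.mem hε hyS, ?_⟩
          have : edist y x ≤ ediam (closure s) := edist_le_ediam_of_mem hys hxs
          rw [ediam_closure, hDe, edist_dist] at this
          have := (ENNReal.ofReal_le_ofReal_iff hD0).1 this
          exact this.trans hr.1.le
        refine (measure_mono hsub).trans ?_
        apply part_le _ _ _ (hK.2.1.isClosed.measurableSet.inter measurableSet_closedBall)
        intro A hA hAE
        exact hd x hxS r (hD0.trans_lt hr.1) hr.2.le A hA hAE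
      have ht : Tendsto (fun r : ℝ => ENNReal.ofReal (C * r ^ m)) (𝓝[>] D) (𝓝 (ENNReal.ofReal (C * D ^ m))) := by
        apply ENNReal.tendsto_ofReal
        have : Continuous fun r : ℝ => C * r ^ m := by fun_prop
        exact (this.tendsto D).mono_left nhdsWithin_le_nhds
      have := ge_of_tendsto ht hev
      rw [hDe, ENNReal.rpow_natCast, ← ENNReal.ofReal_pow hD0, ← ENNReal.ofReal_mul hC.le]
      exact this
    rw [Measure.smul_apply, smul_eq_mul]
    calc _ ≤ (ENNReal.ofReal C)⁻¹ * (ENNReal.ofReal C * ediam s ^ (m : ℝ)) := by gcongr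
      _ = _ := by rw [← mul_assoc, ENNReal.inv_mul_cancel hC0 ENNReal.ofReal_ne_top, one_mul]
  have h2 := key B
  rw [hB0, Measure.smul_apply, smul_eq_mul, nonpos_iff_eq_zero, mul_eq_zero] at h2
  have h3 : μ.restrict S B = 0 := by
    rcases h2 with h | h
    · simp at h
    · exact h
  have h4 : B ∩ S = B := Set.inter_eq_left.2 hB
  have h5 := Measure.le_restrict_apply (μ := μ) S B
  rw [h3, h4] at h5
  exact nonpos_iff_eq_zero.1 h5


theorem stereo_range {n : ℕ} (V : Submodule ℝ (Rn n)) (e u : Rn n) (he : e ∈ Vᗮ) (he1 : ‖e‖ = 1)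
    (hu : u ∈ Vᗮ) (hu1 : ‖u‖ = 1) (hne : u ≠ e) :
    ∃ w : (Vᗮ ⊓ (Submodule.span ℝ {e})ᗮ : Submodule ℝ (Rn n)), stereoInvFunAux e (w : Rn n) = u := by
  have h := stereo_left_inv he1 (x := ⟨u, by simpa using hu1⟩) hne
  have h2 := congrArg (Subtype.val) h
  refine ⟨⟨(stereoToFun e u : Rn n), ?_, (stereoToFun e u).2⟩, h2⟩
  rw [stereoToFun_apply]
  apply Submodule.smul_mem
  have h3 := Submodule.starProjection_add_starProjection_orthogonal (K := Submodule.span ℝ {e}) u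
  have h4 : ((Submodule.span ℝ {e})ᗮ.orthogonalProjectionOnto u : Rn n) = u - (Submodule.span ℝ {e}).starProjection u :=
    eq_sub_of_add_eq' h3
  rw [h4]
  apply Submodule.sub_mem _ hu
  have h5 : Submodule.span ℝ {e} ≤ Vᗮ := by
    rw [Submodule.span_singleton_le_iff_mem]; exact he
  exact h5 (Submodule.starProjection_apply_mem _ _)

/-- bad pieces -/
def Bd {n : ℕ} (t0 : Rn n) (V' V : Submodule ℝ (Rn n)) (ε : ℝ) : Set (Rn n) :=
  {y | ∃ v ∈ V', ∃ u ∈ Vᗮ, ‖u‖ = 1 ∧ y = t0 + v + ε • u}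

theorem Bd_null {m : ℕ} (t0 : Rn (m + 1)) (V' V : Submodule ℝ (Rn (m + 1))) (ε : ℝ)
    (h : Module.finrank ℝ V' < Module.finrank ℝ V) : μH[(m : ℝ)] (Bd t0 V' V ε) = 0 := by
  have key : ∀ e : Rn (m + 1), e ∈ Vᗮ → ‖e‖ = 1 → μH[(m : ℝ)]
      (Set.range fun a : V' × (Vᗮ ⊓ (Submodule.span ℝ {e})ᗮ : Submodule ℝ (Rn (m + 1))) =>
        t0 + (a.1 : Rn (m + 1)) + ε • stereoInvFunAux e (a.2 : Rn (m + 1))) = 0 := by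
    intro e he he1
    set W := (Vᗮ ⊓ (Submodule.span ℝ {e})ᗮ : Submodule ℝ (Rn (m + 1))) with hW
    have hc : ContDiff ℝ 1 (fun a : V' × W =>
        t0 + (a.1 : Rn (m + 1)) + ε • stereoInvFunAux e (a.2 : Rn (m + 1))) := by
      have h1 : ContDiff ℝ 1 (fun a : V' × W => (a.1 : Rn (m + 1))) :=
        V'.subtypeL.contDiff.comp contDiff_fst
      have h2 : ContDiff ℝ 1 (fun a : V' × W => (a.2 : Rn (m + 1))) :=
        W.subtypeL.contDiff.comp contDiff_snd
      have h3 : ContDiff ℝ 1 (fun a : V' × W => stereoInvFunAux e (a.2 : Rn (m + 1))) :=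
        contDiff_stereoInvFunAux.comp h2
      exact (contDiff_const.add h1).add (h3.const_smul ε)
    have hd := hc.dimH_range_le
    have hlt : Module.finrank ℝ W < Module.finrank ℝ Vᗮ := by
      apply Submodule.finrank_lt_finrank_of_lt
      refine lt_of_le_of_ne inf_le_left ?_
      intro heq
      have : e ∈ W := by rw [heq]; exact he
      have h2 := (Submodule.mem_orthogonal_singleton_iff_inner_right).1 this.2
      rw [real_inner_self_eq_norm_sq, he1] at h2
      norm_num at h2
    have hsum := Submodule.finrank_add_finrank_orthogonal V
    simp only [finrank_euclideanSpace, Fintype.card_fin] at hsum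
    have hfin : Module.finrank ℝ (V' × W) < m := by
      rw [Module.finrank_prod]; omega
    have := hausdorffMeasure_of_dimH_lt (d := (m : NNReal)) (hd.trans_lt (by exact_mod_cast hfin))
    simpa using this
  by_cases hex : ∃ e ∈ Vᗮ, ‖e‖ = 1
  · obtain ⟨e, he, he1⟩ := hex
    have hsub := measure_mono_null (μ := μH[(m : ℝ)]) (s := Bd t0 V' V ε) ?_
      (measure_union_null (key e he he1) (key (-e) (neg_mem he) (by simpa using he1)))
    · exact hsub
    · rintro _ ⟨v, hv, u, hu, hu1, rfl⟩
      by_cases hue : u = e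
      · right
        obtain ⟨w, hw⟩ := stereo_range V (-e) u (neg_mem he) (by simpa using he1) hu hu1 (by
          rw [hue]; intro h'
          have : e = 0 := by
            have h2 : (2 : ℝ) • e = 0 := by
              rw [two_smul]; nth_rewrite 2 [h']; exact add_neg_cancel e
            simpa using h2
          simp [this] at he1)
        exact ⟨(⟨v, hv⟩, w), by simp only [hw]⟩
      · left
        obtain ⟨w, hw⟩ := stereo_range V e u he he1 hu hu1 hue
        exact ⟨(⟨v, hv⟩, w), by simp only [hw]⟩
  · have : Bd t0 V' V ε = ∅ := by
      ext y
      simp only [Set.mem_empty_iff_false, iff_false]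
      rintro ⟨v, hv, u, hu, hu1, -⟩
      exact hex ⟨u, hu, hu1⟩
    rw [this]; simp


theorem relint_aux {n : ℕ} (T : Finset (Rn n)) (w : Rn n → ℝ) (hw : ∀ t ∈ T, 0 < w t)
    (hw1 : ∑ t ∈ T, w t = 1) (p : Rn n) (hp : ∑ t ∈ T, w t • t = p) :
    ∀ᶠ v : vectorSpan ℝ (T : Set (Rn n)) in 𝓝 0, p + (v : Rn n) ∈ convexHull ℝ (T : Set (Rn n)) := by
  let F : (T → ℝ) →ₗ[ℝ] Rn n := Fintype.linearCombination ℝ (fun t : T => (t : Rn n) - p)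
  have hF : ∀ c, F c = ∑ t : T, c t • ((t : Rn n) - p) := fun c => rfl
  have hle : vectorSpan ℝ (T : Set (Rn n)) ≤ LinearMap.range F := by
    rw [vectorSpan_def, Submodule.span_le]
    rintro _ ⟨a, ha, b, hb, rfl⟩
    refine ⟨Pi.single ⟨a, ha⟩ 1 - Pi.single ⟨b, hb⟩ 1, ?_⟩
    rw [map_sub]
    simp [F]
  obtain ⟨g, hg⟩ := F.rangeRestrict.exists_rightInverse_of_surjective (LinearMap.range_rangeRestrict F)
  let G : vectorSpan ℝ (T : Set (Rn n)) →ₗ[ℝ] (T → ℝ) := g ∘ₗ Submodule.inclusion hle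
  have hG : ∀ v, F (G v) = v := by
    intro v
    have := congrArg Subtype.val (LinearMap.congr_fun hg (Submodule.inclusion hle v))
    exact this
  have hGc : Continuous G := G.continuous_of_finiteDimensional
  have hev : ∀ᶠ v : vectorSpan ℝ (T : Set (Rn n)) in 𝓝 0, ∀ t : T,
      0 < (1 - ∑ s, G v s) * w t + G v t := by
    rw [eventually_all]
    intro t
    have hc : Continuous fun v => (1 - ∑ s, G v s) * w t + G v t := by fun_prop
    have h0 := hc.tendsto 0
    simp only [map_zero, Pi.zero_apply, Finset.sum_const_zero, sub_zero, one_mul, add_zero] at h0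
    exact h0.eventually (lt_mem_nhds (hw t t.2))
  filter_upwards [hev] with v hv
  have hw1' : ∑ t : T, w t = 1 := by rw [← hw1]; exact Finset.sum_coe_sort T w
  have hp' : ∑ t : T, w t • (t : Rn n) = p := by rw [← hp]; exact Finset.sum_coe_sort T (fun t => w t • t)
  have e : p + (v : Rn n) = ∑ t : T, ((1 - ∑ s, G v s) * w t + G v t) • (t : Rn n) := by
    conv_lhs => rw [← hG v, hF]
    simp only [smul_sub, Finset.sum_sub_distrib, add_smul, mul_smul, Finset.sum_add_distrib,
      ← Finset.smul_sum, ← Finset.sum_smul, hp']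
    module
  rw [e]
  apply (convex_convexHull ℝ _).sum_mem (fun t _ => (hv t).le)
  · rw [Finset.sum_add_distrib, ← Finset.mul_sum, hw1']; ring
  · intro t _
    exact subset_convexHull ℝ _ t.2

theorem infDist_of_inner {n : ℕ} {P : Set (Rn n)} (hP : Convex ℝ P) (z p : Rn n) (hp : p ∈ P)
    (h : ∀ x ∈ P, inner ℝ (z - p) (x - p) ≤ 0) : infDist z P = ‖z - p‖ := by
  rw [infDist_eq_iInf, (norm_eq_iInf_iff_real_inner_le_zero hP hp).2 h]
  simp only [dist_eq_norm]

theorem inner_of_infDist {n : ℕ} {P : Set (Rn n)} (hP : Convex ℝ P) (z p : Rn n) (hp : p ∈ P)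
    (h : infDist z P = ‖z - p‖) : ∀ x ∈ P, inner ℝ (z - p) (x - p) ≤ 0 := by
  apply (norm_eq_iInf_iff_real_inner_le_zero hP hp).1
  rw [← h, infDist_eq_iInf]
  simp only [dist_eq_norm]

theorem mem_cth {n : ℕ} {P : Set (Rn n)} (hP : P.Nonempty) (ε : ℝ) (hε : 0 ≤ ε) (z : Rn n) :
    z ∈ cthickening ε P ↔ infDist z P ≤ ε := by
  rw [cthickening, Set.mem_setOf_eq, infDist, ENNReal.le_ofReal_iff_toReal_le (infEDist_ne_top hP) hε]

/-- local type -/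
def Ty {n : ℕ} (ε : ℝ) (k : ℕ) (K : Set (Rn n)) (y : Rn n) : Prop :=
  (k = n ∧ y ∈ interior K) ∨ ∃ (V : Submodule ℝ (Rn n)) (u : Rn n), Module.finrank ℝ V = k ∧ u ∈ Vᗮ ∧
    ‖u‖ = 1 ∧ ∃ δ > 0, ∀ z ∈ ball y δ, z ∈ K ↔ infDist (z - y + ε • u) (V : Set (Rn n)) ≤ ε

theorem Ty.le {n : ℕ} {ε : ℝ} {k : ℕ} {K : Set (Rn n)} {y : Rn n} (h : Ty ε k K y) : k < n + 1 := by
  rcases h with h | ⟨V, u, h, -⟩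
  · omega
  · have := Submodule.finrank_le V
    simp at this; omega

/-- bad set -/
def BadSet {n : ℕ} (S : Finset (Rn n)) (ε : ℝ) : Set (Rn n) :=
  ⋃ t0 ∈ S, ⋃ A ∈ S.powerset, ⋃ B ∈ S.powerset,
    {y | Module.finrank ℝ (vectorSpan ℝ (A : Set (Rn n))) < Module.finrank ℝ (vectorSpan ℝ (B : Set (Rn n))) ∧
      y ∈ Bd t0 (vectorSpan ℝ (A : Set (Rn n))) (vectorSpan ℝ (B : Set (Rn n))) ε}

theorem BadSet_null {m : ℕ} (S : Finset (Rn (m + 1))) (ε : ℝ) : μH[(m : ℝ)] (BadSet S ε) = 0 := by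
  unfold BadSet
  refine (measure_biUnion_null_iff S.countable_toSet).2 ?_
  intro t0 _
  refine (measure_biUnion_null_iff (Finset.countable_toSet _)).2 ?_
  intro A _
  refine (measure_biUnion_null_iff (Finset.countable_toSet _)).2 ?_
  intro B _
  by_cases h : Module.finrank ℝ (vectorSpan ℝ (A : Set (Rn (m + 1)))) < Module.finrank ℝ (vectorSpan ℝ (B : Set (Rn (m + 1))))
  · exact measure_mono_null (fun y hy => hy.2) (Bd_null t0 _ _ ε h)
  · simp [h]

theorem body_cth {n : ℕ} (S : Finset (Rn n)) (hS : S.Nonempty) (ε : ℝ) :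
    IsConvexBody (cthickening ε (convexHull ℝ (S : Set (Rn n)))) := by
  have hne : (convexHull ℝ (S : Set (Rn n))).Nonempty := by simpa using hS
  refine ⟨hne.mono (self_subset_cthickening _), ?_, (convex_convexHull ℝ _).cthickening ε⟩
  exact (S.finite_toSet.isCompact_convexHull ℝ).cthickening


theorem geom {n : ℕ} (S : Finset (Rn n)) (hS : S.Nonempty) (ε : ℝ) (hε : 0 < ε) (y : Rn n)
    (hy : y ∈ cthickening ε (convexHull ℝ (S : Set (Rn n)))) :
    (∃ k, Ty ε k (cthickening ε (convexHull ℝ (S : Set (Rn n)))) y) ∨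
      (Supp (cthickening ε (convexHull ℝ (S : Set (Rn n)))) ε y ∧ y ∈ BadSet S ε) := by
  classical
  set P := convexHull ℝ (S : Set (Rn n)) with hPdef
  have hPne : P.Nonempty := by simpa [hPdef] using hS
  have hPc : IsCompact P := S.finite_toSet.isCompact_convexHull ℝ
  have hPconv : Convex ℝ P := convex_convexHull ℝ _
  have hSP : ∀ s ∈ S, s ∈ P := fun s hs => subset_convexHull ℝ _ hs
  set K := cthickening ε P with hKdef
  have hyd := (mem_cth hPne ε hε.le y).1 hy
  rcases lt_or_eq_of_le hyd with hlt | heq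
  · left
    refine ⟨n, Or.inl ⟨rfl, ?_⟩⟩
    apply interior_maximal (thickening_subset_cthickening ε P) isOpen_thickening
    obtain ⟨x, hx, hxd⟩ := (infDist_lt_iff hPne).1 hlt
    exact mem_thickening_iff.2 ⟨x, hx, hxd⟩
  obtain ⟨p, hp, hpd⟩ := hPc.exists_infDist_eq_dist hPne y
  rw [heq, dist_eq_norm] at hpd
  obtain ⟨u, hu⟩ : ∃ u, u = ε⁻¹ • (y - p) := ⟨_, rfl⟩
  have hyp : y - p = ε • u := by rw [hu, smul_smul, mul_inv_cancel₀ hε.ne', one_smul]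
  have hyp' : y = p + ε • u := by rw [← hyp]; abel
  have hu1 : ‖u‖ = 1 := by
    rw [hu, norm_smul, ← hpd, norm_inv, Real.norm_of_nonneg hε.le, inv_mul_cancel₀ hε.ne']
  have hsup : ∀ x ∈ P, inner ℝ (x - p) u ≤ 0 := by
    intro x hx
    have := inner_of_infDist hPconv y p hp (by rw [heq, hpd]) x hx
    rw [hyp, real_inner_comm, inner_smul_right] at this
    nlinarith
  have hSupp : Supp K ε y := by
    refine ⟨p, u, hu1, hyp', closedBall_subset_cthickening hp ε, ?_⟩
    intro z hz
    have hzd := (mem_cth hPne ε hε.le z).1 hz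
    obtain ⟨x, hx, hxd⟩ := hPc.exists_infDist_eq_dist hPne z
    rw [hxd, dist_eq_norm] at hzd
    have e : z - y = (z - x) + (x - p) - ε • u := by rw [hyp']; abel
    have h1 := real_inner_le_norm (z - x) u
    have h2 := hsup x hx
    rw [e, inner_sub_left, inner_add_left, inner_smul_left, real_inner_self_eq_norm_sq, hu1]
    rw [hu1] at h1
    simp
    linarith
  obtain ⟨w, hw0, hw1, hwp⟩ := Finset.mem_convexHull'.1 hp
  let T := S.filter (fun s => 0 < w s)
  let Su := S.filter (fun s => inner ℝ (s - p) u = 0)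
  have hT1 : ∑ s ∈ T, w s = 1 := by
    rw [← hw1]
    apply Finset.sum_filter_of_ne
    intro s hs hne
    exact lt_of_le_of_ne (hw0 s hs) hne.symm
  have hTp : ∑ s ∈ T, w s • s = p := by
    rw [← hwp]
    apply Finset.sum_filter_of_ne
    intro s hs hne
    refine lt_of_le_of_ne (hw0 s hs) ?_
    intro h; rw [← h, zero_smul] at hne; exact hne rfl
  have hTpos : ∀ t ∈ T, 0 < w t := fun t ht => (Finset.mem_filter.1 ht).2
  have hTS : T ⊆ S := Finset.filter_subset _ _
  have hSuS : Su ⊆ S := Finset.filter_subset _ _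
  have hTSu : T ⊆ Su := by
    have h0 : ∑ s ∈ T, w s * inner ℝ (s - p) u = 0 := by
      have : ∑ s ∈ T, w s • (s - p) = 0 := by
        simp only [smul_sub, Finset.sum_sub_distrib, ← Finset.sum_smul, hT1, hTp, one_smul, sub_self]
      have h2 := congrArg (fun x => inner ℝ x u) this
      simp only [sum_inner, inner_smul_left, inner_zero_left] at h2
      simpa using h2
    have h3 := (Finset.sum_eq_zero_iff_of_nonpos (fun s hs =>
      mul_nonpos_of_nonneg_of_nonpos (hTpos s hs).le (hsup s (hSP s (hTS hs))))).1 h0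
    intro t ht
    refine Finset.mem_filter.2 ⟨hTS ht, ?_⟩
    rcases mul_eq_zero.1 (h3 t ht) with h | h
    · exact absurd h (hTpos t ht).ne'
    · exact h
  obtain ⟨t0, ht0⟩ : T.Nonempty := by
    rw [Finset.nonempty_iff_ne_empty]
    intro h; rw [h] at hT1; simp at hT1
  set V' := vectorSpan ℝ (T : Set (Rn n)) with hV'
  set V := vectorSpan ℝ (Su : Set (Rn n)) with hV
  have hVV : V' ≤ V := vectorSpan_mono ℝ (by exact_mod_cast hTSu)
  have hpt0 : p - t0 ∈ V' := by
    have : p - t0 = ∑ s ∈ T, w s • (s - t0) := by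
      simp only [smul_sub, Finset.sum_sub_distrib, ← Finset.sum_smul, hT1, hTp, one_smul]
    rw [this]
    apply Submodule.sum_mem
    intro s hs
    exact Submodule.smul_mem _ _ (vsub_mem_vectorSpan ℝ hs ht0)
  have hSuV : ∀ s ∈ Su, s - p ∈ V := by
    intro s hs
    have h1 : s - t0 ∈ V := vsub_mem_vectorSpan ℝ hs (hTSu ht0)
    have e : s - p = (s - t0) - (p - t0) := by abel
    rw [e]; exact V.sub_mem h1 (hVV hpt0)
  have huV : u ∈ Vᗮ := by
    rw [Submodule.mem_orthogonal]
    have : V ≤ (Submodule.span ℝ {u})ᗮ := by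
      rw [hV, vectorSpan_def, Submodule.span_le]
      rintro _ ⟨a, ha, b, hb, rfl⟩
      rw [SetLike.mem_coe, Submodule.mem_orthogonal_singleton_iff_inner_left]
      have ha' := (Finset.mem_filter.1 ha).2
      have hb' := (Finset.mem_filter.1 hb).2
      have e : a -ᵥ b = (a - p) - (b - p) := by simp
      simp only [e]
      rw [inner_sub_left, ha', hb', sub_zero]
    intro v hv
    exact (Submodule.mem_orthogonal_singleton_iff_inner_left).1 (this hv)
  by_cases hlt : Module.finrank ℝ V' < Module.finrank ℝ V
  · right
    refine ⟨hSupp, ?_⟩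
    simp only [BadSet, Set.mem_iUnion]
    refine ⟨t0, hTS ht0, T, Finset.mem_powerset.2 hTS, Su, Finset.mem_powerset.2 hSuS, hlt, p - t0, hpt0, u, huV, hu1, ?_⟩
    rw [hyp']; abel
  left
  have hVeq : V' = V := Submodule.eq_of_le_of_finrank_le hVV (not_lt.1 hlt)
  refine ⟨_, Or.inr ⟨V, u, rfl, huV, hu1, ?_⟩⟩
  have hrel := relint_aux T w hTpos hT1 p hTp
  rw [← hV', hVeq] at hrel
  have hpc : Continuous fun z : Rn n => V.orthogonalProjectionOnto (z - p) := by fun_prop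
  have hpy : V.orthogonalProjectionOnto (y - p) = 0 := by
    rw [hyp, map_smul, Submodule.orthogonalProjectionOnto_eq_zero_iff.2 huV, smul_zero]
  have hev1 : ∀ᶠ z in 𝓝 y, p + (V.orthogonalProjectionOnto (z - p) : Rn n) ∈ P := by
    have h1 := hpc.tendsto y
    simp only [hpy] at h1
    filter_upwards [h1.eventually hrel] with z hz
    exact convexHull_mono (by exact_mod_cast hTS) hz
  have hev2 : ∀ᶠ z in 𝓝 y, ∀ s ∈ S, inner ℝ (z - p - (V.orthogonalProjectionOnto (z - p) : Rn n))
      (s - (p + (V.orthogonalProjectionOnto (z - p) : Rn n))) ≤ 0 := by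
    rw [eventually_all_finset]
    intro s hs
    by_cases hsu : s ∈ Su
    · refine Eventually.of_forall fun z => ?_
      have h1 : s - (p + (V.orthogonalProjectionOnto (z - p) : Rn n)) ∈ V := by
        rw [← sub_sub]; exact V.sub_mem (hSuV s hsu) (Subtype.mem _)
      have h2 : z - p - (V.orthogonalProjectionOnto (z - p) : Rn n) ∈ Vᗮ :=
        Submodule.sub_starProjection_mem_orthogonal (K := V) (z - p)
      exact ((Submodule.mem_orthogonal' V _).1 h2 _ h1).le
    · have hc : Continuous fun z : Rn n => (inner ℝ (z - p - (V.orthogonalProjectionOnto (z - p) : Rn n))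
          (s - (p + (V.orthogonalProjectionOnto (z - p) : Rn n))) : ℝ) := by fun_prop
      have h1 := hc.tendsto y
      simp only [hpy, Submodule.coe_zero, sub_zero, add_zero] at h1
      rw [hyp] at h1
      have h2 : inner ℝ (ε • u) (s - p) < 0 := by
        rw [inner_smul_left, real_inner_comm]
        have h3 : inner ℝ (s - p) u ≠ 0 := fun h => hsu (Finset.mem_filter.2 ⟨hs, h⟩)
        have h4 := lt_of_le_of_ne (hsup s (hSP s hs)) h3
        simp
        nlinarith
      exact (h1.eventually (gt_mem_nhds h2)).mono fun z hz => le_of_lt hz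
  obtain ⟨δ, hδ, hball⟩ := Metric.eventually_nhds_iff_ball.1 (hev1.and hev2)
  refine ⟨δ, hδ, fun z hz => ?_⟩
  obtain ⟨hz1, hz2⟩ := hball z hz
  set v : Rn n := (V.orthogonalProjectionOnto (z - p) : Rn n) with hv
  have e1 : z - y + ε • u = z - p := by rw [hyp']; abel
  have d1 : infDist z P = ‖z - p - v‖ := by
    rw [infDist_of_inner hPconv z (p + v) hz1, sub_sub]
    intro x hx
    have hconv : Convex ℝ {x : Rn n | inner ℝ (z - p - v) (x - (p + v)) ≤ 0} := by
      have := convex_halfSpace_le (𝕜 := ℝ) (f := fun x : Rn n => (inner ℝ (z - p - v) x : ℝ))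
        ⟨fun a b => inner_add_right _ _ _, fun a b => by simp [inner_smul_right]⟩ (inner ℝ (z - p - v) (p + v))
      have e : {x : Rn n | inner ℝ (z - p - v) (x - (p + v)) ≤ 0} =
          {x : Rn n | inner ℝ (z - p - v) x ≤ inner ℝ (z - p - v) (p + v)} := by
        ext x; rw [Set.mem_setOf_eq, Set.mem_setOf_eq, inner_sub_right, sub_nonpos]
      rw [e]; exact this
    have := convexHull_min (s := (S : Set (Rn n))) (fun s hs => hz2 s hs) hconv hx
    rw [← sub_sub]
    exact this
  have d2 : infDist (z - p) (V : Set (Rn n)) = ‖z - p - v‖ := by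
    apply infDist_of_inner V.convex (z - p) v (Subtype.mem _)
    intro x hx
    have h2 : z - p - v ∈ Vᗮ := Submodule.sub_starProjection_mem_orthogonal (K := V) (z - p)
    exact ((Submodule.mem_orthogonal' V _).1 h2 _ (V.sub_mem hx (Subtype.mem _))).le
  rw [e1, d2, ← d1]
  exact mem_cth hPne ε hε.le z


theorem low_lt {n : ℕ} {V : Submodule ℝ (Rn n)} {u : Rn n} (hu : u ∈ Vᗮ) (hu1 : ‖u‖ = 1) :
    Module.finrank ℝ V < n := by
  have h1 : V ≠ ⊤ := by
    rintro rfl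
    simp at hu
    simp [hu] at hu1
  have := Submodule.finrank_lt h1
  simpa using this

theorem germ_of_iff {n : ℕ} {K K' : Set (Rn n)} {y y' : Rn n} (ρ : Rn n ≃ₗᵢ[ℝ] Rn n) (hρ : PosDet ρ)
    (δ : ℝ) (hδ : 0 < δ) (h : ∀ z ∈ ball y δ, z ∈ K ↔ ρ (z - y) + y' ∈ K') : GermEq K y K' y' := by
  refine ⟨ρ, y' - ρ y, hρ, by simp [rig_apply], δ, hδ, ?_⟩
  ext z'
  obtain ⟨z, rfl⟩ := (rig ρ (y' - ρ y)).surjective z'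
  have e : rig ρ (y' - ρ y) z = ρ (z - y) + y' := by rw [rig_apply, map_sub]; abel
  rw [Set.mem_inter_iff, Set.mem_inter_iff, and_congr_left_iff,
    (rig ρ (y' - ρ y)).injective.mem_set_image, e]
  intro hz
  apply h
  rw [mem_ball, dist_eq_norm] at hz ⊢
  rwa [add_sub_cancel_right, ρ.norm_map] at hz

theorem Ty.germEq {n : ℕ} (hn : 2 ≤ n) {ε : ℝ} {k : ℕ} {K K' : Set (Rn n)} {y y' : Rn n} (h : Ty ε k K y)
    (h' : Ty ε k K' y') : GermEq K y K' y' := by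
  rcases h with ⟨hk, hi⟩ | ⟨V, u, hV, hu, hu1, δ, hδ, hb⟩
  · rcases h' with ⟨-, hi'⟩ | ⟨V', u', hV', hu', hu1', -⟩
    · obtain ⟨δ, hδ, hb⟩ := Metric.isOpen_iff.1 isOpen_interior y hi
      obtain ⟨δ', hδ', hb'⟩ := Metric.isOpen_iff.1 isOpen_interior y' hi'
      refine germ_of_iff (LinearIsometryEquiv.refl ℝ _) posDet_refl (min δ δ') (lt_min hδ hδ') ?_
      intro z hz
      have hz1 : z ∈ ball y δ := ball_subset_ball (min_le_left _ _) hz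
      have hz2 : z ∈ ball y δ' := ball_subset_ball (min_le_right _ _) hz
      refine iff_of_true (interior_subset (hb hz1)) (interior_subset (hb' ?_))
      rw [mem_ball, dist_eq_norm] at hz2 ⊢
      simpa using hz2
    · have := low_lt hu' hu1'
      omega
  · rcases h' with ⟨hk, -⟩ | ⟨V', u', hV', hu', hu1', δ', hδ', hb'⟩
    · have := low_lt hu hu1
      omega
    · obtain ⟨ρ, hρ, hρV, hρu⟩ := exists_rotation hn V V' u u' hu hu1 hu' hu1' (hV.trans hV'.symm)
      refine germ_of_iff ρ hρ (min δ δ') (lt_min hδ hδ') ?_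
      intro z hz
      have hz1 : z ∈ ball y δ := ball_subset_ball (min_le_left _ _) hz
      have hz2 : z ∈ ball y δ' := ball_subset_ball (min_le_right _ _) hz
      rw [hb z hz1, hb' _ (by
        rw [mem_ball, dist_eq_norm] at hz2 ⊢
        rwa [add_sub_cancel_right, ρ.norm_map])]
      have e : ρ (z - y) + y' - y' + ε • u' = ρ (z - y + ε • u) := by
        rw [map_add, map_smul, hρu]; abel
      rw [e, ← hρV, infDist_image ρ.isometry]


/-- total measure -/
noncomputable def totM {n N : ℕ} (Φ : Fin N → CurvatureMeasure n) (K : Set (Rn n)) : Measure (Rn n) :=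
  ∑ i : Fin N × Fin 4, part ((Φ i.1).meas K) i.2

instance {n N : ℕ} (Φ : Fin N → CurvatureMeasure n) (K : Set (Rn n)) : IsFiniteMeasure (totM Φ K) := by
  unfold totM; infer_instance

theorem totM_apply {n N : ℕ} (Φ : Fin N → CurvatureMeasure n) (K A : Set (Rn n)) :
    totM Φ K A = ∑ i : Fin N × Fin 4, part ((Φ i.1).meas K) i.2 A := by
  unfold totM; simp [Measure.finsetSum_apply]

theorem part_ac {n N : ℕ} (Φ : Fin N → CurvatureMeasure n) (K : Set (Rn n)) (i : Fin N × Fin 4) :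
    part ((Φ i.1).meas K) i.2 ≪ totM Φ K := by
  intro A hA
  rw [totM_apply] at hA
  exact (Finset.sum_eq_zero_iff.1 hA) i (Finset.mem_univ _)

/-- limit of density ratios -/
def RatioLim {n N : ℕ} (Φ : Fin N → CurvatureMeasure n) (K : Set (Rn n)) (y : Rn n)
    (c : Fin N × Fin 4 → ENNReal) : Prop :=
  ∀ i, Tendsto (fun r => part ((Φ i.1).meas K) i.2 (closedBall y r) / totM Φ K (closedBall y r))
    (𝓝[>] 0) (𝓝 (c i))

theorem RatioLim.germ {n N : ℕ} {Φ : Fin N → CurvatureMeasure n} (hΦ : ∀ i, (Φ i).SOInvariant)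
    {K K' : Set (Rn n)} {y y' : Rn n} (hK : IsConvexBody K) (hK' : IsConvexBody K') (hg : GermEq K y K' y')
    {c : Fin N × Fin 4 → ENNReal} (h : RatioLim Φ K y c) : RatioLim Φ K' y' c := by
  intro i
  refine (h i).congr' ?_
  filter_upwards [hg.eventually hK hK'] with r hr
  rw [totM_apply, totM_apply, hr _ (hΦ i.1)]
  congr 1
  exact Finset.sum_congr rfl fun j _ => (hr _ (hΦ j.1) _).symm

theorem ratioLim_ae {n N : ℕ} (Φ : Fin N → CurvatureMeasure n) (K : Set (Rn n)) :
    ∀ᵐ y ∂(totM Φ K), RatioLim Φ K y (fun i => (part ((Φ i.1).meas K) i.2).rnDeriv (totM Φ K) y) := by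
  unfold RatioLim
  rw [ae_all_iff]
  intro i
  exact Besicovitch.ae_tendsto_rnDeriv _ _

theorem type_ae {n N : ℕ} (hn : 2 ≤ n) {Φ : Fin N → CurvatureMeasure n} (hΦ : ∀ i, (Φ i).SOInvariant)
    (S : Finset (Rn n)) (hS : S.Nonempty) (ε : ℝ) (hε : 0 < ε) :
    ∀ᵐ y ∂(totM Φ (cthickening ε (convexHull ℝ (S : Set (Rn n))))),
      ∃ k, Ty ε k (cthickening ε (convexHull ℝ (S : Set (Rn n)))) y := by
  obtain ⟨m, rfl⟩ : ∃ m, n = m + 1 := ⟨n - 1, by omega⟩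
  set K := cthickening ε (convexHull ℝ (S : Set (Rn (m + 1)))) with hK
  have hKb : IsConvexBody K := body_cth S hS ε
  rw [ae_iff, totM_apply]
  apply Finset.sum_eq_zero
  intro i _
  refine measure_mono_null (t := Kᶜ ∪ {y | Supp K ε y ∧ y ∈ BadSet S ε}) ?_ (measure_union_null
    (part_compl hn (hΦ i.1) hKb i.2) (null_of_hausdorff (by omega) (hΦ i.1) hKb ε hε i.2 _ (fun x hx => hx.1)
      (measure_mono_null (fun x hx => hx.2) (BadSet_null S ε))))
  intro y hy
  by_cases hyK : y ∈ K
  · right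
    rcases geom S hS ε hε y hyK with h | h
    · exact absurd h hy
    · exact h
  · left; exact hyK

theorem step {n : ℕ} (hn : 2 ≤ n) (Φ : Fin (n + 2) → CurvatureMeasure n) (hΦ : ∀ i, (Φ i).SOInvariant)
    (ε : ℝ) (hε : 0 < ε) :
    ∃ a : Fin (n + 2) → ℂ, a ≠ 0 ∧ ∀ S : Finset (Rn n), S.Nonempty →
      ∀ f : BoundedContinuousFunction (Rn n) ℂ,
        ∑ j, a j * cmIntegral ((Φ j).meas (cthickening ε (convexHull ℝ (S : Set (Rn n))))) f = 0 := by
  classical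
  have hc : ∀ k : ℕ, ∃ c : Fin (n + 2) × Fin 4 → ENNReal, ∀ K y, IsConvexBody K → Ty ε k K y →
      ∀ c', RatioLim Φ K y c' → c' = c := by
    intro k
    by_cases hex : ∃ K y c, IsConvexBody K ∧ Ty ε k K y ∧ RatioLim Φ K y c
    · obtain ⟨K0, y0, c, hK0, hT0, hR0⟩ := hex
      refine ⟨c, fun K y hK hT c' hR => ?_⟩
      have h1 := hR0.germ hΦ hK0 hK (hT0.germEq hn hT)
      funext i
      exact tendsto_nhds_unique (hR i) (h1 i)
    · exact ⟨0, fun K y hK hT c' hR => absurd ⟨K, y, c', hK, hT, hR⟩ hex⟩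
  choose c hc using hc
  let b : Fin (n + 2) → Fin (n + 1) → ℂ := fun j k => ∑ t, w4 t * ((c k (j, t)).toReal : ℂ)
  let T : (Fin (n + 2) → ℂ) →ₗ[ℂ] (Fin (n + 1) → ℂ) := Fintype.linearCombination ℂ b
  have hker : LinearMap.ker T ≠ ⊥ := LinearMap.ker_ne_bot_of_finrank_lt (by simp)
  obtain ⟨a, ha, ha0⟩ := (Submodule.ne_bot_iff _).1 hker
  have haT : ∀ k : Fin (n + 1), ∑ j, a j * b j k = 0 := by
    intro k
    have h1 : T a = ∑ j, a j • b j := rfl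
    rw [LinearMap.mem_ker.1 ha] at h1
    have := congrFun h1 k
    simpa using this.symm
  refine ⟨a, ha0, fun S hS f => ?_⟩
  set K := cthickening ε (convexHull ℝ (S : Set (Rn n))) with hK
  have hKb : IsConvexBody K := body_cth S hS ε
  let d : Fin (n + 2) → Fin 4 → Rn n → ℝ := fun j t y =>
    ((part ((Φ j).meas K) t).rnDeriv (totM Φ K) y).toReal
  have hleb : ∀ j t, (part ((Φ j).meas K) t).HaveLebesgueDecomposition (totM Φ K) := fun j t =>
    Measure.haveLebesgueDecomposition_of_sigmaFinite _ _
  have hac : ∀ j t, part ((Φ j).meas K) t ≪ totM Φ K := fun j t => part_ac Φ K (j, t)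
  have hint : ∀ j t, Integrable (fun y => d j t y • f y) (totM Φ K) := by
    intro j t
    exact (integrable_rnDeriv_smul_iff (hac j t)).2 (f.integrable _)
  have h1 : ∀ j t, ∫ y, f y ∂(part ((Φ j).meas K) t) = ∫ y, d j t y • f y ∂(totM Φ K) := by
    intro j t
    exact (integral_rnDeriv_smul (hac j t)).symm
  have h2 : ∑ j, a j * cmIntegral ((Φ j).meas K) f =
      ∫ y, ∑ j, a j * ∑ t, w4 t * (d j t y • f y) ∂(totM Φ K) := by
    rw [integral_finsetSum _ (fun j _ => (integrable_finsetSum _ fun t _ => (hint j t).const_mul _).const_mul _)]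
    refine Finset.sum_congr rfl fun j _ => ?_
    rw [integral_const_mul, integral_finsetSum _ (fun t _ => (hint j t).const_mul _), cmIntegral_eq_parts]
    congr 1
    refine Finset.sum_congr rfl fun t _ => ?_
    rw [integral_const_mul, h1]
  rw [h2]
  apply integral_eq_zero_of_ae
  filter_upwards [type_ae hn hΦ S hS ε hε, ratioLim_ae Φ K] with y hy hR
  obtain ⟨k, hk⟩ := hy
  have h3 := hc k K y hKb hk _ hR
  have h4 : ∀ j t, d j t y = (c k (j, t)).toReal := by
    intro j t
    simp only [d]
    rw [← h3]
  have h5 := haT ⟨k, hk.le⟩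
  simp only [b] at h5
  have h6 : ∑ j, a j * ∑ t, w4 t * (d j t y • f y) =
      (∑ j, a j * ∑ t, w4 t * ((c k (j, t)).toReal : ℂ)) * f y := by
    rw [Finset.sum_mul]
    refine Finset.sum_congr rfl fun j _ => ?_
    rw [mul_assoc, Finset.sum_mul]
    congr 1
    refine Finset.sum_congr rfl fun t _ => ?_
    rw [h4, Complex.real_smul, mul_assoc]
  rw [h6, h5, zero_mul, Pi.zero_apply]


theorem approx_body {n : ℕ} {K : Set (Rn n)} (hK : IsConvexBody K) (ε : ℝ) (hε : 0 < ε) :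
    ∃ S : Finset (Rn n), S.Nonempty ∧ hausdorffDist (cthickening ε (convexHull ℝ (S : Set (Rn n)))) K ≤ ε := by
  obtain ⟨t, htK, htf, hcov⟩ := hK.2.1.finite_cover_balls hε
  obtain ⟨S, rfl⟩ := htf.exists_finset_coe
  have hS : S.Nonempty := by
    obtain ⟨x, hx⟩ := hK.1
    obtain ⟨s, hs, -⟩ := Set.mem_iUnion₂.1 (hcov hx)
    exact ⟨s, hs⟩
  have hPne : (convexHull ℝ (S : Set (Rn n))).Nonempty := by simpa using hS
  refine ⟨S, hS, hausdorffDist_le_of_mem_dist hε.le ?_ ?_⟩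
  · intro z hz
    have hd := (mem_cth hPne ε hε.le z).1 hz
    obtain ⟨x, hx, hxd⟩ := (S.finite_toSet.isCompact_convexHull ℝ).exists_infDist_eq_dist hPne z
    exact ⟨x, convexHull_min htK hK.2.2 hx, hxd ▸ hd⟩
  · intro x hx
    obtain ⟨s, hs, hsd⟩ := Set.mem_iUnion₂.1 (hcov hx)
    exact ⟨s, self_subset_cthickening _ (subset_convexHull ℝ _ hs), (mem_ball.1 hsd).le⟩

theorem step' {n : ℕ} (hn : 2 ≤ n) (Φ : Fin (n + 2) → CurvatureMeasure n) (hΦ : ∀ i, (Φ i).SOInvariant)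
    (ε : ℝ) (hε : 0 < ε) :
    ∃ a : Fin (n + 2) → ℂ, ‖a‖ = 1 ∧ ∀ S : Finset (Rn n), S.Nonempty →
      ∀ f : BoundedContinuousFunction (Rn n) ℂ,
        ∑ j, a j * cmIntegral ((Φ j).meas (cthickening ε (convexHull ℝ (S : Set (Rn n))))) f = 0 := by
  obtain ⟨a, ha, h⟩ := step hn Φ hΦ ε hε
  have ha' : ‖a‖ ≠ 0 := norm_ne_zero_iff.2 ha
  refine ⟨((‖a‖⁻¹ : ℝ) : ℂ) • a, ?_, fun S hS f => ?_⟩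
  · rw [norm_smul, Complex.norm_real, norm_inv, norm_norm, inv_mul_cancel₀ ha']
  · have := h S hS f
    simp only [Pi.smul_apply, smul_eq_mul, mul_assoc, ← Finset.mul_sum, this, mul_zero]

theorem final_thm {n : ℕ} (hn : 2 ≤ n)
    (Φ : Fin (n + 2) → CurvatureMeasure n) (hinv : ∀ i, (Φ i).SOInvariant) :
    ∃ c : Fin (n + 2) → ℂ, c ≠ 0 ∧
      ∀ K : Set (Rn n), IsConvexBody K → ∀ β : Set (Rn n), MeasurableSet β →
        ∑ i, c i * (Φ i).meas K β = 0 := by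
  have hpos : ∀ i : ℕ, (0 : ℝ) < 1 / ((i : ℝ) + 1) := fun i => Nat.one_div_pos_of_nat
  choose a ha1 ha using fun i : ℕ => step' hn Φ hinv (1 / ((i : ℝ) + 1)) (hpos i)
  obtain ⟨c, hc, φ, hφ, hlim⟩ := (isCompact_sphere (0 : Fin (n + 2) → ℂ) 1).tendsto_subseq
    (x := a) (fun i => by simpa using ha1 i)
  have hc0 : c ≠ 0 := by
    rintro rfl; simp at hc
  refine ⟨c, hc0, fun K hK β hβ => ?_⟩
  have hf : ∀ f : BoundedContinuousFunction (Rn n) ℂ, ∑ j, c j * cmIntegral ((Φ j).meas K) f = 0 := by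
    intro f
    choose S hS hSd using fun i : ℕ => approx_body hK (1 / ((φ i : ℝ) + 1)) (hpos (φ i))
    have hd : Tendsto (fun i => hausdorffDist (cthickening (1 / ((φ i : ℝ) + 1)) (convexHull ℝ (S i : Set (Rn n)))) K)
        atTop (𝓝 0) :=
      squeeze_zero (fun i => hausdorffDist_nonneg) hSd
        (tendsto_one_div_add_atTop_nhds_zero_nat.comp hφ.tendsto_atTop)
    have h1 : ∀ j, Tendsto (fun i => cmIntegral ((Φ j).meas (cthickening (1 / ((φ i : ℝ) + 1)) (convexHull ℝ (S i : Set (Rn n))))) f)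
        atTop (𝓝 (cmIntegral ((Φ j).meas K) f)) := fun j =>
      (Φ j).continuity _ K (fun i => body_cth _ (hS i) _) hK hd f
    have h2 : Tendsto (fun i => ∑ j, a (φ i) j * cmIntegral ((Φ j).meas (cthickening (1 / ((φ i : ℝ) + 1)) (convexHull ℝ (S i : Set (Rn n))))) f)
        atTop (𝓝 (∑ j, c j * cmIntegral ((Φ j).meas K) f)) :=
      tendsto_finset_sum _ fun j _ => (((continuous_apply j).tendsto c).comp hlim).mul (h1 j)
    have h3 : (fun i => ∑ j, a (φ i) j * cmIntegral ((Φ j).meas (cthickening (1 / ((φ i : ℝ) + 1)) (convexHull ℝ (S i : Set (Rn n))))) f)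
        = fun _ => 0 := by
      funext i
      exact ha (φ i) (S i) (hS i) f
    rw [h3] at h2
    exact (tendsto_nhds_unique h2 tendsto_const_nhds)
  have hle : ∀ η > 0, ‖∑ j, c j * (Φ j).meas K β‖ ≤ (∑ j, ‖c j‖) * η := by
    intro η hη
    obtain ⟨f, -, hfa⟩ := approx_cm (fun j => (Φ j).meas K) β hβ η hη
    have e : ∑ j, c j * (Φ j).meas K β = - ∑ j, c j * (cmIntegral ((Φ j).meas K) f - (Φ j).meas K β) := by
      simp only [mul_sub, Finset.sum_sub_distrib, hf f]; ring
    rw [e, norm_neg, Finset.sum_mul]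
    refine (norm_sum_le _ _).trans (Finset.sum_le_sum fun j _ => ?_)
    rw [norm_mul]
    exact mul_le_mul_of_nonneg_left (hfa j) (norm_nonneg _)
  have hlim2 : Tendsto (fun η : ℝ => (∑ j, ‖c j‖) * η) (𝓝[>] 0) (𝓝 0) := by
    have : Continuous fun η : ℝ => (∑ j, ‖c j‖) * η := by fun_prop
    have h := (this.tendsto 0).mono_left (nhdsWithin_le_nhds (s := Set.Ioi 0))
    simpa using h
  have := ge_of_tendsto hlim2 (by filter_upwards [self_mem_nhdsWithin] with η hη using hle η hη)
  exact norm_le_zero_iff.1 this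

/-- Any n+2 SO(n) invariant translation invariant curvature measures on ℝⁿ (n ≥ 2) are
linearly dependent over ℂ: the space of such measures has dimension at most n+1. -/
theorem soInvariant_curvatureMeasures_linearly_dependent (n : ℕ) (hn : 2 ≤ n)
    (Φ : Fin (n + 2) → CurvatureMeasure n) (hinv : ∀ i, (Φ i).SOInvariant) :
    ∃ c : Fin (n + 2) → ℂ, c ≠ 0 ∧
      ∀ K : Set (Rn n), IsConvexBody K → ∀ β : Set (Rn n), MeasurableSet β →
        ∑ i, c i * (Φ i).meas K β = 0 := by
  exact final_thm hn Φ hinv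
end

section
/- Let n ≥ 2 and let Φ be a translation invariant curvature measure on ℝⁿ that is homogeneous of degree n−2, even (i.e., Φ(−K, −β) = Φ(K, β) for every convex body K and Borel set β), and satisfies Φ(K, ℝⁿ) = 0 for every convex body K. Then Φ is simple: Φ(K, β) = 0 for every Borel set β whenever the convex body K has empty interior. -/
open MeasureTheory Metric Filter Topology
open scoped Pointwise

lemma vm_const_zero {X : Type*} [MeasurableSpace X] (v : ComplexMeasure X) (z : ℂ) (f : ℕ → Set X)
    (hf : ∀ i, MeasurableSet (f i)) (hd : Pairwise (Function.onFun Disjoint f))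
    (hz : ∀ i, v (f i) = z) : z = 0 := by
  have h := (v.m_iUnion hf hd).summable
  simp only [hz] at h
  exact (summable_const_iff z).1 h

lemma box_zero {k : ℕ} (v : ComplexMeasure (Fin k → ℝ)) (h1 : v Set.univ = 0)
    (h : ∀ a b : Fin k → ℝ, v (Set.univ.pi fun i => Set.Ioo (a i) (b i)) = 0) : v = 0 := by
  have hspan : IsCountablySpanning (⋃ (a : ℚ) (b : ℚ) (_ : a < b), {Set.Ioo (a : ℝ) (b : ℝ)}) :=
    (Real.finiteSpanningSetsInIooRat volume).isCountablySpanning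
  refine VectorMeasure.ext_of_generateFrom
    (Set.univ.pi '' Set.univ.pi fun _ : Fin k => (⋃ (a : ℚ) (b : ℚ) (_ : a < b), {Set.Ioo (a : ℝ) (b : ℝ)}))
    ?_ ?_ ?_ (by simpa using h1)
  · rintro _ ⟨s, hs, rfl⟩
    simp only [Set.mem_univ_pi, Set.mem_iUnion, Set.mem_singleton_iff] at hs
    choose a b hab hs using hs
    have : s = fun i => Set.Ioo (a i : ℝ) (b i : ℝ) := funext hs
    rw [this]
    simpa using h _ _
  · rw [← generateFrom_pi_eq (fun _ => hspan)]
    congr 1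
    funext i
    rw [← Real.borel_eq_generateFrom_Ioo_rat]
    exact BorelSpace.measurable_eq
  · exact IsPiSystem.pi fun _ => Real.isPiSystem_Ioo_rat

/-- grid map -/
noncomputable def gmap {k : ℕ} (N : ℕ) (j : Fin k → Fin N) (z : Fin k → ℝ) : Fin k → ℝ :=
  fun i => (z i + (j i : ℕ)) / N

def cube01 (k : ℕ) : Set (Fin k → ℝ) := Set.univ.pi fun _ => Set.Ico 0 1

lemma gmap_inj {k N : ℕ} (hN : 0 < N) {j j' : Fin k → Fin N} {z z' : Fin k → ℝ}
    (hz : z ∈ cube01 k) (hz' : z' ∈ cube01 k) (h : gmap N j z = gmap N j' z') : j = j' := by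
  funext i
  have hi := congrFun h i
  have hN' : (0 : ℝ) < N := by exact_mod_cast hN
  simp only [gmap] at hi
  rw [div_left_inj' hN'.ne'] at hi
  have a := hz i (Set.mem_univ i)
  have b := hz' i (Set.mem_univ i)
  obtain ⟨a1, a2⟩ := a
  obtain ⟨b1, b2⟩ := b
  apply Fin.ext
  have h1 : ((j i : ℕ) : ℝ) < (j' i : ℕ) + 1 := by linarith
  have h2 : ((j' i : ℕ) : ℝ) < (j i : ℕ) + 1 := by linarith
  norm_cast at h1 h2
  omega

lemma gmap_meas {k N : ℕ} (hN : 0 < N) (j : Fin k → Fin N) {γ : Set (Fin k → ℝ)}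
    (hγ : MeasurableSet γ) : MeasurableSet (gmap N j '' γ) := by
  have hN' : (N : ℝ) ≠ 0 := by positivity
  have : gmap N j '' γ = (fun (y : Fin k → ℝ) (i : Fin k) => (N : ℝ) * y i - ((j i : ℕ) : ℝ)) ⁻¹' γ := by
    ext y
    constructor
    · rintro ⟨z, hz, rfl⟩
      have : (fun i => (N : ℝ) * gmap N j z i - ((j i : ℕ) : ℝ)) = z := by
        funext i; simp only [gmap]; field_simp; ring
      simpa [this] using hz
    · intro hy
      refine ⟨_, hy, ?_⟩
      funext i; simp only [gmap]; field_simp; ring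
  rw [this]
  apply hγ.preimage
  fun_prop

lemma gmap_mem {k N : ℕ} (hN : 0 < N) (j : Fin k → Fin N) {z : Fin k → ℝ} (hz : z ∈ cube01 k) :
    gmap N j z ∈ cube01 k := by
  intro i _
  obtain ⟨a1, a2⟩ := hz i (Set.mem_univ i)
  have hN' : (0 : ℝ) < N := by exact_mod_cast hN
  have : ((j i : ℕ) : ℝ) + 1 ≤ N := by exact_mod_cast (j i).2
  constructor
  · simp only [gmap]; positivity
  · simp only [gmap]; rw [div_lt_one hN']; linarith

lemma gmap_cover {k N : ℕ} (hN : 0 < N) {y : Fin k → ℝ} (hy : y ∈ cube01 k) :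
    ∃ j : Fin k → Fin N, ∃ z ∈ cube01 k, gmap N j z = y := by
  have hN' : (0 : ℝ) < N := by exact_mod_cast hN
  have hlt : ∀ i, ⌊N * y i⌋₊ < N := by
    intro i
    obtain ⟨a1, a2⟩ := hy i (Set.mem_univ i)
    rw [Nat.floor_lt (by positivity)]
    nlinarith
  refine ⟨fun i => ⟨⌊N * y i⌋₊, hlt i⟩, fun i => N * y i - ⌊N * y i⌋₊, ?_, ?_⟩
  · intro i _
    obtain ⟨a1, a2⟩ := hy i (Set.mem_univ i)
    constructor
    · have := Nat.floor_le (a := N * y i) (by positivity)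
      simpa using this
    · have := Nat.lt_floor_add_one (N * y i)
      simp only; linarith
  · funext i; simp only [gmap]; field_simp; ring

lemma cube_meas (k : ℕ) : MeasurableSet (cube01 k) :=
  MeasurableSet.univ_pi fun _ => measurableSet_Ico

lemma grid_zero {k d : ℕ} (hkd : k ≠ d) (v : ComplexMeasure (Fin k → ℝ))
    (h : ∀ N : ℕ, 0 < N → ∀ j : Fin k → Fin N, ∀ γ ⊆ cube01 k, MeasurableSet γ →
      v (gmap N j '' γ) * (N : ℂ) ^ d = v γ) :
    ∀ γ ⊆ cube01 k, MeasurableSet γ → v γ = 0 := by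
  intro γ hγ hm
  have hdisj : ∀ N : ℕ, 0 < N → ∀ f : (Fin k → Fin N) → Set (Fin k → ℝ), (∀ j, f j ⊆ cube01 k) →
      Pairwise (Function.onFun Disjoint fun j => gmap N j '' (f j)) := by
    intro N hN f hf j j' hjj
    rw [Function.onFun, Set.disjoint_left]
    rintro _ ⟨z, hz, rfl⟩ ⟨z', hz', he⟩
    exact hjj (gmap_inj hN (hf _ hz) (hf _ hz') he.symm)
  have key : ∀ N : ℕ, 0 < N → ‖v γ‖ * N ≤ v.bound := by
    intro N hN
    have hN1 : (1 : ℝ) ≤ N := by exact_mod_cast hN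
    rcases lt_or_gt_of_ne hkd with hlt | hgt
    · -- cover
      let f : (Fin k → Fin N) → Set (Fin k → ℝ) := fun j => cube01 k ∩ gmap N j ⁻¹' γ
      have hgm : ∀ j : Fin k → Fin N, Measurable (gmap N j) := by
        intro j; unfold gmap; fun_prop
      have hfm : ∀ j, MeasurableSet (f j) := fun j => (cube_meas k).inter (hgm j hm)
      have hun : γ = ⋃ j, gmap N j '' f j := by
        ext y
        simp only [Set.mem_iUnion]
        constructor
        · intro hy
          obtain ⟨j, z, hz, rfl⟩ := gmap_cover hN (hγ hy)
          exact ⟨j, z, ⟨hz, hy⟩, rfl⟩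
        · rintro ⟨j, z, hz, rfl⟩
          exact hz.2
      have hs : v γ = ∑ j, v (gmap N j '' f j) := by
        conv_lhs => rw [hun]
        rw [VectorMeasure.of_disjoint_iUnion (fun j => gmap_meas hN j (hfm j))
          (hdisj N hN f fun j => Set.inter_subset_left), tsum_fintype]
      have hb : ∀ j, ‖v (gmap N j '' f j)‖ * (N : ℝ) ^ d ≤ v.bound := by
        intro j
        have := h N hN j (f j) Set.inter_subset_left (hfm j)
        have h2 := v.norm_apply_le_bound (s := f j)
        rw [← this] at h2
        simpa using h2
      have hb2 : ‖v γ‖ * (N : ℝ) ^ d ≤ (N : ℝ) ^ k * v.bound := by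
        calc ‖v γ‖ * (N : ℝ) ^ d ≤ (∑ j, ‖v (gmap N j '' f j)‖) * (N : ℝ) ^ d := by
              gcongr; rw [hs]; exact norm_sum_le _ _
          _ = ∑ j, ‖v (gmap N j '' f j)‖ * (N : ℝ) ^ d := by rw [Finset.sum_mul]
          _ ≤ ∑ j : Fin k → Fin N, (v.bound : ℝ) := Finset.sum_le_sum fun j _ => hb j
          _ = _ := by simp
      have hpow : (N : ℝ) ^ k * N ≤ (N : ℝ) ^ d := by
        rw [← pow_succ]; exact pow_le_pow_right₀ hN1 hlt
      have hpos : (0 : ℝ) < (N : ℝ) ^ k := by positivity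
      have : (N : ℝ) ^ k * (‖v γ‖ * N) ≤ (N : ℝ) ^ k * v.bound := by
        refine le_trans ?_ hb2
        calc _ = ‖v γ‖ * ((N : ℝ) ^ k * N) := by ring
          _ ≤ _ := by gcongr
      exact le_of_mul_le_mul_left this hpos
    · have hb := v.norm_apply_le_bound (s := ⋃ j : Fin k → Fin N, gmap N j '' γ)
      rw [VectorMeasure.of_disjoint_iUnion (fun j => gmap_meas hN j hm)
          (hdisj N hN (fun _ => γ) fun j => hγ), tsum_fintype] at hb
      have hpd : (0 : ℝ) < (N : ℝ) ^ d := by positivity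
      have hs : (∑ j : Fin k → Fin N, v (gmap N j '' γ)) * (N : ℂ) ^ d = (N : ℂ) ^ k * v γ := by
        rw [Finset.sum_mul, Finset.sum_congr rfl fun j _ => h N hN j γ hγ hm]
        simp
      have hn := congrArg norm hs
      simp only [norm_mul, norm_pow, Complex.norm_natCast] at hn
      have hpow : (N : ℝ) ^ d * N ≤ (N : ℝ) ^ k := by
        rw [← pow_succ]; exact pow_le_pow_right₀ hN1 hgt
      have : (N : ℝ) ^ d * (‖v γ‖ * N) ≤ (N : ℝ) ^ d * v.bound := by
        calc _ = ((N : ℝ) ^ d * N) * ‖v γ‖ := by ring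
          _ ≤ (N : ℝ) ^ k * ‖v γ‖ := by gcongr
          _ = _ := hn.symm
          _ ≤ v.bound * (N : ℝ) ^ d := by gcongr
          _ = _ := by ring
      exact le_of_mul_le_mul_left this hpd
  by_contra hne
  have hp : 0 < ‖v γ‖ := norm_pos_iff.2 hne
  obtain ⟨N, hN⟩ := exists_nat_gt ((v.bound : ℝ) / ‖v γ‖)
  have hN0 : 0 < N := by
    have : (0 : ℝ) ≤ (v.bound : ℝ) / ‖v γ‖ := by positivity
    exact_mod_cast this.trans_lt hN
  have := key N hN0
  rw [div_lt_iff₀ hp] at hN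
  linarith

lemma affine_meas {n : ℕ} {t : ℝ} (ht : 0 < t) (w : Rn n) {β : Set (Rn n)} (hβ : MeasurableSet β) :
    MeasurableSet ((fun y => t • y + w) '' β) := by
  have : (fun y => t • y + w) '' β = (fun y => t⁻¹ • (y - w)) ⁻¹' β := by
    ext y
    constructor
    · rintro ⟨z, hz, rfl⟩
      simpa [smul_smul, ht.ne'] using hz
    · intro hy
      exact ⟨_, hy, by simp [smul_smul, ht.ne']⟩
  rw [this]
  exact hβ.preimage (by fun_prop)

lemma affine_eq {n d : ℕ} (Φ : CurvatureMeasure n) (hhom : Φ.Homogeneous d) {P Q : Set (Rn n)}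
    (hP : IsConvexBody P) (hQ : IsConvexBody Q) {t : ℝ} (ht : 0 < t) (w : Rn n) {β : Set (Rn n)}
    (hβ : MeasurableSet β) (hloc : ∀ x ∈ β, ∀ᶠ y in 𝓝 x, (y ∈ P ↔ t • y + w ∈ Q)) :
    Φ.meas Q ((fun y => t • y + w) '' β) = (t : ℂ) ^ d * Φ.meas P β := by
  set Q' : Set (Rn n) := (fun y => t⁻¹ • (y - w)) '' Q with hQ'
  have hmem : ∀ y, y ∈ Q' ↔ t • y + w ∈ Q := by
    intro y
    constructor
    · rintro ⟨z, hz, rfl⟩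
      simpa [smul_smul, ht.ne'] using hz
    · intro hy
      exact ⟨_, hy, by simp [smul_smul, ht.ne']⟩
  have hQb : IsConvexBody Q' := by
    refine ⟨hQ.1.image _, hQ.2.1.image (by fun_prop), ?_⟩
    intro x hx y hy a b ha hb hab
    rw [hmem] at hx hy ⊢
    have := hQ.2.2 hx hy ha hb hab
    convert this using 1
    have hw : w = a • w + b • w := by rw [← add_smul, hab, one_smul]
    nth_rewrite 1 [hw]
    simp only [smul_add, smul_smul, mul_comm t]
    abel
  have h1 : Φ.meas P β = Φ.meas Q' β := by
    refine Φ.locality P Q' (interior {y | y ∈ P ↔ t • y + w ∈ Q}) hP hQb isOpen_interior ?_ β hβ ?_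
    · ext y
      constructor
      · rintro ⟨a, b⟩
        exact ⟨(hmem y).2 ((interior_subset b).1 a), b⟩
      · rintro ⟨a, b⟩
        exact ⟨(interior_subset b).2 ((hmem y).1 a), b⟩
    · intro x hx
      exact mem_interior_iff_mem_nhds.2 (hloc x hx)
  have hsm : ∀ s : Set (Rn n), (fun y => y + w) '' (t • s) = (fun y => t • y + w) '' s := by
    intro s
    rw [← Set.image_smul, Set.image_image]
  have hQQ : (fun y => y + w) '' (t • Q') = Q := by
    rw [hsm]
    ext y
    constructor
    · rintro ⟨z, hz, rfl⟩
      exact (hmem z).1 hz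
    · intro hy
      exact ⟨t⁻¹ • (y - w), (hmem _).2 (by simpa [smul_smul, ht.ne'] using hy), by simp [smul_smul, ht.ne']⟩
  have htQ : IsConvexBody (t • Q') :=
    ⟨hQb.1.smul_set, hQb.2.1.smul t, hQb.2.2.smul t⟩
  have h2 := Φ.translation_invariant (t • Q') htQ w (t • β) (hβ.const_smul₀ t)
  rw [hQQ, hsm, hhom t ht Q' hQb β hβ] at h2
  rw [h2, h1]

lemma trans_eq {n d : ℕ} (Φ : CurvatureMeasure n) (hhom : Φ.Homogeneous d) {P Q : Set (Rn n)}
    (hP : IsConvexBody P) (hQ : IsConvexBody Q) (w : Rn n) {β : Set (Rn n)}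
    (hβ : MeasurableSet β) (hloc : ∀ x ∈ β, ∀ᶠ y in 𝓝 x, (y ∈ P ↔ y + w ∈ Q)) :
    Φ.meas Q ((fun y => y + w) '' β) = Φ.meas P β := by
  have := affine_eq Φ hhom hP hQ one_pos w hβ (by simpa using hloc)
  simpa using this

lemma outside_zero {n d : ℕ} (hn : 2 ≤ n) (Φ : CurvatureMeasure n) (hhom : Φ.Homogeneous d) {P : Set (Rn n)}
    (hP : IsConvexBody P) {β : Set (Rn n)} (hβ : MeasurableSet β) (hd : Disjoint β P) :
    Φ.meas P β = 0 := by
  have : Nontrivial (Rn n) := by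
    have : Nonempty (Fin n) := ⟨⟨0, by omega⟩⟩
    infer_instance
  obtain ⟨v, hv⟩ := exists_norm_eq (Rn n) (zero_le_one (α := ℝ))
  -- bounded case
  have hbdd : ∀ m : ℕ, Φ.meas P (β ∩ closedBall 0 m) = 0 := by
    intro m
    obtain ⟨R, hR⟩ := hP.2.1.isBounded.subset_closedBall (0 : Rn n)
    set S : ℝ := max R m with hS
    have hS1 : R ≤ S := le_max_left _ _
    have hS2 : (m : ℝ) ≤ S := le_max_right _ _
    have hS0 : 0 ≤ S := le_trans (by positivity) hS2
    set T : ℝ := 2 * S + 1 with hT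
    have hnorm : ∀ j : ℕ, ‖((j : ℝ) * T) • v‖ = j * T := by
      intro j
      rw [norm_smul, hv, mul_one, Real.norm_of_nonneg (by positivity)]
    have hgmeas : MeasurableSet (β ∩ closedBall (0 : Rn n) m) := hβ.inter measurableSet_closedBall
    refine vm_const_zero (Φ.meas P) _ (fun j : ℕ => (fun y => y + ((j : ℝ) * T) • v) '' (β ∩ closedBall 0 m)) ?_ ?_ ?_
    · intro j
      have := affine_meas one_pos (((j : ℝ) * T) • v) hgmeas
      simpa using this
    · have main : ∀ i j : ℕ, i < j → ∀ x ∈ closedBall (0 : Rn n) m, ∀ y ∈ closedBall (0 : Rn n) m,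
          x + ((i : ℝ) * T) • v ≠ y + ((j : ℝ) * T) • v := by
        intro i j hij x hx y hy he
        have h1 : x - y = (((j : ℝ) - i) * T) • v := by
          rw [sub_mul, sub_smul, sub_eq_sub_iff_add_eq_add, he, add_comm]
        have h2 := norm_sub_le x y
        have hji : (1 : ℝ) ≤ (j : ℝ) - i := by
          have : (i : ℝ) + 1 ≤ j := by exact_mod_cast hij
          linarith
        rw [h1, norm_smul, hv, mul_one, Real.norm_of_nonneg (by positivity)] at h2
        rw [mem_closedBall_zero_iff] at hx hy
        nlinarith
      intro i j hij
      rw [Function.onFun, Set.disjoint_left]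
      rintro _ ⟨x, hx, rfl⟩ ⟨y, hy, he⟩
      rcases lt_or_gt_of_ne hij with h | h
      · exact main i j h x hx.2 y hy.2 he.symm
      · exact main j i h y hy.2 x hx.2 he
    · intro j
      refine trans_eq Φ hhom hP hP _ hgmeas ?_
      intro x hx
      have hc : IsClosed P := hP.2.1.isClosed
      have hx1 : x ∉ P := fun h => Set.disjoint_left.1 hd hx.1 h
      have hx2 : x + ((j : ℝ) * T) • v ∉ P := by
        rcases Nat.eq_zero_or_pos j with rfl | hj
        · simpa using hx1
        · intro h
          have h1 := hR h
          rw [mem_closedBall_zero_iff] at h1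
          have h2 := hx.2
          rw [mem_closedBall_zero_iff] at h2
          have h3 := norm_sub_le (x + ((j : ℝ) * T) • v) x
          rw [add_sub_cancel_left, hnorm] at h3
          have hj1 : (1 : ℝ) ≤ j := by exact_mod_cast hj
          nlinarith
      have e1 : ∀ᶠ y in 𝓝 x, y ∉ P := hc.isOpen_compl.mem_nhds hx1
      have e2 : ∀ᶠ y in 𝓝 x, y + ((j : ℝ) * T) • v ∉ P :=
        (by fun_prop : Continuous fun y : Rn n => y + ((j : ℝ) * T) • v).continuousAt.eventually
          (hc.isOpen_compl.mem_nhds hx2)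
      filter_upwards [e1, e2] with y h1 h2
      simp [h1, h2]
  have hun : β = ⋃ m : ℕ, β ∩ closedBall (0 : Rn n) m := by
    ext x
    simp only [Set.mem_iUnion, Set.mem_inter_iff, mem_closedBall_zero_iff]
    constructor
    · intro h
      obtain ⟨m, hm⟩ := exists_nat_ge ‖x‖
      exact ⟨m, h, hm⟩
    · rintro ⟨m, h, _⟩
      exact h
  have ht := VectorMeasure.tendsto_vectorMeasure_iUnion_atTop_nat (v := Φ.meas P)
    (s := fun m : ℕ => β ∩ closedBall (0 : Rn n) m)
    (fun a b hab => Set.inter_subset_inter_right _ (closedBall_subset_closedBall (by exact_mod_cast hab)))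
    (fun m => hβ.inter measurableSet_closedBall)
  rw [← hun] at ht
  simp only [hbdd] at ht
  exact tendsto_nhds_unique ht tendsto_const_nhds

/-- polyhedron -/
def poly {n : ℕ} (F : Finset (Rn n × ℝ)) : Set (Rn n) := {x | ∀ p ∈ F, inner ℝ p.1 x ≤ p.2}

open Classical in
noncomputable def act {n : ℕ} (F : Finset (Rn n × ℝ)) (x : Rn n) : Finset (Rn n × ℝ) :=
  F.filter fun p => inner ℝ p.1 x = p.2

def stratum {n : ℕ} (F A : Finset (Rn n × ℝ)) : Set (Rn n) := {x | x ∈ poly F ∧ act F x = A}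

def lin {n : ℕ} (A : Finset (Rn n × ℝ)) : Submodule ℝ (Rn n) where
  carrier := {v | ∀ p ∈ A, inner ℝ p.1 v = 0}
  add_mem' := by
    intro a b ha hb p hp
    simp [inner_add_right, ha p hp, hb p hp]
  zero_mem' := by simp
  smul_mem' := by
    intro c x hx p hp
    simp [inner_smul_right, hx p hp]

lemma mem_lin {n : ℕ} {A : Finset (Rn n × ℝ)} {v : Rn n} :
    v ∈ lin A ↔ ∀ p ∈ A, inner ℝ p.1 v = 0 := Iff.rfl

lemma mem_stratum {n : ℕ} {F A : Finset (Rn n × ℝ)} (hA : A ⊆ F) {x : Rn n} :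
    x ∈ stratum F A ↔ (∀ p ∈ A, inner ℝ p.1 x = p.2) ∧ ∀ p ∈ F, p ∉ A → inner ℝ p.1 x < p.2 := by
  classical
  constructor
  · rintro ⟨h1, rfl⟩
    refine ⟨fun p hp => (Finset.mem_filter.1 hp).2, fun p hp hpA => lt_of_le_of_ne (h1 p hp) ?_⟩
    intro h
    exact hpA (Finset.mem_filter.2 ⟨hp, h⟩)
  · rintro ⟨h1, h2⟩
    refine ⟨fun p hp => ?_, ?_⟩
    · by_cases h : p ∈ A
      · exact (h1 p h).le
      · exact (h2 p hp h).le
    · ext p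
      simp only [act, Finset.mem_filter]
      constructor
      · rintro ⟨hp, he⟩
        by_contra h
        exact (h2 p hp h).ne he
      · intro hp
        exact ⟨hA hp, h1 p hp⟩

lemma stratum_meas {n : ℕ} {F A : Finset (Rn n × ℝ)} (hA : A ⊆ F) : MeasurableSet (stratum F A) := by
  have : stratum F A = (⋂ p ∈ A, {x | inner ℝ p.1 x = p.2}) ∩ ⋂ p ∈ F, ⋂ (_ : p ∉ A), {x | inner ℝ p.1 x < p.2} := by
    ext x; rw [mem_stratum hA]; simp
  rw [this]
  refine MeasurableSet.inter (Finset.measurableSet_biInter _ fun p _ => ?_)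
    (Finset.measurableSet_biInter _ fun p _ => MeasurableSet.iInter fun _ => ?_)
  · exact measurableSet_eq_fun (by fun_prop) (by fun_prop)
  · exact measurableSet_lt (by fun_prop) (by fun_prop)

lemma germ {n : ℕ} {F : Finset (Rn n × ℝ)} {x : Rn n} (hx : x ∈ poly F) :
    ∀ᶠ y in 𝓝 x, (y ∈ poly F ↔ ∀ p ∈ act F x, inner ℝ p.1 (y - x) ≤ 0) := by
  classical
  have h : ∀ p ∈ F, ∀ᶠ y in 𝓝 x, (inner ℝ p.1 y ≤ p.2 ↔ (p ∈ act F x → inner ℝ p.1 (y - x) ≤ 0)) := by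
    intro p hp
    by_cases hpa : inner ℝ p.1 x = p.2
    · refine Eventually.of_forall fun y => ?_
      have : p ∈ act F x := Finset.mem_filter.2 ⟨hp, hpa⟩
      simp [this, inner_sub_right, hpa]
    · have hlt : inner ℝ p.1 x < p.2 := lt_of_le_of_ne (hx p hp) hpa
      have : ∀ᶠ y in 𝓝 x, inner ℝ p.1 y < p.2 :=
        (by fun_prop : Continuous fun y : Rn n => inner ℝ p.1 y).continuousAt.eventually
          (gt_mem_nhds hlt)
      filter_upwards [this] with y hy
      have : p ∉ act F x := fun h => hpa (Finset.mem_filter.1 h).2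
      simp [this, hy.le]
  rw [← Filter.eventually_all_finset] at h
  filter_upwards [h] with y hy
  constructor
  · intro hyF p hp
    exact (hy p (Finset.mem_filter.1 hp).1).1 (hyF p (Finset.mem_filter.1 hp).1) hp
  · intro h p hp
    exact (hy p hp).2 (h p)

/-- self-similarity of strata -/
lemma stratum_affine {n d : ℕ} (Φ : CurvatureMeasure n) (hhom : Φ.Homogeneous d)
    {F A : Finset (Rn n × ℝ)} (hP : IsConvexBody (poly F)) {t : ℝ} (ht : 0 < t) (w : Rn n)
    {β : Set (Rn n)} (hβ : MeasurableSet β) (h1 : β ⊆ stratum F A)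
    (h2 : ∀ x ∈ β, t • x + w ∈ stratum F A) :
    Φ.meas (poly F) ((fun y => t • y + w) '' β) = (t : ℂ) ^ d * Φ.meas (poly F) β := by
  refine affine_eq Φ hhom hP hP ht w hβ ?_
  intro x hx
  have g1 := germ (h1 hx).1
  have g2 := (by fun_prop : Continuous fun y : Rn n => t • y + w).continuousAt.eventually
    (germ (h2 x hx).1)
  rw [(h1 hx).2] at g1
  rw [(h2 x hx).2] at g2
  filter_upwards [g1, g2] with y a b
  rw [a, b]
  refine forall₂_congr fun p hp => ?_
  have : t • y + w - (t • x + w) = t • (y - x) := by rw [smul_sub]; abel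
  rw [this, inner_smul_right]
  constructor
  · intro h; exact mul_nonpos_of_nonneg_of_nonpos ht.le h
  · intro h; exact nonpos_of_mul_nonpos_right h ht

lemma onb_exists {n : ℕ} (L : Submodule ℝ (Rn n)) : ∃ b : Fin (Module.finrank ℝ L) → Rn n,
    Orthonormal ℝ b ∧ (∀ i, b i ∈ L) ∧ ∀ v ∈ L, ∑ i, (inner ℝ (b i) v : ℝ) • b i = v := by
  let B := stdOrthonormalBasis ℝ L
  refine ⟨fun i => (B i : Rn n), ?_, fun i => (B i).2, ?_⟩
  · exact B.orthonormal.comp_linearIsometry L.subtypeₗᵢ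
  · intro v hv
    have := congrArg (Subtype.val) (B.sum_repr' ⟨v, hv⟩)
    simpa using this

structure SChart {n : ℕ} (F A : Finset (Rn n × ℝ)) where
  x0 : Rn n
  b : Fin (Module.finrank ℝ (lin A)) → Rn n
  r : ℝ
  hr : 0 < r
  on : Orthonormal ℝ b
  blin : ∀ i, b i ∈ lin A
  span : ∀ v ∈ lin A, ∑ i, (inner ℝ (b i) v : ℝ) • b i = v
  sub : ∀ z : Fin (Module.finrank ℝ (lin A)) → ℝ, (∀ i, |z i| ≤ 1) → x0 + r • ∑ i, z i • b i ∈ stratum F A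

namespace SChart
variable {n : ℕ} {F A : Finset (Rn n × ℝ)} (C : SChart F A)

noncomputable def psi (z : Fin (Module.finrank ℝ (lin A)) → ℝ) : Rn n := C.x0 + C.r • ∑ i, z i • C.b i
noncomputable def co (x : Rn n) : Fin (Module.finrank ℝ (lin A)) → ℝ := fun i => inner ℝ (C.b i) (x - C.x0) / C.r

lemma co_meas : Measurable C.co := by unfold co; fun_prop

lemma co_psi (z) : C.co (C.psi z) = z := by
  funext i
  have := C.on.inner_right_fintype z i
  simp only [co, psi, add_sub_cancel_left, inner_smul_right, this]
  field_simp [C.hr.ne']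

lemma psi_mem {z} (hz : ∀ i, |z i| ≤ 1) : C.psi z ∈ stratum F A := C.sub z hz

lemma x0_mem : C.x0 ∈ stratum F A := by
  have := C.sub 0 (by simp)
  simpa using this

lemma psi_co (hA : A ⊆ F) {x} (hx : x ∈ stratum F A) : C.psi (C.co x) = x := by
  have hl : x - C.x0 ∈ lin A := by
    intro p hp
    rw [inner_sub_right, ((mem_stratum hA).1 hx).1 p hp, ((mem_stratum hA).1 C.x0_mem).1 p hp, sub_self]
  have := C.span _ hl
  simp only [psi, co]
  rw [Finset.smul_sum]
  simp only [smul_smul, mul_div_cancel₀ _ C.hr.ne']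
  rw [this]; abel

lemma psi_affine (t : ℝ) (z z0) : t • C.psi z + (C.psi z0 - t • C.x0) = C.psi (fun i => z0 i + t * z i) := by
  simp only [psi, add_smul, Finset.sum_add_distrib, smul_add, mul_smul, ← Finset.smul_sum]
  rw [smul_comm t C.r]
  abel
end SChart

lemma schart_exists {n : ℕ} {F A : Finset (Rn n × ℝ)} (hA : A ⊆ F) {x0 : Rn n} (hx : x0 ∈ stratum F A) :
    ∃ C : SChart F A, C.x0 = x0 := by
  obtain ⟨b, h1, h2, h3⟩ := onb_exists (lin A)
  have hx' := (mem_stratum hA).1 hx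
  set S : ℝ := ∑ i, ‖b i‖ + 1 with hS
  have hS0 : 0 < S := by
    have : 0 ≤ ∑ i, ‖b i‖ := Finset.sum_nonneg fun _ _ => norm_nonneg _
    linarith
  have hev : ∀ᶠ y in 𝓝 x0, ∀ p ∈ F, p ∉ A → inner ℝ p.1 y < p.2 := by
    rw [Filter.eventually_all_finset]
    intro p hp
    by_cases h : p ∈ A
    · simp [h]
    · have : ∀ᶠ y in 𝓝 x0, inner ℝ p.1 y < p.2 :=
        (by fun_prop : Continuous fun y : Rn n => inner ℝ p.1 y).continuousAt.eventually
          (gt_mem_nhds (hx'.2 p hp h))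
      filter_upwards [this] with y hy _ using hy
  obtain ⟨ε, hε, hball⟩ := Metric.eventually_nhds_iff.1 hev
  refine ⟨⟨x0, b, ε / (2 * S), by positivity, h1, h2, h3, ?_⟩, rfl⟩
  intro z hz
  rw [mem_stratum hA]
  have hl : (ε / (2 * S)) • ∑ i, z i • b i ∈ lin A :=
    Submodule.smul_mem _ _ (Submodule.sum_mem _ fun i _ => Submodule.smul_mem _ _ (h2 i))
  constructor
  · intro p hp
    rw [inner_add_right, hx'.1 p hp, mem_lin.1 hl p hp, add_zero]
  · intro p hp hpA
    refine hball ?_ p hp hpA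
    rw [dist_self_add_left, norm_smul, Real.norm_of_nonneg (by positivity)]
    have hs : ‖∑ i, z i • b i‖ ≤ S := by
      refine (norm_sum_le _ _).trans ?_
      have : ∑ i, ‖z i • b i‖ ≤ ∑ i, ‖b i‖ := by
        refine Finset.sum_le_sum fun i _ => ?_
        rw [norm_smul]
        exact mul_le_of_le_one_left (norm_nonneg _) (hz i)
      linarith
    calc ε / (2 * S) * ‖∑ i, z i • b i‖ ≤ ε / (2 * S) * S := by gcongr
      _ = ε / 2 := by field_simp
      _ < ε := by linarith

lemma shrink {n d : ℕ} (Φ : CurvatureMeasure n) (hhom : Φ.Homogeneous d)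
    {F A : Finset (Rn n × ℝ)} (hA : A ⊆ F) (hP : IsConvexBody (poly F)) (C : SChart F A)
    (h : ∀ β ⊆ stratum F A, MeasurableSet β → (∀ x ∈ β, ∀ i, C.co x i ∈ Set.Ioo (0 : ℝ) 1) →
      Φ.meas (poly F) β = 0) :
    ∀ β ⊆ stratum F A, MeasurableSet β → Φ.meas (poly F) β = 0 := by
  intro β hβ hm
  obtain ⟨R, hR⟩ := hP.2.1.isBounded.subset_closedBall C.x0
  have hr := C.hr
  set R' : ℝ := max R 1
  have hR' : 0 < R' := lt_of_lt_of_le one_pos (le_max_right _ _)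
  have hco : ∀ x ∈ β, ∀ i, |C.co x i| ≤ R' / C.r := by
    intro x hx i
    have h1 := hR (hβ hx).1
    rw [mem_closedBall, dist_eq_norm] at h1
    have h2 := abs_real_inner_le_norm (C.b i) (x - C.x0)
    rw [C.on.1 i, one_mul] at h2
    simp only [SChart.co]
    rw [abs_div, abs_of_pos hr]
    gcongr
    exact h2.trans (h1.trans (le_max_left _ _))
  set t : ℝ := C.r / (4 * R') with ht
  have ht0 : 0 < t := by positivity
  have htc : ∀ x ∈ β, ∀ i, |t * C.co x i| ≤ 1 / 4 := by
    intro x hx i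
    rw [abs_mul, abs_of_pos ht0]
    calc t * |C.co x i| ≤ t * (R' / C.r) := by gcongr; exact hco x hx i
      _ = 1 / 4 := by rw [ht]; field_simp
  set w : Rn n := C.psi (fun _ => 1 / 2) - t • C.x0 with hw
  have him : ∀ x ∈ β, t • x + w = C.psi (fun i => 1 / 2 + t * C.co x i) := by
    intro x hx
    conv_lhs => rw [← C.psi_co hA (hβ hx)]
    rw [hw, C.psi_affine]
  have hmem : ∀ x ∈ β, t • x + w ∈ stratum F A := by
    intro x hx
    rw [him x hx]
    apply C.psi_mem
    intro i
    have := abs_le.1 (htc x hx i)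
    rw [abs_le]; constructor <;> linarith
  have h1 := stratum_affine Φ hhom hP ht0 w hm hβ hmem
  rw [h _ (by rintro _ ⟨x, hx, rfl⟩; exact hmem x hx) (affine_meas ht0 w hm)] at h1
  · have : (t : ℂ) ^ d ≠ 0 := pow_ne_zero _ (by exact_mod_cast ht0.ne')
    exact (mul_eq_zero.1 h1.symm).resolve_left this
  · rintro _ ⟨x, hx, rfl⟩ i
    simp only [him x hx, C.co_psi]
    have := abs_le.1 (htc x hx i)
    constructor <;> linarith

lemma stratum_zero {n d : ℕ} (Φ : CurvatureMeasure n) (hhom : Φ.Homogeneous d)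
    {F A : Finset (Rn n × ℝ)} (hA : A ⊆ F) (hP : IsConvexBody (poly F))
    (hk : Module.finrank ℝ (lin A) ≠ d) :
    ∀ β ⊆ stratum F A, MeasurableSet β → Φ.meas (poly F) β = 0 := by
  intro β0 hβ0 hm0
  rcases Set.eq_empty_or_nonempty (stratum F A) with he | ⟨x0, hx0⟩
  · rw [he, Set.subset_empty_iff] at hβ0
    simp [hβ0]
  obtain ⟨C, -⟩ := schart_exists hA hx0
  refine shrink Φ hhom hA hP C ?_ β0 hβ0 hm0
  intro β hβ hm hc
  have hS := stratum_meas hA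
  set v : ComplexMeasure (Fin (Module.finrank ℝ (lin A)) → ℝ) :=
    ((Φ.meas (poly F)).restrict (stratum F A)).map C.co with hv
  have hva : ∀ γ, MeasurableSet γ → v γ = Φ.meas (poly F) (C.co ⁻¹' γ ∩ stratum F A) := by
    intro γ hγ
    rw [hv, VectorMeasure.map_apply _ C.co_meas hγ, VectorMeasure.restrict_apply _ hS (C.co_meas hγ)]
  have habs : ∀ z ∈ cube01 (Module.finrank ℝ (lin A)), ∀ i, |z i| ≤ 1 := by
    intro z hz i
    obtain ⟨a1, a2⟩ := hz i (Set.mem_univ i)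
    rw [abs_of_nonneg a1]; exact a2.le
  have hz := grid_zero hk v ?_
  · -- β = co ⁻¹' (psi⁻¹ β) ∩ S
    have hpm : Measurable C.psi := by unfold SChart.psi; fun_prop
    have hγ : MeasurableSet (C.psi ⁻¹' β ∩ cube01 _) := (hpm hm).inter (cube_meas _)
    have h1 := hz _ Set.inter_subset_right hγ
    rw [hva _ hγ] at h1
    convert h1 using 2
    ext x
    constructor
    · intro hx
      refine ⟨⟨?_, ?_⟩, hβ hx⟩
      · simpa [C.psi_co hA (hβ hx)] using hx
      · intro i _
        exact ⟨(hc x hx i).1.le, (hc x hx i).2⟩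
    · rintro ⟨⟨h2, _⟩, h3⟩
      simpa [C.psi_co hA h3] using h2
  · intro N hN j γ hγ hγm
    have hN0 : (0 : ℝ) < N := by exact_mod_cast hN
    rw [hva _ (gmap_meas hN j hγm), hva _ hγm]
    set β' := C.co ⁻¹' γ ∩ stratum F A with hβ'
    set w : Rn n := C.psi (fun i => (j i : ℕ) / (N : ℝ)) - (N : ℝ)⁻¹ • C.x0 with hw
    have him : ∀ x ∈ stratum F A, (N : ℝ)⁻¹ • x + w = C.psi (gmap N j (C.co x)) := by
      intro x hx
      conv_lhs => rw [← C.psi_co hA hx]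
      rw [hw, C.psi_affine]
      congr 1
      funext i
      simp only [gmap]; field_simp; ring
    have hmem : ∀ x ∈ β', (N : ℝ)⁻¹ • x + w ∈ stratum F A := by
      intro x hx
      rw [him x hx.2]
      exact C.psi_mem (habs _ (gmap_mem hN j (hγ hx.1)))
    have h1 := stratum_affine Φ hhom hP (inv_pos.2 hN0) w ((C.co_meas hγm).inter hS) Set.inter_subset_right hmem
    have hset : C.co ⁻¹' (gmap N j '' γ) ∩ stratum F A = (fun y => (N : ℝ)⁻¹ • y + w) '' β' := by
      ext x
      constructor
      · rintro ⟨⟨z, hz, hzx⟩, hxS⟩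
        have hzS : C.psi z ∈ stratum F A := C.psi_mem (habs _ (hγ hz))
        refine ⟨C.psi z, ⟨?_, hzS⟩, ?_⟩
        · simpa [C.co_psi] using hz
        · simp only
          rw [him _ hzS, C.co_psi, hzx, C.psi_co hA hxS]
      · rintro ⟨y, hy, rfl⟩
        refine ⟨⟨C.co y, hy.1, ?_⟩, hmem y hy⟩
        simp only
        rw [him y hy.2, C.co_psi]
    rw [hset, h1]
    have hNd : (N : ℂ) ^ d ≠ 0 := pow_ne_zero _ (by exact_mod_cast hN.ne')
    push_cast
    rw [inv_pow, mul_comm, ← mul_assoc, mul_inv_cancel₀ hNd, one_mul]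

lemma lower_zero {n : ℕ} (Φ : CurvatureMeasure n)
    {F : Finset (Rn n × ℝ)} {β : Set (Rn n)} (hβ : MeasurableSet β)
    (hsub : β ⊆ poly F)
    (h : ∀ A ⊆ F, ∀ γ ⊆ β ∩ stratum F A, MeasurableSet γ → Φ.meas (poly F) γ = 0) :
    Φ.meas (poly F) β = 0 := by
  classical
  have hun : β = ⋃ A ∈ F.powerset, β ∩ stratum F A := by
    ext x
    simp only [Set.mem_iUnion, Finset.mem_powerset, exists_prop]
    constructor
    · intro hx
      exact ⟨act F x, Finset.filter_subset _ _, hx, hsub hx, rfl⟩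
    · rintro ⟨A, _, hx, _⟩
      exact hx
  rw [hun, VectorMeasure.of_biUnion_finset]
  · refine Finset.sum_eq_zero fun A hA => ?_
    have hA := Finset.mem_powerset.1 hA
    exact h A hA _ subset_rfl (hβ.inter (stratum_meas hA))
  · intro A _ B _ hAB
    rw [Function.onFun, Set.disjoint_left]
    rintro x ⟨_, h1⟩ ⟨_, h2⟩
    exact hAB (h1.2.symm.trans h2.2)
  · intro A hA
    exact hβ.inter (stratum_meas (Finset.mem_powerset.1 hA))

lemma poly_closed {n : ℕ} (F : Finset (Rn n × ℝ)) : IsClosed (poly F) := by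
  have : poly F = ⋂ p ∈ F, {x | inner ℝ p.1 x ≤ p.2} := by ext x; simp [poly]
  rw [this]
  exact isClosed_biInter fun p _ => isClosed_le (by fun_prop) (by fun_prop)

lemma poly_convex {n : ℕ} (F : Finset (Rn n × ℝ)) : Convex ℝ (poly F) := by
  intro x hx y hy a b ha hb hab p hp
  rw [inner_add_right, inner_smul_right, inner_smul_right]
  have h1 := mul_le_mul_of_nonneg_left (hx p hp) ha
  have h2 := mul_le_mul_of_nonneg_left (hy p hp) hb
  have : a * p.2 + b * p.2 = p.2 := by rw [← add_mul, hab, one_mul]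
  linarith

open Classical in
noncomputable def bF {n k : ℕ} (e u : Rn n) (b : Fin k → Rn n) (s : Fin k → ℝ) (l : ℝ) : Finset (Rn n × ℝ) :=
  {(e, 0), (-e, 0), (u, l), (-u, l)} ∪ Finset.univ.image (fun i => (b i, s i)) ∪
    Finset.univ.image (fun i => (-b i, s i))

lemma mem_bF_pos {n k : ℕ} {e u : Rn n} {b : Fin k → Rn n} {s : Fin k → ℝ} {l : ℝ} (i : Fin k) :
    (b i, s i) ∈ bF e u b s l := by
  classical
  exact Finset.mem_union_left _ (Finset.mem_union_right _ (Finset.mem_image.2 ⟨i, Finset.mem_univ i, rfl⟩))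

lemma mem_bF_neg {n k : ℕ} {e u : Rn n} {b : Fin k → Rn n} {s : Fin k → ℝ} {l : ℝ} (i : Fin k) :
    (-b i, s i) ∈ bF e u b s l := by
  classical
  exact Finset.mem_union_right _ (Finset.mem_image.2 ⟨i, Finset.mem_univ i, rfl⟩)

lemma mem_box {n k : ℕ} {e u : Rn n} {b : Fin k → Rn n} {s : Fin k → ℝ} {l : ℝ} {x : Rn n} :
    x ∈ poly (bF e u b s l) ↔ inner ℝ e x = 0 ∧ |inner ℝ u x| ≤ l ∧ ∀ i, |inner ℝ (b i) x| ≤ s i := by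
  constructor
  · intro h
    have h1 := h (e, 0) (by simp [bF])
    have h2 := h (-e, 0) (by simp [bF])
    have h3 := h (u, l) (by simp [bF])
    have h4 := h (-u, l) (by simp [bF])
    simp only [inner_neg_left] at h1 h2 h3 h4
    refine ⟨by linarith, abs_le.2 ⟨by linarith, h3⟩, fun i => ?_⟩
    have h5 := h (b i, s i) (mem_bF_pos i)
    have h6 := h (-b i, s i) (mem_bF_neg i)
    simp only [inner_neg_left] at h5 h6
    exact abs_le.2 ⟨by linarith, h5⟩
  · rintro ⟨h1, h2, h3⟩ p hp
    rw [abs_le] at h2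
    simp only [bF, Finset.mem_union, Finset.mem_insert, Finset.mem_singleton, Finset.mem_image, Finset.mem_univ, true_and] at hp
    rcases hp with ((rfl | rfl | rfl | rfl) | ⟨i, rfl⟩) | ⟨i, rfl⟩
    · exact h1.le
    · simp [h1]
    · exact h2.2
    · simp only [inner_neg_left]; linarith
    · exact (abs_le.1 (h3 i)).2
    · have := (abs_le.1 (h3 i)).1
      simp only [inner_neg_left]; linarith

/-- frame hypotheses -/
structure Frame {n k : ℕ} (e u : Rn n) (b : Fin k → Rn n) : Prop where
  he : inner ℝ e e = (1 : ℝ)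
  hu : inner ℝ u u = (1 : ℝ)
  heu : inner ℝ e u = (0 : ℝ)
  on : Orthonormal ℝ b
  heb : ∀ i, inner ℝ e (b i) = (0 : ℝ)
  hub : ∀ i, inner ℝ u (b i) = (0 : ℝ)
  span : ∀ v, inner ℝ e v = (0 : ℝ) → inner ℝ u v = (0 : ℝ) → ∑ i, (inner ℝ (b i) v : ℝ) • b i = v

lemma box_body {n k : ℕ} {e u : Rn n} {b : Fin k → Rn n} (hF : Frame e u b) {s : Fin k → ℝ} {l : ℝ}
    (hl : 0 ≤ l) (hs : ∀ i, 0 ≤ s i) : IsConvexBody (poly (bF e u b s l)) := by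
  refine ⟨⟨0, mem_box.2 ⟨by simp, by simpa using hl, by simpa using hs⟩⟩, ?_, poly_convex _⟩
  refine isCompact_of_isClosed_isBounded (poly_closed _) ?_
  refine (isBounded_closedBall (x := (0 : Rn n)) (r := l + ∑ i, s i)).subset ?_
  intro x hx
  obtain ⟨h1, h2, h3⟩ := mem_box.1 hx
  rw [mem_closedBall_zero_iff]
  have hun : ‖u‖ = 1 := by
    have := hF.hu
    rw [real_inner_self_eq_norm_sq] at this
    nlinarith [norm_nonneg u]
  have hsp := hF.span (x - (inner ℝ u x : ℝ) • u) (by simp [inner_sub_right, inner_smul_right, h1, hF.heu])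
    (by simp only [inner_sub_right, inner_smul_right, hF.hu]; ring)
  have hx' : x = (inner ℝ u x : ℝ) • u + ∑ i, (inner ℝ (b i) x : ℝ) • b i := by
    have hsum : ∑ i, (inner ℝ (b i) x : ℝ) • b i = x - (inner ℝ u x : ℝ) • u := by
      refine Eq.trans (Finset.sum_congr rfl fun i _ => ?_) hsp
      rw [inner_sub_right, inner_smul_right, real_inner_comm u (b i), hF.hub i, mul_zero, sub_zero]
    rw [hsum, add_sub_cancel]
  rw [hx']
  refine (norm_add_le _ _).trans (add_le_add ?_ ((norm_sum_le _ _).trans (Finset.sum_le_sum fun i _ => ?_)))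
  · rw [norm_smul, hun, mul_one]; exact h2
  · rw [norm_smul, hF.on.1 i, mul_one]; exact h3 i

section
variable {n d k : ℕ} (Φ : CurvatureMeasure n) (hhom : Φ.Homogeneous d)
    (heven : ∀ K : Set (Rn n), IsConvexBody K → ∀ β : Set (Rn n), MeasurableSet β →
      Φ.meas (-K) (-β) = Φ.meas K β)
    (hglob : ∀ K : Set (Rn n), IsConvexBody K → Φ.meas K Set.univ = 0)
    {e u : Rn n} {b : Fin k → Rn n} (hF : Frame e u b) {s : Fin k → ℝ} (hs : ∀ i, 0 ≤ s i)

/-- the pushforward to the `u` axis -/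
noncomputable def mm (Φ : CurvatureMeasure n) (e u : Rn n) (b : Fin k → Rn n) (s : Fin k → ℝ) (l : ℝ) :
    ComplexMeasure ℝ := (Φ.meas (poly (bF e u b s l))).map (fun x => inner ℝ u x)

lemma mm_apply (l : ℝ) {J : Set ℝ} (hJ : MeasurableSet J) :
    mm Φ e u b s l J = Φ.meas (poly (bF e u b s l)) {x | inner ℝ u x ∈ J} := by
  rw [mm, VectorMeasure.map_apply _ (by fun_prop) hJ]; rfl

include hhom hF hs in
lemma mm_trans {l l' c : ℝ} (hl : 0 ≤ l) (hl' : 0 ≤ l') {J J' : Set ℝ} (hJ : MeasurableSet J)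
    (hJ' : J' = (fun a => a - c) ⁻¹' J)
    (h : ∀ a ∈ J, ∀ᶠ a' in 𝓝 a, (|a'| ≤ l ↔ |a' + c| ≤ l')) :
    mm Φ e u b s l' J' = mm Φ e u b s l J := by
  have hJm : MeasurableSet J' := by
    rw [hJ']; exact hJ.preimage (by fun_prop)
  rw [mm_apply Φ l hJ, mm_apply Φ l' hJm]
  have hm : MeasurableSet {x : Rn n | inner ℝ u x ∈ J} :=
    hJ.preimage (by fun_prop : Measurable fun x : Rn n => (inner ℝ u x : ℝ))
  rw [← trans_eq Φ hhom (box_body hF hl hs) (box_body hF hl' hs) (c • u) hm]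
  · congr 1
    ext x
    simp only [hJ', Set.mem_ofPred_eq, Set.mem_preimage, Set.mem_image]
    constructor
    · intro hx
      refine ⟨x - c • u, ?_, by simp⟩
      rw [inner_sub_right, inner_smul_right, hF.hu, mul_one]; exact hx
    · rintro ⟨y, hy, rfl⟩
      rw [inner_add_right, inner_smul_right, hF.hu, mul_one, add_sub_cancel_right]; exact hy
  · intro x hx
    have := (by fun_prop : Continuous fun y : Rn n => (inner ℝ u y : ℝ)).continuousAt.eventually (h _ hx)
    filter_upwards [this] with y hy
    rw [mem_box, mem_box]
    simp only [inner_add_right, inner_smul_right, hF.hu, hF.heu, mul_one, mul_zero, add_zero, hy]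
    refine and_congr_right fun _ => and_congr_right fun _ => forall_congr' fun i => ?_
    rw [real_inner_comm u (b i), hF.hub i]; simp

include hhom hF hs heven hglob in
lemma prism_top {l : ℝ} (hl : 0 < l) : Φ.meas (poly (bF e u b s l)) {x | l ≤ inner ℝ u x} = 0 := by
  have hB := box_body hF hl.le hs
  have hB2 := box_body hF (by positivity : 0 ≤ 2 * l) hs
  have hmu : ∀ l, 0 ≤ l → mm Φ e u b s l Set.univ = 0 := by
    intro l hl
    rw [mm_apply Φ l MeasurableSet.univ]
    simpa using hglob _ (box_body hF hl hs)
  have hev : ∀ l, 0 ≤ l → mm Φ e u b s l (Set.Iic (-l)) = mm Φ e u b s l (Set.Ici l) := by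
    intro l hl
    have hB := box_body hF hl hs
    rw [mm_apply Φ l measurableSet_Iic, mm_apply Φ l measurableSet_Ici]
    have hm : MeasurableSet {x : Rn n | inner ℝ u x ∈ Set.Ici l} :=
      measurableSet_Ici.preimage (by fun_prop : Measurable fun x : Rn n => (inner ℝ u x : ℝ))
    rw [← heven _ hB _ hm]
    have h1 : -poly (bF e u b s l) = poly (bF e u b s l) := by
      ext x
      simp [mem_box]
    have h2 : -{x : Rn n | inner ℝ u x ∈ Set.Ici l} = {x : Rn n | inner ℝ u x ∈ Set.Iic (-l)} := by
      ext x
      simp [le_neg]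
    rw [h1, h2]
  have hsplit : ∀ l, 0 < l → mm Φ e u b s l (Set.Ioo (-l) l) = -2 * mm Φ e u b s l (Set.Ici l) := by
    intro l hl
    have h1 : (Set.univ : Set ℝ) = (Set.Iic (-l) ∪ Set.Ioo (-l) l) ∪ Set.Ici l := by
      ext x; simp; grind
    have h2 := hmu l hl.le
    rw [h1, VectorMeasure.of_union (by
        rw [Set.disjoint_left]; intro x; simp; grind) (measurableSet_Iic.union measurableSet_Ioo) measurableSet_Ici,
      VectorMeasure.of_union (by rw [Set.disjoint_left]; intro x; simp; grind) measurableSet_Iic measurableSet_Ioo,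
      hev l hl.le] at h2
    linear_combination h2
  have hT : mm Φ e u b s (2 * l) (Set.Ici (2 * l)) = mm Φ e u b s l (Set.Ici l) := by
    refine mm_trans Φ hhom hF hs hl.le (by positivity) (c := l) measurableSet_Ici ?_ ?_
    · ext x; simp; constructor <;> intro h <;> linarith
    · intro a ha
      have : ∀ᶠ a' in 𝓝 a, -l < a' := lt_mem_nhds (by simp at ha; linarith)
      filter_upwards [this] with a' h
      rw [abs_le, abs_le]
      constructor <;> rintro ⟨h1, h2⟩ <;> constructor <;> linarith
  have hR : mm Φ e u b s (2 * l) (Set.Ioo 0 (2 * l)) = mm Φ e u b s l (Set.Ioo (-l) l) := by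
    refine mm_trans Φ hhom hF hs hl.le (by positivity) (c := l) measurableSet_Ioo ?_ ?_
    · ext x; simp; intro _; constructor <;> intro h <;> linarith
    · intro a ha
      filter_upwards [lt_mem_nhds ha.1, gt_mem_nhds ha.2] with a' h h'
      rw [abs_le, abs_le]
      constructor <;> rintro ⟨h1, h2⟩ <;> constructor <;> linarith
  have hL : mm Φ e u b s (2 * l) (Set.Ioo (-(2 * l)) 0) = mm Φ e u b s l (Set.Ioo (-l) l) := by
    refine mm_trans Φ hhom hF hs hl.le (by positivity) (c := -l) measurableSet_Ioo ?_ ?_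
    · ext x; simp; intro _; constructor <;> intro h <;> linarith
    · intro a ha
      filter_upwards [lt_mem_nhds ha.1, gt_mem_nhds ha.2] with a' h h'
      rw [abs_le, abs_le]
      constructor <;> rintro ⟨h1, h2⟩ <;> constructor <;> linarith
  have h0 : mm Φ e u b s (2 * l) {0} = 0 := by
    refine vm_const_zero (mm Φ e u b s (2 * l)) _ (fun j : ℕ => {l / (j + 1)}) (fun _ => measurableSet_singleton _) ?_ ?_
    · intro i j hij
      rw [Function.onFun, Set.disjoint_singleton]
      intro h
      apply hij
      field_simp at h
      have : (j : ℝ) = i := by linarith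
      exact_mod_cast this.symm
    · intro j
      have hj : 0 < l / ((j : ℝ) + 1) := by positivity
      have hj2 : l / ((j : ℝ) + 1) ≤ l := div_le_self hl.le (by linarith [Nat.cast_nonneg (α := ℝ) j])
      refine mm_trans Φ hhom hF hs (by positivity) (by positivity) (c := l / (j + 1)) (measurableSet_singleton _) ?_ ?_
      · ext x; simp [sub_eq_zero]
      · intro a ha
        rw [Set.mem_singleton_iff] at ha
        subst ha
        filter_upwards [lt_mem_nhds (neg_lt_zero.2 hl), gt_mem_nhds hl] with a' h h'
        rw [abs_le, abs_le]
        constructor <;> rintro ⟨h1, h2⟩ <;> constructor <;> linarith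
  have h1 : Set.Ioo (-(2 * l)) (2 * l) = (Set.Ioo (-(2 * l)) 0 ∪ {0}) ∪ Set.Ioo 0 (2 * l) := by
    ext x; simp; grind
  have h2 := hsplit (2 * l) (by positivity)
  rw [h1, VectorMeasure.of_union (by
        rw [Set.disjoint_left]; intro x; simp; grind) (measurableSet_Ioo.union (measurableSet_singleton _)) measurableSet_Ioo,
      VectorMeasure.of_union (by rw [Set.disjoint_left]; intro x; simp; intro _ h; exact h.ne) measurableSet_Ioo (measurableSet_singleton _),
      h0, hR, hL, hT, hsplit l hl] at h2
  have h3 : mm Φ e u b s l (Set.Ici l) = 0 := by linear_combination (-1 / 2) * h2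
  rw [mm_apply Φ l measurableSet_Ici] at h3
  exact h3

/-- open top facet -/
def facet (e u : Rn n) (b : Fin k → Rn n) (s : Fin k → ℝ) (l : ℝ) : Set (Rn n) :=
  {x | inner ℝ e x = (0 : ℝ) ∧ inner ℝ u x = l ∧ ∀ i, |inner ℝ (b i) x| < s i}

include hhom hF hs heven hglob in
lemma facet_zero (hn : 2 ≤ n) {l : ℝ} (hl : 0 ≤ l) (W : Submodule ℝ (Rn n))
    (hW : ∀ v, v ∈ W ↔ inner ℝ e v = (0 : ℝ) ∧ inner ℝ u v = (0 : ℝ)) (hWd : Module.finrank ℝ W = d) :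
    Φ.meas (poly (bF e u b s l)) (facet e u b s l) = 0 := by
  have hB := box_body hF hl hs
  obtain ⟨G, hGm, hG0, hG⟩ : ∃ G : Set (Rn n), MeasurableSet G ∧ Φ.meas (poly (bF e u b s l)) G = 0 ∧
      ∀ x ∈ poly (bF e u b s l), (x ∈ G ↔ inner ℝ u x = l) := by
    rcases hl.eq_or_lt with h0 | h0
    · refine ⟨Set.univ, MeasurableSet.univ, hglob _ hB, fun x hx => ?_⟩
      have := (mem_box.1 hx).2.1
      rw [← h0] at this ⊢
      simpa using this
    · refine ⟨{x | l ≤ inner ℝ u x}, measurableSet_le (by fun_prop) (by fun_prop),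
        prism_top Φ hhom heven hglob hF hs h0, fun x hx => ?_⟩
      have := (abs_le.1 (mem_box.1 hx).2.1).2
      constructor
      · intro h; exact le_antisymm this h
      · intro h; exact h.ge
  set B := poly (bF e u b s l) with hBdef
  set O := facet e u b s l with hO
  have hBm : MeasurableSet B := (poly_closed _).measurableSet
  have hOm : MeasurableSet O := by
    have : O = {x | inner ℝ e x = (0 : ℝ)} ∩ {x | inner ℝ u x = l} ∩ ⋂ i, {x | |inner ℝ (b i) x| < s i} := by
      ext x; simp [hO, facet, and_assoc]
    rw [this]
    refine ((measurableSet_eq_fun (by fun_prop) (by fun_prop)).inter (measurableSet_eq_fun (by fun_prop) (by fun_prop))).inter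
      (MeasurableSet.iInter fun i => measurableSet_lt ?_ (by fun_prop))
    exact (by fun_prop : Continuous fun x : Rn n => |(inner ℝ (b i) x : ℝ)|).measurable
  have hOB : O ⊆ B := by
    intro x hx
    exact mem_box.2 ⟨hx.1, by rw [hx.2.1, abs_of_nonneg hl], fun i => (hx.2.2 i).le⟩
  have hOG : O ⊆ G := fun x hx => (hG x (hOB hx)).2 hx.2.1
  have e1 := VectorMeasure.of_add_of_sdiff (v := Φ.meas B) hOm hGm hOG
  have e2 := VectorMeasure.of_add_of_sdiff (v := Φ.meas B) ((hBm.inter hGm).diff hOm) (hGm.diff hOm)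
    (fun x hx => ⟨hx.1.2, hx.2⟩)
  have e3 : Φ.meas B ((G \ O) \ ((B ∩ G) \ O)) = 0 := by
    refine outside_zero hn Φ hhom hB ((hGm.diff hOm).diff ((hBm.inter hGm).diff hOm)) ?_
    rw [Set.disjoint_left]
    rintro x ⟨h1, h2⟩ h3
    exact h2 ⟨⟨h3, h1.1⟩, h1.2⟩
  have e4 : Φ.meas B ((B ∩ G) \ O) = 0 := by
    refine lower_zero Φ ((hBm.inter hGm).diff hOm) (fun x hx => hx.1.1) ?_
    intro A hA γ hγ hγm
    rcases Set.eq_empty_or_nonempty γ with rfl | ⟨x, hx⟩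
    · simp
    refine stratum_zero Φ hhom hA hB ?_ γ (fun y hy => (hγ hy).2) hγm
    obtain ⟨⟨⟨hxB, hxG⟩, hxO⟩, hxA⟩ := hγ hx
    have hxu := (hG x hxB).1 hxG
    have hx' := mem_box.1 hxB
    have hAeq := (mem_stratum hA).1 hxA
    have hmem : ∀ p ∈ bF e u b s l, inner ℝ p.1 x = p.2 → p ∈ A := by
      intro p hp h
      by_contra hpA
      exact (hAeq.2 p hp hpA).ne h
    have hle : lin A ≤ W := by
      intro v hv
      rw [hW]
      exact ⟨hv (e, 0) (hmem _ (by simp [bF]) hx'.1), hv (u, l) (hmem _ (by simp [bF]) hxu)⟩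
    obtain ⟨i, hi⟩ : ∃ i, s i ≤ |inner ℝ (b i) x| := by
      by_contra hcon
      push Not at hcon
      exact hxO ⟨hx'.1, hxu, hcon⟩
    have hi' : |inner ℝ (b i) x| = s i := le_antisymm (hx'.2.2 i) hi
    have hbi : b i ∈ W := (hW _).2 ⟨hF.heb i, hF.hub i⟩
    have hbb : inner ℝ (b i) (b i) = (1 : ℝ) := by
      rw [real_inner_self_eq_norm_sq, hF.on.1 i]; norm_num
    have hbA : b i ∉ lin A := by
      intro hcon
      rcases abs_choice (inner ℝ (b i) x) with h | h
      · have := hcon (b i, s i) (hmem _ (mem_bF_pos i) (by rw [← hi', h]))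
        simp only [hbb] at this
        norm_num at this
      · have := hcon (-b i, s i) (hmem _ (mem_bF_neg i) (by rw [← hi', h, inner_neg_left]))
        simp only [inner_neg_left, hbb] at this
        norm_num at this
    have hlt : lin A < W := lt_of_le_of_ne hle (fun h => hbA (h ▸ hbi))
    have := Submodule.finrank_lt_finrank_of_lt hlt
    omega
  rw [e3, e4] at e2
  rw [hG0, ← e2] at e1
  simpa using e1
end

lemma facet_germ {n k : ℕ} {e u : Rn n} {b : Fin k → Rn n} {s : Fin k → ℝ} {l : ℝ} {x : Rn n}
    (hx : x ∈ facet e u b s l) : ∀ᶠ y in 𝓝 x, (y ∈ poly (bF e u b s l) ↔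
      inner ℝ e (y - x) = (0 : ℝ) ∧ |inner ℝ u y| ≤ l) := by
  have h : ∀ᶠ y in 𝓝 x, ∀ i, |inner ℝ (b i) y| < s i := by
    rw [Filter.eventually_all]
    intro i
    exact (by fun_prop : Continuous fun x : Rn n => |(inner ℝ (b i) x : ℝ)|).continuousAt.eventually
      (gt_mem_nhds (hx.2.2 i))
  filter_upwards [h] with y hy
  rw [mem_box, inner_sub_right, hx.1, sub_zero]
  constructor
  · rintro ⟨h1, h2, _⟩; exact ⟨h1, h2⟩
  · rintro ⟨h1, h2⟩; exact ⟨h1, h2, fun i => (hy i).le⟩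

lemma facet_stratum {n d : ℕ} (hn : 2 ≤ n) (Φ : CurvatureMeasure n) (hhom : Φ.Homogeneous d)
    (heven : ∀ K : Set (Rn n), IsConvexBody K → ∀ β : Set (Rn n), MeasurableSet β →
      Φ.meas (-K) (-β) = Φ.meas K β)
    (hglob : ∀ K : Set (Rn n), IsConvexBody K → Φ.meas K Set.univ = 0)
    {F A : Finset (Rn n × ℝ)} (hA : A ⊆ F) (hP : IsConvexBody (poly F)) (C : SChart F A)
    {e u : Rn n} (hF : Frame e u C.b) (hd : Module.finrank ℝ (lin A) = d)
    (hW : ∀ v, v ∈ lin A ↔ inner ℝ e v = (0 : ℝ) ∧ inner ℝ u v = (0 : ℝ))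
    {l : ℝ} (hl : 0 ≤ l)
    (hcone : ∀ᶠ v : Rn n in 𝓝 0, ((∀ p ∈ A, inner ℝ p.1 v ≤ 0) ↔
      inner ℝ e v = (0 : ℝ) ∧ |inner ℝ u v + l| ≤ l)) :
    ∀ β ⊆ stratum F A, MeasurableSet β → Φ.meas (poly F) β = 0 := by
  have hr := C.hr
  have hboxm : ∀ p q : Fin (Module.finrank ℝ (lin A)) → ℝ, MeasurableSet (Set.univ.pi fun i => Set.Ioo (p i) (q i)) :=
    fun p q => MeasurableSet.univ_pi fun i => measurableSet_Ioo
  have hbox : ∀ p q : Fin (Module.finrank ℝ (lin A)) → ℝ, (∀ i, 0 ≤ p i) → (∀ i, q i ≤ 1) →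
      Φ.meas (poly F) (C.co ⁻¹' (Set.univ.pi fun i => Set.Ioo (p i) (q i)) ∩ stratum F A) = 0 := by
    intro p q hp hq
    by_cases hpq : ∀ i, p i < q i
    swap
    · push Not at hpq
      obtain ⟨i, hi⟩ := hpq
      have : (Set.univ.pi fun i => Set.Ioo (p i) (q i)) = ∅ := by
        rw [Set.univ_pi_eq_empty_iff]; exact ⟨i, Set.Ioo_eq_empty (not_lt.2 hi)⟩
      rw [this]; simp
    set R := C.co ⁻¹' (Set.univ.pi fun i => Set.Ioo (p i) (q i)) ∩ stratum F A with hR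
    have hRm : MeasurableSet R := ((hboxm p q).preimage C.co_meas).inter (stratum_meas hA)
    set s : Fin (Module.finrank ℝ (lin A)) → ℝ := fun i => C.r * ((q i - p i) / 2) with hs
    have hs0 : ∀ i, 0 ≤ s i := fun i => mul_nonneg hr.le (by linarith [hpq i])
    set z0 : Fin (Module.finrank ℝ (lin A)) → ℝ := fun i => (p i + q i) / 2 with hz0
    set w : Rn n := l • u - C.psi z0 with hw
    have hpw : ∀ z, C.psi z + w = l • u + C.r • ∑ i, (z i - z0 i) • C.b i := by
      intro z
      simp only [hw, SChart.psi, sub_smul, Finset.sum_sub_distrib, smul_sub]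
      abel
    have hee : ∀ z, inner ℝ e (C.psi z + w) = (0 : ℝ) := by
      intro z
      rw [hpw, inner_add_right, inner_smul_right, inner_smul_right, hF.heu, inner_sum]
      simp [inner_smul_right, hF.heb]
    have huu : ∀ z, inner ℝ u (C.psi z + w) = l := by
      intro z
      rw [hpw, inner_add_right, inner_smul_right, inner_smul_right, hF.hu, inner_sum]
      simp [inner_smul_right, hF.hub]
    have hbb : ∀ z i, inner ℝ (C.b i) (C.psi z + w) = C.r * (z i - z0 i) := by
      intro z i
      rw [hpw, inner_add_right, inner_smul_right, inner_smul_right, C.on.inner_right_fintype,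
        real_inner_comm u, hF.hub]
      simp
    have hfac : ∀ x ∈ R, x + w ∈ facet e u C.b s l := by
      rintro x ⟨hx1, hx2⟩
      rw [← C.psi_co hA hx2]
      refine ⟨hee _, huu _, fun i => ?_⟩
      rw [hbb, abs_mul, abs_of_pos hr]
      refine mul_lt_mul_of_pos_left ?_ hr
      have := hx1 i (Set.mem_univ i)
      rw [abs_lt]
      simp only [hz0]
      constructor <;> linarith [this.1, this.2]
    have him : (fun y => y + w) '' R = facet e u C.b s l := by
      apply Set.Subset.antisymm
      · rintro _ ⟨x, hx, rfl⟩; exact hfac x hx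
      · intro y hy
        set z : Fin (Module.finrank ℝ (lin A)) → ℝ := fun i => z0 i + inner ℝ (C.b i) y / C.r with hz
        have hzz : ∀ i, z i ∈ Set.Ioo (p i) (q i) := by
          intro i
          have h1 := abs_lt.1 (hy.2.2 i)
          have h2 : -((q i - p i) / 2) < inner ℝ (C.b i) y / C.r := by
            rw [lt_div_iff₀ hr]; simp only [hs] at h1; linarith [h1.1]
          have h3 : inner ℝ (C.b i) y / C.r < ((q i - p i) / 2) := by
            rw [div_lt_iff₀ hr]; simp only [hs] at h1; linarith [h1.2]
          simp only [hz, hz0]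
          constructor <;> linarith
        refine ⟨C.psi z, ⟨?_, C.psi_mem ?_⟩, ?_⟩
        · intro i _
          simp only [C.co_psi]
          exact hzz i
        · intro i
          rw [abs_le]
          constructor <;> linarith [(hzz i).1, (hzz i).2, hp i, hq i]
        · change C.psi z + w = y
          rw [hpw, Finset.smul_sum]
          have : ∀ i, C.r • (z i - z0 i) • C.b i = (inner ℝ (C.b i) (y - l • u) : ℝ) • C.b i := by
            intro i
            rw [smul_smul]
            congr 1
            rw [inner_sub_right, inner_smul_right, real_inner_comm u, hF.hub]
            simp only [hz]
            field_simp
            ring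
          simp only [this]
          rw [hF.span]
          · abel
          · rw [inner_sub_right, inner_smul_right, hF.heu, hy.1]; ring
          · rw [inner_sub_right, inner_smul_right, hF.hu, hy.2.1]; ring
    have h0 := facet_zero Φ hhom heven hglob hF hs0 hn hl (lin A) hW hd
    rw [← him, trans_eq Φ hhom hP (box_body hF hl hs0) w hRm] at h0
    · exact h0
    · intro x hx
      have g1 := germ hx.2.1
      rw [hx.2.2] at g1
      have g2 := facet_germ (hfac x hx)
      have g3 : ∀ᶠ y in 𝓝 x, (y + w ∈ poly (bF e u C.b s l) ↔
        inner ℝ e (y + w - (x + w)) = (0 : ℝ) ∧ |inner ℝ u (y + w)| ≤ l) :=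
        (by fun_prop : Continuous fun y : Rn n => y + w).continuousAt.eventually g2
      have g4 : ∀ᶠ y in 𝓝 x, ((∀ p ∈ A, inner ℝ p.1 (y - x) ≤ 0) ↔
          inner ℝ e (y - x) = (0 : ℝ) ∧ |inner ℝ u (y - x) + l| ≤ l) := by
        have : Tendsto (fun y : Rn n => y - x) (𝓝 x) (𝓝 0) := by
          have := (by fun_prop : Continuous fun y : Rn n => y - x).tendsto x
          simpa using this
        exact this.eventually hcone
      filter_upwards [g1, g3, g4] with y h1 h2 h3
      rw [h1, h2, h3, add_sub_add_right_eq_sub]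
      have : inner ℝ u (y - x) + l = inner ℝ u (y + w) := by
        have h := (hfac x hx).2.1
        rw [inner_add_right] at h ⊢
        rw [inner_sub_right]
        linarith
      rw [this]
  refine shrink Φ hhom hA hP C ?_
  intro β hβ hm hβc
  set cu : Set (Fin (Module.finrank ℝ (lin A)) → ℝ) := Set.univ.pi fun _ => Set.Ioo 0 1 with hcu
  have hcum : MeasurableSet cu := MeasurableSet.univ_pi fun i => measurableSet_Ioo
  set S := stratum F A ∩ C.co ⁻¹' cu with hS
  have hSm : MeasurableSet S := (stratum_meas hA).inter (hcum.preimage C.co_meas)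
  set v : ComplexMeasure (Fin (Module.finrank ℝ (lin A)) → ℝ) := ((Φ.meas (poly F)).restrict S).map C.co with hv
  have hva : ∀ Q, MeasurableSet Q → v Q = Φ.meas (poly F) (C.co ⁻¹' Q ∩ S) := by
    intro Q hQ
    rw [hv, VectorMeasure.map_apply _ C.co_meas hQ, VectorMeasure.restrict_apply _ hSm (hQ.preimage C.co_meas)]
  have hv0 : v = 0 := by
    apply box_zero
    · rw [hva _ MeasurableSet.univ]
      have := hbox (fun _ => 0) (fun _ => 1) (fun _ => le_rfl) (fun _ => le_rfl)
      rw [← this, hS, Set.preimage_univ, Set.univ_inter, Set.inter_comm]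
    · intro a b
      rw [hva _ (hboxm a b)]
      rw [← hbox (fun i => max (a i) 0) (fun i => min (b i) 1) (fun _ => le_max_right _ _) (fun _ => min_le_right _ _)]
      congr 1
      ext x
      simp only [hS, hcu, Set.mem_inter_iff, Set.mem_preimage, Set.mem_univ_pi, Set.mem_Ioo, max_lt_iff, lt_min_iff]
      constructor
      · rintro ⟨h1, h2, h3⟩
        exact ⟨fun i => ⟨⟨(h1 i).1, (h3 i).1⟩, (h1 i).2, (h3 i).2⟩, h2⟩
      · rintro ⟨h1, h2⟩
        exact ⟨fun i => ⟨(h1 i).1.1, (h1 i).2.1⟩, h2, fun i => ⟨(h1 i).1.2, (h1 i).2.2⟩⟩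
  have hpm : Measurable C.psi := by
    have : Continuous C.psi := by unfold SChart.psi; fun_prop
    exact this.measurable
  have := hva (C.psi ⁻¹' β) (hm.preimage hpm)
  rw [hv0] at this
  have hβe : C.co ⁻¹' (C.psi ⁻¹' β) ∩ S = β := by
    ext x
    constructor
    · rintro ⟨h1, h2⟩
      have : C.psi (C.co x) ∈ β := h1
      rwa [C.psi_co hA h2.1] at this
    · intro hx
      refine ⟨?_, hβ hx, fun i _ => hβc x hx i⟩
      change C.psi (C.co x) ∈ β
      rwa [C.psi_co hA (hβ hx)]
  rw [hβe] at this
  simpa using this.symm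

lemma unit_perp {n : ℕ} (L : Submodule ℝ (Rn n)) (hL : Module.finrank ℝ L < n) :
    ∃ u : Rn n, inner ℝ u u = (1 : ℝ) ∧ ∀ v ∈ L, inner ℝ u v = (0 : ℝ) := by
  have hne : L ≠ ⊤ := by
    rintro rfl
    rw [finrank_top, finrank_euclideanSpace_fin] at hL
    exact lt_irrefl _ hL
  have h2 : Lᗮ ≠ ⊥ := fun h => hne ((Submodule.orthogonal_eq_bot_iff).1 h)
  obtain ⟨w, hw, hw0⟩ := Submodule.exists_mem_ne_zero_of_ne_bot h2
  have hwn : 0 < ‖w‖ := norm_pos_iff.2 hw0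
  refine ⟨‖w‖⁻¹ • w, ?_, fun v hv => ?_⟩
  · rw [inner_smul_left, inner_smul_right, real_inner_self_eq_norm_sq]
    simp; field_simp
  · rw [inner_smul_left, Submodule.inner_left_of_mem_orthogonal hv hw, mul_zero]

lemma strat2 {n : ℕ} (hn : 2 ≤ n) (Φ : CurvatureMeasure n) (hhom : Φ.Homogeneous (n - 2))
    (heven : ∀ K : Set (Rn n), IsConvexBody K → ∀ β : Set (Rn n), MeasurableSet β →
      Φ.meas (-K) (-β) = Φ.meas K β)
    (hglob : ∀ K : Set (Rn n), IsConvexBody K → Φ.meas K Set.univ = 0)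
    {F A : Finset (Rn n × ℝ)} (hA : A ⊆ F) (hP : IsConvexBody (poly F))
    {e : Rn n} {c : ℝ} (he : inner ℝ e e = (1 : ℝ)) (h1 : (e, c) ∈ A) (h2 : (-e, -c) ∈ A) :
    ∀ β ⊆ stratum F A, MeasurableSet β → Φ.meas (poly F) β = 0 := by
  by_cases hd : Module.finrank ℝ (lin A) = n - 2
  swap
  · exact stratum_zero Φ hhom hA hP hd
  intro β hβ hm
  rcases Set.eq_empty_or_nonempty β with rfl | ⟨x0, hx0⟩
  · simp
  obtain ⟨C, -⟩ := schart_exists hA (hβ hx0)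
  revert β
  rintro β hβ hm -
  -- the second normal
  obtain ⟨u, hu, hul⟩ := unit_perp (lin A ⊔ Submodule.span ℝ {e}) (by
    have := Submodule.finrank_add_le_finrank_add_finrank (lin A) (Submodule.span ℝ {e})
    have h := finrank_span_singleton (K := ℝ) (v := e) (by rintro rfl; simp at he)
    omega)
  have hue : inner ℝ u e = (0 : ℝ) := hul e (Submodule.mem_sup_right (Submodule.mem_span_singleton_self e))
  have heu : inner ℝ e u = (0 : ℝ) := by rw [real_inner_comm]; exact hue
  have hev : ∀ v ∈ lin A, inner ℝ e v = (0 : ℝ) := fun v hv => hv (e, c) h1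
  have huv : ∀ v ∈ lin A, inner ℝ u v = (0 : ℝ) := fun v hv => hul v (Submodule.mem_sup_left hv)
  have hnn : ∀ v : Rn n, v ∈ Submodule.span ℝ {e, u} ↔ v = (inner ℝ e v : ℝ) • e + (inner ℝ u v : ℝ) • u := by
    intro v
    constructor
    · intro h
      obtain ⟨a, b, rfl⟩ := Submodule.mem_span_pair.1 h
      simp only [inner_add_right, inner_smul_right, he, hu, hue, heu]
      simp
    · intro h
      rw [h]
      exact Submodule.mem_span_pair.2 ⟨_, _, rfl⟩
  have hspan : Module.finrank ℝ (Submodule.span ℝ {e, u}) = 2 := by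
    have hli : LinearIndependent ℝ ![e, u] := by
      rw [LinearIndependent.pair_iff]
      intro s t hst
      have a1 := congrArg (fun v => (inner ℝ e v : ℝ)) hst
      have a2 := congrArg (fun v => (inner ℝ u v : ℝ)) hst
      simp only [inner_add_right, inner_smul_right, he, hu, hue, heu, inner_zero_right] at a1 a2
      exact ⟨by linarith, by linarith⟩
    have := finrank_span_eq_card hli
    have hr : Set.range ![e, u] = {e, u} := by
      ext x; simp [eq_comm]; tauto
    rw [hr] at this
    simpa using this
  have hperp : lin A = (Submodule.span ℝ {e, u})ᗮ := by
    apply Submodule.eq_of_le_of_finrank_eq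
    · intro v hv
      rw [Submodule.mem_orthogonal]
      intro w hw
      obtain ⟨a, b, rfl⟩ := Submodule.mem_span_pair.1 hw
      rw [inner_add_left, inner_smul_left, inner_smul_left, hev v hv, huv v hv]; simp
    · have := Submodule.finrank_add_finrank_orthogonal (Submodule.span ℝ {e, u})
      rw [hspan, finrank_euclideanSpace_fin] at this
      omega
  have hW : ∀ v, v ∈ lin A ↔ inner ℝ e v = (0 : ℝ) ∧ inner ℝ u v = (0 : ℝ) := by
    intro v
    refine ⟨fun hv => ⟨hev v hv, huv v hv⟩, fun hv => ?_⟩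
    rw [hperp, Submodule.mem_orthogonal]
    intro w hw
    obtain ⟨a, b, rfl⟩ := Submodule.mem_span_pair.1 hw
    rw [inner_add_left, inner_smul_left, inner_smul_left, hv.1, hv.2]; simp
  have hpA : ∀ p ∈ A, ∀ v, inner ℝ p.1 v = (inner ℝ e p.1 : ℝ) * inner ℝ e v + (inner ℝ u p.1 : ℝ) * inner ℝ u v := by
    intro p hp v
    have : p.1 ∈ (lin A)ᗮ := by
      rw [Submodule.mem_orthogonal]
      intro w hw
      rw [real_inner_comm]; exact hw p hp
    rw [hperp, Submodule.orthogonal_orthogonal, hnn] at this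
    conv_lhs => rw [this]
    rw [inner_add_left, inner_smul_left, inner_smul_left]; simp
  have hex : ∃ p ∈ A, (inner ℝ u p.1 : ℝ) ≠ 0 := by
    by_contra hcon
    push Not at hcon
    have : u ∈ lin A := by
      intro p hp
      rw [real_inner_comm]; exact hcon p hp
    have := (hW u).1 this
    rw [hu] at this
    exact one_ne_zero this.2
  have hcA : ∀ v, (∀ p ∈ A, inner ℝ p.1 v ≤ 0) ↔
      (inner ℝ e v = (0 : ℝ) ∧ ∀ p ∈ A, (inner ℝ u p.1 : ℝ) * inner ℝ u v ≤ 0) := by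
    intro v
    constructor
    · intro h
      have a1 := h _ h1
      have a2 := h _ h2
      simp only [inner_neg_left] at a1 a2
      have a3 : inner ℝ e v = (0 : ℝ) := by linarith
      refine ⟨a3, fun p hp => ?_⟩
      have := h p hp
      rw [hpA p hp, a3] at this
      linarith
    · rintro ⟨a1, a2⟩ p hp
      rw [hpA p hp, a1]
      linarith [a2 p hp]
  have hfr : ∀ u' : Rn n, (u' = u ∨ u' = -u) → Frame e u' C.b ∧
      (∀ v, v ∈ lin A ↔ inner ℝ e v = (0 : ℝ) ∧ inner ℝ u' v = (0 : ℝ)) := by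
    intro u' hu'
    have hW' : ∀ v, v ∈ lin A ↔ inner ℝ e v = (0 : ℝ) ∧ inner ℝ u' v = (0 : ℝ) := by
      rcases hu' with rfl | rfl
      · exact hW
      · intro v; rw [hW v, inner_neg_left, neg_eq_zero]
    refine ⟨⟨he, ?_, ?_, C.on, fun i => ((hW' _).1 (C.blin i)).1, fun i => ((hW' _).1 (C.blin i)).2,
      fun v a1 a2 => C.span v ((hW' v).2 ⟨a1, a2⟩)⟩, hW'⟩
    · rcases hu' with rfl | rfl
      · exact hu
      · rw [inner_neg_neg, hu]
    · rcases hu' with rfl | rfl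
      · exact heu
      · rw [inner_neg_right, heu, neg_zero]
  -- half-space case
  have hhalf : ∀ u' : Rn n, (u' = u ∨ u' = -u) → (∀ p ∈ A, (0 : ℝ) ≤ inner ℝ u' p.1) →
      Φ.meas (poly F) β = 0 := by
    intro u' hu' hpos
    obtain ⟨fr, hW'⟩ := hfr u' hu'
    refine facet_stratum hn Φ hhom heven hglob hA hP C fr hd hW' (l := 1) zero_le_one ?_ β hβ hm
    have : ∀ᶠ v : Rn n in 𝓝 0, -2 < (inner ℝ u' v : ℝ) := by
      refine (by fun_prop : Continuous fun v : Rn n => (inner ℝ u' v : ℝ)).continuousAt.eventually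
        (lt_mem_nhds ?_)
      simp
    filter_upwards [this] with v hv
    rw [hcA]
    refine and_congr_right fun _ => ?_
    have hsame : ∀ p : Rn n × ℝ, (inner ℝ u p.1 : ℝ) * inner ℝ u v = (inner ℝ u' p.1 : ℝ) * inner ℝ u' v := by
      intro p
      rcases hu' with rfl | rfl
      · rfl
      · simp only [inner_neg_left]; ring
    simp only [hsame]
    constructor
    · intro h
      obtain ⟨p, hp, hp0⟩ := hex
      have hp1 : 0 < (inner ℝ u' p.1 : ℝ) := by
        refine lt_of_le_of_ne (hpos p hp) (Ne.symm ?_)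
        rcases hu' with rfl | rfl
        · exact hp0
        · rw [inner_neg_left]; exact neg_ne_zero.2 hp0
      have h3 : (inner ℝ u' v : ℝ) ≤ 0 := by
        by_contra hc
        push Not at hc
        have := mul_pos hp1 hc
        linarith [h p hp]
      rw [abs_le]; constructor <;> linarith
    · intro h p hp
      have := (abs_le.1 h).2
      exact mul_nonpos_of_nonneg_of_nonpos (hpos p hp) (by linarith)
  by_cases c1 : ∀ p ∈ A, (0 : ℝ) ≤ inner ℝ u p.1
  · exact hhalf u (Or.inl rfl) c1
  by_cases c2 : ∀ p ∈ A, (inner ℝ u p.1 : ℝ) ≤ 0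
  · refine hhalf (-u) (Or.inr rfl) fun p hp => ?_
    rw [inner_neg_left]; linarith [c2 p hp]
  push Not at c1 c2
  obtain ⟨p, hp, hp'⟩ := c1
  obtain ⟨q, hq, hq'⟩ := c2
  obtain ⟨fr, hW'⟩ := hfr u (Or.inl rfl)
  refine facet_stratum hn Φ hhom heven hglob hA hP C fr hd hW' (l := 0) le_rfl ?_ β hβ hm
  refine Filter.Eventually.of_forall fun v => ?_
  rw [hcA]
  refine and_congr_right fun _ => ?_
  rw [add_zero, abs_nonpos_iff]
  constructor
  · intro h
    have a1 := h p hp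
    have a2 := h q hq
    apply le_antisymm
    · by_contra hc
      push Not at hc
      linarith [mul_pos hq' hc]
    · by_contra hc
      push Not at hc
      linarith [mul_pos_of_neg_of_neg hp' hc]
  · intro h p _
    rw [h, mul_zero]

lemma poly_zero {n : ℕ} (hn : 2 ≤ n) (Φ : CurvatureMeasure n) (hhom : Φ.Homogeneous (n - 2))
    (heven : ∀ K : Set (Rn n), IsConvexBody K → ∀ β : Set (Rn n), MeasurableSet β →
      Φ.meas (-K) (-β) = Φ.meas K β)
    (hglob : ∀ K : Set (Rn n), IsConvexBody K → Φ.meas K Set.univ = 0)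
    {F : Finset (Rn n × ℝ)} (hP : IsConvexBody (poly F))
    {e : Rn n} {c : ℝ} (he : inner ℝ e e = (1 : ℝ)) (h1 : (e, c) ∈ F) (h2 : (-e, -c) ∈ F) :
    Φ.meas (poly F) = 0 := by
  ext β hβ
  have hPm : MeasurableSet (poly F) := (poly_closed F).measurableSet
  have e1 := VectorMeasure.of_add_of_sdiff (v := Φ.meas (poly F)) (hβ.inter hPm) hβ Set.inter_subset_left
  have e2 : Φ.meas (poly F) (β \ (β ∩ poly F)) = 0 := by
    refine outside_zero hn Φ hhom hP (hβ.diff (hβ.inter hPm)) ?_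
    rw [Set.disjoint_left]
    rintro x ⟨a1, a2⟩ a3
    exact a2 ⟨a1, a3⟩
  have e3 : Φ.meas (poly F) (β ∩ poly F) = 0 := by
    refine lower_zero Φ (hβ.inter hPm) Set.inter_subset_right ?_
    intro A hA γ hγ hγm
    rcases Set.eq_empty_or_nonempty γ with rfl | ⟨x, hx⟩
    · simp
    obtain ⟨⟨_, hxP⟩, hxA⟩ := hγ hx
    have a1 := hxP _ h1
    have a2 := hxP _ h2
    simp only [inner_neg_left] at a1 a2
    have hAeq := (mem_stratum hA).1 hxA
    have hmem : ∀ p ∈ F, inner ℝ p.1 x = p.2 → p ∈ A := by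
      intro p hp h
      by_contra hpA
      exact (hAeq.2 p hp hpA).ne h
    refine strat2 hn Φ hhom heven hglob hA hP he (hmem _ h1 ?_) (hmem _ h2 ?_) γ (fun y hy => (hγ hy).2) hγm
    · simp only; linarith
    · simp only [inner_neg_left]; linarith
  rw [e2, e3] at e1
  simpa using e1.symm

lemma approx {n : ℕ} {K : Set (Rn n)} (hK : IsConvexBody K) (F0 : Finset (Rn n × ℝ)) (hF0 : K ⊆ poly F0)
    {ε : ℝ} (hε : 0 < ε) :
    ∃ F, F0 ⊆ F ∧ IsConvexBody (poly F) ∧ hausdorffDist (poly F) K ≤ ε := by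
  classical
  obtain ⟨hKne, hKc, hKconv⟩ := hK
  have hcont : Continuous fun y : Rn n => infDist y K := continuous_infDist_pt K
  set T : Set (Rn n) := {y | infDist y K = ε} with hT
  have hbd : ∀ r, Bornology.IsBounded {y : Rn n | infDist y K ≤ r} := by
    intro r
    have := hKc.isBounded.thickening (δ := r + 1)
    refine this.subset fun y hy => ?_
    rw [mem_thickening_iff_infDist_lt hKne]
    exact lt_of_le_of_lt hy (by linarith)
  have hTc : IsCompact T := by
    refine isCompact_of_isClosed_isBounded (isClosed_eq hcont continuous_const) ((hbd ε).subset ?_)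
    intro y hy; exact le_of_eq hy
  have hsep : ∀ y : Rn n, ∃ p : Rn n × ℝ, y ∈ T → ((∀ a ∈ K, inner ℝ p.1 a ≤ p.2) ∧ p.2 < inner ℝ p.1 y) := by
    intro y
    by_cases hy : y ∈ T
    · have hyK : y ∉ K := by
        intro h
        have : infDist y K = ε := hy
        rw [infDist_zero_of_mem h] at this
        linarith
      obtain ⟨f, u, h1, h2⟩ := geometric_hahn_banach_closed_point hKconv hKc.isClosed hyK
      refine ⟨((InnerProductSpace.toDual ℝ (Rn n)).symm f, u), fun _ => ⟨fun a ha => ?_, ?_⟩⟩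
      · simpa using (h1 a ha).le
      · simpa using h2
    · exact ⟨0, fun h => absurd h hy⟩
  choose p hp using hsep
  obtain ⟨t, ht, htT⟩ := hTc.elim_nhds_subcover (fun y => {z | (p y).2 < inner ℝ (p y).1 z}) (by
    intro y hy
    exact (isOpen_lt (by fun_prop) (by fun_prop)).mem_nhds (hp y hy).2)
  set F := F0 ∪ t.image p with hF
  have hKF : K ⊆ poly F := by
    intro x hx q hq
    rcases Finset.mem_union.1 hq with hq | hq
    · exact hF0 hx q hq
    · obtain ⟨y, hy, rfl⟩ := Finset.mem_image.1 hq
      exact (hp y (ht y hy)).1 x hx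
  have hdis : ∀ x ∈ poly F, infDist x K ≠ ε := by
    intro x hx h
    have := htT h
    simp only [Set.mem_iUnion] at this
    obtain ⟨y, hy, hxy⟩ := this
    have h1 := hx (p y) (Finset.mem_union_right _ (Finset.mem_image_of_mem _ hy))
    exact absurd hxy (not_lt.2 h1)
  have hle : ∀ x ∈ poly F, infDist x K ≤ ε := by
    intro x hx
    by_contra hc
    push Not at hc
    obtain ⟨k, hk⟩ := hKne
    have hpre : IsPreconnected (poly F) := (poly_convex F).isPreconnected
    have := hpre.intermediate_value (hKF hk) hx hcont.continuousOn
    obtain ⟨y, hy, hy'⟩ := this (show ε ∈ Set.Icc (infDist k K) (infDist x K) from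
      ⟨by rw [infDist_zero_of_mem hk]; exact hε.le, hc.le⟩)
    exact hdis y hy hy'
  refine ⟨F, Finset.subset_union_left, ⟨hKne.mono hKF,
    isCompact_of_isClosed_isBounded (poly_closed F) ((hbd ε).subset hle), poly_convex F⟩, ?_⟩
  refine hausdorffDist_le_of_infDist hε.le hle fun x hx => ?_
  rw [infDist_zero_of_mem (hKF hx)]; exact hε.le

lemma hyper_exists {n : ℕ} {K : Set (Rn n)} (hK : IsConvexBody K) (hint : interior K = ∅) :
    ∃ e : Rn n, ∃ c : ℝ, inner ℝ e e = (1 : ℝ) ∧ ∀ x ∈ K, inner ℝ e x = c := by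
  have h1 : affineSpan ℝ K ≠ ⊤ := by
    intro h
    rw [← hK.2.2.interior_nonempty_iff_affineSpan_eq_top, hint] at h
    exact Set.not_nonempty_empty h
  obtain ⟨x0, hx0⟩ := hK.1
  have hd : (affineSpan ℝ K).direction ≠ ⊤ := by
    intro h
    exact h1 ((AffineSubspace.direction_eq_top_iff_of_nonempty ⟨x0, subset_affineSpan ℝ K hx0⟩).1 h)
  obtain ⟨e, he, hev⟩ := unit_perp (affineSpan ℝ K).direction (by
    have := Submodule.finrank_lt hd
    rwa [finrank_euclideanSpace_fin] at this)
  refine ⟨e, inner ℝ e x0, he, fun x hx => ?_⟩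
  have := hev (x -ᵥ x0) (AffineSubspace.vsub_mem_direction (subset_affineSpan ℝ K hx) (subset_affineSpan ℝ K hx0))
  rw [vsub_eq_sub, inner_sub_right] at this
  linarith

lemma cm_zero {n : ℕ} (f : Rn n → ℂ) : cmIntegral (0 : ComplexMeasure (Rn n)) f = 0 := by
  have h1 : ComplexMeasure.re (0 : ComplexMeasure (Rn n)) = 0 := map_zero _
  have h2 : ComplexMeasure.im (0 : ComplexMeasure (Rn n)) = 0 := map_zero _
  simp [cmIntegral, h1, h2, SignedMeasure.toJordanDecomposition_zero]

lemma signed_zero {n : ℕ} (s : SignedMeasure (Rn n)) (h : ∀ f : BoundedContinuousFunction (Rn n) ℝ,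
    ∫ x, f x ∂s.toJordanDecomposition.posPart = ∫ x, f x ∂s.toJordanDecomposition.negPart) : s = 0 := by
  have := ext_of_forall_integral_eq_of_IsFiniteMeasure h
  rw [← s.toSignedMeasure_toJordanDecomposition, JordanDecomposition.toSignedMeasure]
  simp only [this, sub_self]

lemma cm_eq_zero {n : ℕ} (μ : ComplexMeasure (Rn n))
    (h : ∀ f : BoundedContinuousFunction (Rn n) ℂ, cmIntegral μ f = 0) : μ = 0 := by
  have aux : ∀ a b c d : ℝ, (a : ℂ) - b + Complex.I * (c - d) = 0 → a = b ∧ c = d := by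
    intro a b c d hg
    have hr := congrArg Complex.re hg
    have hi := congrArg Complex.im hg
    simp at hr hi
    exact ⟨by linarith, by linarith⟩
  have key : ∀ g : BoundedContinuousFunction (Rn n) ℝ,
    (∫ x, g x ∂(ComplexMeasure.re μ).toJordanDecomposition.posPart =
      ∫ x, g x ∂(ComplexMeasure.re μ).toJordanDecomposition.negPart) ∧
    (∫ x, g x ∂(ComplexMeasure.im μ).toJordanDecomposition.posPart =
      ∫ x, g x ∂(ComplexMeasure.im μ).toJordanDecomposition.negPart) := by
    intro g
    have hg := h (BoundedContinuousFunction.ofNormedAddCommGroup (fun x => (g x : ℂ))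
      (Complex.continuous_ofReal.comp g.continuous) ‖g‖ (fun x => by
        simpa using g.norm_coe_le_norm x))
    simp only [cmIntegral, BoundedContinuousFunction.coe_ofNormedAddCommGroup, integral_complex_ofReal] at hg
    exact aux _ _ _ _ hg
  have h1 := signed_zero _ fun g => (key g).1
  have h2 := signed_zero _ fun g => (key g).2
  ext i hi
  have e1 := congrArg (fun s : SignedMeasure (Rn n) => s i) h1
  have e2 := congrArg (fun s : SignedMeasure (Rn n) => s i) h2
  simp only [ComplexMeasure.re_apply, ComplexMeasure.im_apply] at e1 e2
  exact Complex.ext e1 e2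

/-- An even translation invariant curvature measure of degree n−2 that globalizes to zero
is simple: it vanishes on every convex body with empty interior. -/
theorem even_degree_n_sub_two_glob_zero_is_simple (n : ℕ) (hn : 2 ≤ n)
    (Φ : CurvatureMeasure n) (hhom : Φ.Homogeneous (n - 2))
    (heven : ∀ K : Set (Rn n), IsConvexBody K → ∀ β : Set (Rn n), MeasurableSet β →
      Φ.meas (-K) (-β) = Φ.meas K β)
    (hglob : ∀ K : Set (Rn n), IsConvexBody K → Φ.meas K Set.univ = 0) :
    ∀ K : Set (Rn n), IsConvexBody K → interior K = ∅ →
      ∀ β : Set (Rn n), MeasurableSet β → Φ.meas K β = 0 := by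
  classical
  intro K hK hint β hβ
  obtain ⟨e, c, he, hec⟩ := hyper_exists hK hint
  have hF0 : K ⊆ poly ({(e, c), (-e, -c)} : Finset (Rn n × ℝ)) := by
    intro x hx p hp
    simp only [Finset.mem_insert, Finset.mem_singleton] at hp
    rcases hp with rfl | rfl
    · exact (hec x hx).le
    · simp [hec x hx]
  have := fun m : ℕ => approx hK _ hF0 (ε := 1 / ((m : ℝ) + 1)) (by positivity)
  choose F h1 h2 h3 using this
  have hz : ∀ m, Φ.meas (poly (F m)) = 0 := fun m =>
    poly_zero hn Φ hhom heven hglob (h2 m) he (h1 m (Finset.mem_insert_self _ _))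
      (h1 m (Finset.mem_insert_of_mem (Finset.mem_singleton_self _)))
  have hlim : Tendsto (fun m => hausdorffDist (poly (F m)) K) atTop (𝓝 0) :=
    squeeze_zero (fun _ => hausdorffDist_nonneg) h3 tendsto_one_div_add_atTop_nhds_zero_nat
  have : Φ.meas K = 0 := by
    apply cm_eq_zero
    intro f
    have ht := Φ.continuity _ K h2 hK hlim f
    simp only [hz, cm_zero] at ht
    exact tendsto_nhds_unique ht tendsto_const_nhds
  rw [this]; rfl
end

section
/- Let Φ be a translation invariant curvature measure on ℝⁿ. Then for every convex body K, the support of the complex measure Φ(K,·) is contained in K. -/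
open MeasureTheory Metric Filter Topology
open scoped Pointwise

/-- The support of a Borel measure: the set of points all of whose open neighborhoods have
nonzero measure. -/
def measureSupport {n : ℕ} (μ : Measure (Rn n)) : Set (Rn n) :=
  {x | ∀ U : Set (Rn n), x ∈ U → IsOpen U → μ U ≠ 0}

theorem totalVariation_null_aux {α : Type*} [MeasurableSpace α] (s : SignedMeasure α) (U : Set α)
    (hU : MeasurableSet U) (h : ∀ β, MeasurableSet β → β ⊆ U → s β = 0) :
    s.totalVariation U = 0 := by
  obtain ⟨i, hi, h1, h2, h3, h4⟩ := s.toJordanDecomposition_spec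
  have e1 : s (i ∩ U) = 0 := h _ (hi.inter hU) Set.inter_subset_right
  have e2 : s (iᶜ ∩ U) = 0 := h _ (hi.compl.inter hU) Set.inter_subset_right
  rw [SignedMeasure.totalVariation, Measure.add_apply, h3, h4,
    SignedMeasure.toMeasureOfZeroLE_apply _ _ hi hU,
    SignedMeasure.toMeasureOfLEZero_apply _ _ hi.compl hU]
  have z1 : ∀ hp, NNReal.mk (s (i ∩ U)) hp = 0 := fun hp => NNReal.eq e1
  have z2 : ∀ hp, NNReal.mk (-s (iᶜ ∩ U)) hp = 0 := fun hp => NNReal.eq (neg_eq_zero.2 e2)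
  rw [z1, z2]
  simp

theorem curvatureMeasure_null_aux {n : ℕ} (Φ : CurvatureMeasure n) (K U : Set (Rn n))
    (hK : IsConvexBody K) (hU : IsOpen U) (hUb : Bornology.IsBounded U) (hd : Disjoint K U)
    (e : Rn n) (he : ‖e‖ = 1) (β : Set (Rn n)) (hβ : MeasurableSet β) (hβU : β ⊆ U) :
    Φ.meas K β = 0 := by
  obtain ⟨R, hR⟩ := (hK.2.1.isBounded.union hUb).subset_closedBall 0
  have hR' : ∀ y ∈ K ∪ U, ‖y‖ ≤ R := fun y hy => by simpa using hR hy
  have hR0 : 0 ≤ R := by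
    obtain ⟨k, hk⟩ := hK.1
    exact (norm_nonneg _).trans (hR' k (Or.inl hk))
  set x : ℕ → Rn n := fun i => ((i : ℝ) * (2 * R + 1)) • e with hx
  have hsep : ∀ i j : ℕ, i ≠ j → ∀ u ∈ K ∪ U, ∀ v ∈ K ∪ U, u + x i ≠ v + x j := by
    intro i j hij u hu v hv huv
    have h1 : u - v = (((j : ℝ) - i) * (2 * R + 1)) • e := by
      rw [sub_mul, sub_smul, sub_eq_sub_iff_add_eq_add, huv]
      exact add_comm _ _
    have h2 : ‖u - v‖ = |(j : ℝ) - i| * (2 * R + 1) := by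
      rw [h1, norm_smul, he, mul_one, Real.norm_eq_abs, abs_mul,
        abs_of_nonneg (by linarith : 0 ≤ 2 * R + 1)]
    have h3 : (1 : ℝ) ≤ |(j : ℝ) - i| := by
      have : (1 : ℤ) ≤ |(j : ℤ) - i| := Int.one_le_abs (by omega)
      exact_mod_cast this
    have h4 := norm_sub_le u v
    have h5 := hR' u hu
    have h6 := hR' v hv
    nlinarith
  have key : ∀ i, Φ.meas K ((fun y => y + x i) '' β) = Φ.meas K β := by
    intro i
    set K' := (fun y => y + (- x i)) '' K with hK'
    have hKb : IsConvexBody K' := by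
      refine ⟨hK.1.image _, hK.2.1.image (by fun_prop), ?_⟩
      have := hK.2.2.translate (- x i)
      simpa [hK', add_comm] using this
    have hKK : (fun y => y + x i) '' K' = K := by
      rw [hK', Set.image_image]; simp
    have t := Φ.translation_invariant K' hKb (x i) β hβ
    rw [hKK] at t
    rw [t]
    refine Φ.locality K' K U hKb hK hU ?_ β hβ hβU
    rw [hd.inter_eq, Set.eq_empty_iff_forall_notMem]
    rintro _ ⟨⟨k, hk, rfl⟩, hu⟩
    rcases Nat.eq_zero_or_pos i with rfl | hi
    · have : k ∈ U := by simpa [hx] using hu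
      exact Set.disjoint_left.1 hd hk this
    · refine hsep 0 i hi.ne k (Or.inl hk) _ (Or.inr hu) ?_
      simp [hx]
  have hm : ∀ i, MeasurableSet ((fun y => y + x i) '' β) := fun i =>
    (MeasurableEquiv.addRight (x i)).measurableSet_image.2 hβ
  have hs := (Φ.meas K).m_iUnion (f := fun i => (fun y => y + x i) '' β) hm (by
    intro i j hij
    refine Set.disjoint_left.2 ?_
    rintro _ ⟨u, hu, rfl⟩ ⟨v, hv, hvu⟩
    exact hsep i j hij u (Or.inr (hβU hu)) v (Or.inr (hβU hv)) hvu.symm)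
  simp only [key] at hs
  exact (summable_const_iff _).1 hs.summable

/-- For every translation invariant curvature measure Φ and every convex body K, the support
of the complex measure Φ(K,·) (i.e. of its total variation measure) is contained in K. -/
theorem curvatureMeasure_support_subset (n : ℕ) (Φ : CurvatureMeasure n) :
    ∀ K : Set (Rn n), IsConvexBody K →
      measureSupport (cmVariation (Φ.meas K)) ⊆ K := by
  intro K hK x hx
  by_contra hxK
  obtain ⟨r, hr, hrK⟩ := Metric.isOpen_iff.1 hK.2.1.isClosed.isOpen_compl x hxK
  have hd : Disjoint K (ball x r) := (Set.subset_compl_iff_disjoint_left.1 hrK)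
  obtain ⟨k, hk⟩ := hK.1
  have hkx : k - x ≠ 0 := fun h => hxK (by rwa [← sub_eq_zero.1 h])
  have he : ‖(‖k - x‖⁻¹ : ℝ) • (k - x)‖ = 1 := by
    rw [norm_smul, norm_inv, norm_norm, inv_mul_cancel₀ (norm_ne_zero_iff.2 hkx)]
  have hn := curvatureMeasure_null_aux Φ K (ball x r) hK isOpen_ball isBounded_ball hd _ he
  refine hx (ball x r) (mem_ball_self hr) isOpen_ball ?_
  rw [cmVariation, Measure.add_apply,
    totalVariation_null_aux _ _ measurableSet_ball, totalVariation_null_aux _ _ measurableSet_ball,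
    add_zero]
  · intro β hβ hb
    change (Φ.meas K β).im = 0
    rw [hn β hβ hb]; rfl
  · intro β hβ hb
    change (Φ.meas K β).re = 0
    rw [hn β hβ hb]; rfl
end
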